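/- Let M be an o-minimal structure and let (X,τ) be a definable topological space in M. Then (X,τ) is definably compact if and only if every consistent definable family of τ-closed subsets of X has a finite transversal contained in X. -/

import Mathlib

open FirstOrder Set

/-- `M` is an o-minimal `L`-structure: a densely linearly ordered structure without endpoints,
whose order is `∅`-definable, and in which every definable (with parameters) subset of `M`
is a finite union of points and open intervals with endpoints in `M ∪ {±∞}`. -/
def IsOMinimal (L : FirstOrder.Language) (M : Type*) [L.Structure M] [LinearOrder M] : Prop :=
  Nonempty M ∧ DenselyOrdered M ∧ NoMinOrder M ∧ NoMaxOrder M ∧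
  Set.Definable (∅ : Set M) L {v : Fin 2 → M | v 0 < v 1} ∧
  ∀ s : Set M, Set.Definable₁ (Set.univ : Set M) L s →
    ∃ F : Finset (Set M), s = ⋃₀ (F : Set (Set M)) ∧
      ∀ t ∈ F, (∃ a : M, t = {a}) ∨ (∃ a b : M, t = Set.Ioo a b) ∨
        (∃ a : M, t = Set.Ioi a) ∨ (∃ a : M, t = Set.Iio a) ∨ t = Set.univ

/-- The fiber over `u` of a set `D ⊆ M^{m+n}`, i.e. the set `φ(u, M^n)`. -/
def famFiber {M : Type*} {m n : ℕ} (D : Set (Fin m ⊕ Fin n → M)) (u : Fin m → M) :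
    Set (Fin n → M) :=
  {v | Sum.elim u v ∈ D}

/-- An `A`-definable family of subsets of `M^n`: the family of fibers `φ(u, M^n)` for `u`
ranging over an `A`-definable index set `Ω`, where `φ` is `A`-definable. -/
def IsDefFamily (L : FirstOrder.Language) {M : Type*} [L.Structure M] (A : Set M) (n : ℕ)
    (S : Set (Set (Fin n → M))) : Prop :=
  ∃ (m : ℕ) (Ω : Set (Fin m → M)) (D : Set (Fin m ⊕ Fin n → M)),
    Set.Definable A L Ω ∧ Set.Definable A L D ∧ S = famFiber D '' Ω

/-- A family of sets is downward directed: it does not contain `∅` and any two members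
contain a common member. -/
def DirectedFam {α : Type*} (S : Set (Set α)) : Prop :=
  ∅ ∉ S ∧ ∀ X ∈ S, ∀ Y ∈ S, ∃ Z ∈ S, Z ⊆ X ∩ Y

/-- `S` is finer than `F`: every member of `F` contains a member of `S`. -/
def FinerThan {α : Type*} (S F : Set (Set α)) : Prop :=
  ∀ X ∈ F, ∃ Y ∈ S, Y ⊆ X

/-- A (complete) `n`-type over `M`: an ultrafilter on the Boolean algebra of definable
subsets of `M^n`. -/
def IsTypeOn (L : FirstOrder.Language) {M : Type*} [L.Structure M] (n : ℕ)
    (p : Set (Set (Fin n → M))) : Prop :=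
  (∀ X ∈ p, Set.Definable (Set.univ : Set M) L X) ∧
  ∅ ∉ p ∧
  (∀ X ∈ p, ∀ Y ∈ p, X ∩ Y ∈ p) ∧
  (∀ X ∈ p, ∀ Y : Set (Fin n → M), Set.Definable (Set.univ : Set M) L Y → X ⊆ Y → Y ∈ p) ∧
  (∀ X : Set (Fin n → M), Set.Definable (Set.univ : Set M) L X → X ∈ p ∨ Xᶜ ∈ p)

/-- A type `p` is `A`-definable if for every `∅`-definable `D ⊆ M^{m+n}` the set of
parameters `u` with `φ(u, M^n) ∈ p` is `A`-definable. -/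
def IsDefTypeOver (L : FirstOrder.Language) {M : Type*} [L.Structure M] (A : Set M) (n : ℕ)
    (p : Set (Set (Fin n → M))) : Prop :=
  ∀ (m : ℕ) (D : Set (Fin m ⊕ Fin n → M)), Set.Definable (∅ : Set M) L D →
    Set.Definable A L {u : Fin m → M | famFiber D u ∈ p}

/-- A family `F` is complete for a family `X` if each member of `X` either contains a member
of `F` or is disjoint from one. -/
def CompleteFor {α : Type*} (F X : Set (Set α)) : Prop :=
  ∀ Y ∈ X, ∃ Z ∈ F, Z ⊆ Y ∨ Z ∩ Y = ∅

/-- A family of subsets of `M^n` is complete if it decides every definable set. -/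
def IsCompleteFam (L : FirstOrder.Language) {M : Type*} [L.Structure M] (n : ℕ)
    (S : Set (Set (Fin n → M))) : Prop :=
  ∀ X : Set (Fin n → M), Set.Definable (Set.univ : Set M) L X → ∃ Z ∈ S, Z ⊆ X ∨ Z ∩ X = ∅

/-- `B` is a basis for the type `p`: a downward directed subfamily generating `p`. -/
def IsBasisOfType {α : Type*} (B p : Set (Set α)) : Prop :=
  B ⊆ p ∧ DirectedFam B ∧ ∀ Y ∈ p, ∃ Z ∈ B, Z ⊆ Y

/-- `p` has an `A`-definable basis. -/
def HasDefBasis (L : FirstOrder.Language) {M : Type*} [L.Structure M] (A : Set M) (n : ℕ)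
    (p : Set (Set (Fin n → M))) : Prop :=
  ∃ B, IsDefFamily L A n B ∧ IsBasisOfType B p

/-- `S` has a finite tame transversal: it is covered by finitely many subfamilies, each of
which extends to a definable type. -/
def HasFTT (L : FirstOrder.Language) {M : Type*} [L.Structure M] (n : ℕ)
    (S : Set (Set (Fin n → M))) : Prop :=
  ∃ (N : ℕ) (p : Fin N → Set (Set (Fin n → M))),
    (∀ i, IsTypeOn L n (p i) ∧ IsDefTypeOver L (Set.univ : Set M) n (p i)) ∧
    ∀ X ∈ S, ∃ i, X ∈ p i

/-- The `(m,n)`-property: among any `m` members of the family, some `n` have nonempty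
intersection. -/
def HasMNProperty {α : Type*} (S : Set (Set α)) (m n : ℕ) : Prop :=
  ∀ F : Finset (Set α), ↑F ⊆ S → F.card = m →
    ∃ G ⊆ F, G.card = n ∧ (⋂₀ (G : Set (Set α))).Nonempty

/-- `C` is a `τ`-closed subset of `X`. -/
def TauClosed {M : Type*} {k : ℕ} (X : Set (Fin k → M)) [TopologicalSpace ↥X]
    (C : Set (Fin k → M)) : Prop :=
  C ⊆ X ∧ IsClosed (Subtype.val ⁻¹' C : Set ↥X)

/-- `(X,τ)` is a definable topological space with an `A`-definable basis:
`X` is `A`-definable and the topology on `X` has a basis given by an `A`-definable family. -/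
def IsDefTopSpaceOver (L : FirstOrder.Language) {M : Type*} [L.Structure M] (A : Set M) {k : ℕ}
    (X : Set (Fin k → M)) [TopologicalSpace ↥X] : Prop :=
  Set.Definable A L X ∧
  ∃ B : Set (Set (Fin k → M)), IsDefFamily L A k B ∧ (∀ U ∈ B, U ⊆ X) ∧
    TopologicalSpace.IsTopologicalBasis ((fun U => (Subtype.val ⁻¹' U : Set ↥X)) '' B)

/-- `(X,τ)` is a definable topological space. -/
def IsDefTopSpace (L : FirstOrder.Language) {M : Type*} [L.Structure M] {k : ℕ}
    (X : Set (Fin k → M)) [TopologicalSpace ↥X] : Prop :=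
  IsDefTopSpaceOver L (Set.univ : Set M) X

/-- `(X,τ)` is definably compact: every definable downward directed family of nonempty
`τ`-closed subsets of `X` has nonempty intersection. -/
def DefinablyCompact (L : FirstOrder.Language) {M : Type*} [L.Structure M] {k : ℕ}
    (X : Set (Fin k → M)) [TopologicalSpace ↥X] : Prop :=
  ∀ C : Set (Set (Fin k → M)), IsDefFamily L (Set.univ : Set M) k C → DirectedFam C →
    (∀ Y ∈ C, Y.Nonempty ∧ TauClosed X Y) → (⋂₀ C).Nonempty

/-- `x` is a limit of the type `p` in `(X,τ)`: `x` belongs to every `τ`-closed member of `p`. -/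
def IsLimitOf {M : Type*} {k : ℕ} (X : Set (Fin k → M)) [TopologicalSpace ↥X]
    (p : Set (Set (Fin k → M))) (x : Fin k → M) : Prop :=
  x ∈ X ∧ ∀ C ∈ p, TauClosed X C → x ∈ C

/-- `(X,τ)` is type-compact: every definable type containing `X` has a limit in `X`. -/
def TypeCompact (L : FirstOrder.Language) {M : Type*} [L.Structure M] {k : ℕ}
    (X : Set (Fin k → M)) [TopologicalSpace ↥X] : Prop :=
  ∀ p : Set (Set (Fin k → M)), IsTypeOn L k p → IsDefTypeOver L (Set.univ : Set M) k p →
    X ∈ p → ∃ x, IsLimitOf X p x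

open FirstOrder Set

universe u
set_option autoImplicit false
set_option linter.unusedSectionVars false
set_option linter.unusedVariables false

/-! ### Infrastructure for definability over finite powers -/

/-- A type identified with a finite cartesian power of `M`. -/
class Coded (M : Type u) (Γ : Type u) where
  ι : Type
  fin : Finite ι
  e : Γ ≃ (ι → M)

attribute [instance] Coded.fin

namespace OM

instance codedSelf (M : Type u) : Coded M M := ⟨Unit, inferInstance, (Equiv.funUnique Unit M).symm⟩
instance codedUnit (M : Type u) : Coded M PUnit.{u+1} :=
  ⟨Empty, inferInstance, ⟨fun _ i => i.elim, fun _ => PUnit.unit, fun _ => rfl,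
    fun _ => funext fun i => i.elim⟩⟩
instance codedProd (M Γ Δ : Type u) [Coded M Γ] [Coded M Δ] : Coded M (Γ × Δ) :=
  ⟨Coded.ι M Γ ⊕ Coded.ι M Δ, inferInstance,
    (Equiv.prodCongr (Coded.e (M := M) (Γ := Γ)) (Coded.e (M := M) (Γ := Δ))).trans
      (Equiv.sumArrowEquivProdArrow _ _ _).symm⟩
instance codedPi (M Γ : Type u) [Coded M Γ] (J : Type) [Finite J] : Coded M (J → Γ) :=
  ⟨J × Coded.ι M Γ, inferInstance,
    (Equiv.arrowCongr (Equiv.refl J) (Coded.e (M := M) (Γ := Γ))).trans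
      (Equiv.curry _ _ _).symm⟩

variable (L : FirstOrder.Language) (M : Type u) [L.Structure M]
variable {Γ Δ Ξ Θ : Type u} [Coded M Γ] [Coded M Δ] [Coded M Ξ] [Coded M Θ]

/-- Definable predicate (with parameters). -/
def Dp (P : Γ → Prop) : Prop :=
  (univ : Set M).Definable L {v : Coded.ι M Γ → M | P ((Coded.e (M := M)).symm v)}

/-- Definable set. -/
def DSet (D : Set Γ) : Prop := Dp L M (fun x => x ∈ D)

/-- Definable function. -/
@[fun_prop]
def DefFun (f : Γ → Δ) : Prop := Dp L M (fun z : Γ × Δ => f z.1 = z.2)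

/-- Coordinate map. -/
def Crd (h : Γ → Δ) : Prop :=
  ∃ σ : Coded.ι M Δ → Coded.ι M Γ, ∀ x, Coded.e (M := M) (h x) = Coded.e (M := M) x ∘ σ

variable {L M}

theorem Dp.congr {P Q : Γ → Prop} (h : Dp L M P) (hh : ∀ x, P x ↔ Q x) : Dp L M Q := by
  have : P = Q := funext fun x => propext (hh x)
  rwa [← this]

theorem Dp.and {P Q : Γ → Prop} (h : Dp L M P) (h' : Dp L M Q) : Dp L M (fun x => P x ∧ Q x) :=
  Set.Definable.inter h h'
theorem Dp.or {P Q : Γ → Prop} (h : Dp L M P) (h' : Dp L M Q) : Dp L M (fun x => P x ∨ Q x) :=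
  Set.Definable.union h h'
theorem Dp.not {P : Γ → Prop} (h : Dp L M P) : Dp L M (fun x => ¬ P x) :=
  Set.Definable.compl h
theorem Dp.imp {P Q : Γ → Prop} (h : Dp L M P) (h' : Dp L M Q) : Dp L M (fun x => P x → Q x) :=
  (h.not.or h').congr fun x => by tauto
theorem Dp.iff {P Q : Γ → Prop} (h : Dp L M P) (h' : Dp L M Q) : Dp L M (fun x => P x ↔ Q x) :=
  ((h.imp h').and (h'.imp h)).congr fun x => by tauto
theorem Dp.const (p : Prop) : Dp L M (fun _ : Γ => p) := by
  unfold Dp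
  by_cases hp : p
  · convert! Set.definable_univ (L := L) (A := (univ : Set M)) (α := Coded.ι M Γ)
    simp [hp]
  · convert! Set.definable_empty (L := L) (A := (univ : Set M)) (α := Coded.ι M Γ)
    simp [hp]

theorem Dp.allFin {J : Type*} [Finite J] {P : J → Γ → Prop} (h : ∀ j, Dp L M (P j)) :
    Dp L M (fun x => ∀ j, P j x) := by
  unfold Dp
  convert! Set.definable_iInter_of_finite h
  ext; simp

theorem Dp.exFin {J : Type*} [Finite J] {P : J → Γ → Prop} (h : ∀ j, Dp L M (P j)) :
    Dp L M (fun x => ∃ j, P j x) :=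
  (Dp.allFin (fun j => (h j).not)).not.congr fun x => by simp

theorem Dp.ex {P : Γ → Δ → Prop} (h : Dp L M (fun z : Γ × Δ => P z.1 z.2)) :
    Dp L M (fun x => ∃ y, P x y) := by
  unfold Dp
  convert! Set.Definable.image_comp h (Sum.inl : Coded.ι M Γ → Coded.ι M Γ ⊕ Coded.ι M Δ)
  ext v
  constructor
  · rintro ⟨y, hy⟩
    refine ⟨Sum.elim v (Coded.e (M := M) y), ?_, by ext; rfl⟩
    change P (Coded.e.symm v) (Coded.e.symm (Coded.e y))
    simpa using hy
  · rintro ⟨w, hw, rfl⟩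
    exact ⟨_, hw⟩

theorem Dp.all {P : Γ → Δ → Prop} (h : Dp L M (fun z : Γ × Δ => P z.1 z.2)) :
    Dp L M (fun x => ∀ y, P x y) :=
  (Dp.ex (P := fun x y => ¬ P x y) h.not).not.congr fun x => by simp

theorem Dp.crd {P : Δ → Prop} (hP : Dp L M P) {h : Γ → Δ} (hh : Crd M h) :
    Dp L M (fun x => P (h x)) := by
  obtain ⟨σ, hσ⟩ := hh
  unfold Dp
  convert! Set.Definable.preimage_comp σ hP
  ext v
  have := hσ (Coded.e.symm v)
  simp only [Equiv.apply_symm_apply] at this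
  change P _ ↔ P (Coded.e.symm (v ∘ σ))
  rw [← this, Equiv.symm_apply_apply]

theorem Crd.id : Crd M (fun x : Γ => x) := ⟨_root_.id, fun _ => rfl⟩
theorem Crd.fst {f : Γ → Δ × Ξ} (hf : Crd M f) : Crd M (fun x => (f x).1) := by
  obtain ⟨σ, hσ⟩ := hf
  exact ⟨σ ∘ Sum.inl, fun x => by
    rw [← Function.comp_assoc, ← hσ]; rfl⟩
theorem Crd.snd {f : Γ → Δ × Ξ} (hf : Crd M f) : Crd M (fun x => (f x).2) := by
  obtain ⟨σ, hσ⟩ := hf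
  exact ⟨σ ∘ Sum.inr, fun x => by
    rw [← Function.comp_assoc, ← hσ]; rfl⟩
theorem Crd.pair {f : Γ → Δ} {g : Γ → Ξ} (hf : Crd M f) (hg : Crd M g) :
    Crd M (fun x => (f x, g x)) := by
  obtain ⟨σ, hσ⟩ := hf
  obtain ⟨σ', hσ'⟩ := hg
  refine ⟨Sum.elim σ σ', fun x => ?_⟩
  ext (i | i)
  · exact congrFun (hσ x) i
  · exact congrFun (hσ' x) i
theorem Crd.apply {J : Type} [Finite J] {f : Γ → J → Δ} (hf : Crd M f) (j : J) :
    Crd M (fun x => f x j) := by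
  obtain ⟨σ, hσ⟩ := hf
  exact ⟨fun i => σ (j, i), fun x => funext fun i => congrFun (hσ x) (j, i)⟩
theorem Crd.pi {J : Type} [Finite J] {f : Γ → J → Δ} (hf : ∀ j, Crd M (fun x => f x j)) :
    Crd M f := by
  choose σ hσ using hf
  exact ⟨fun i => σ i.1 i.2, fun x => funext fun i => congrFun (hσ i.1 x) i.2⟩

theorem Dp.eqCrd : Dp L M (fun z : Γ × Γ => z.1 = z.2) := by
  have : ∀ i : Coded.ι M Γ,
      Dp L M (fun z : Γ × Γ => Coded.e (M := M) z.1 i = Coded.e (M := M) z.2 i) := by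
    intro i
    refine ⟨(Language.Term.var (Sum.inl i)).equal (Language.Term.var (Sum.inr i)), ?_⟩
    ext v
    simp
    change Coded.e (Coded.e.symm _) i = Coded.e (Coded.e.symm _) i ↔ _
    simp
  refine (Dp.allFin this).congr fun x => ?_
  rw [← funext_iff]
  simp

theorem Dp.eqConst (c : Γ) : Dp L M (fun z : Γ => c = z) := by
  have : ∀ i : Coded.ι M Γ,
      Dp L M (fun z : Γ => Coded.e (M := M) c i = Coded.e (M := M) z i) := by
    intro i
    refine ⟨((L.con (⟨Coded.e (M := M) c i, trivial⟩ : (univ : Set M))).term).equal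
      (Language.Term.var i), ?_⟩
    ext v
    simp
  refine (Dp.allFin this).congr fun x => ?_
  rw [← funext_iff]
  simp

theorem DefFun.ofCrd {f : Γ → Δ} (hf : Crd M f) : DefFun L M f :=
  Dp.crd (P := fun z : Δ × Δ => z.1 = z.2) Dp.eqCrd
    (h := fun z : Γ × Δ => (f z.1, z.2)) (by
      obtain ⟨σ, hσ⟩ := hf
      refine Crd.pair ⟨Sum.inl ∘ σ, fun x => ?_⟩ Crd.id.snd
      rw [hσ]; rfl)

@[fun_prop]
theorem DefFun.id : DefFun L M (fun x : Γ => x) := DefFun.ofCrd Crd.id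
@[fun_prop]
theorem DefFun.const (c : Δ) : DefFun L M (fun _ : Γ => c) :=
  (Dp.eqConst c).crd Crd.id.snd
@[fun_prop]
theorem DefFun.comp {g : Δ → Ξ} {f : Γ → Δ} (hg : DefFun L M g) (hf : DefFun L M f) :
    DefFun L M (fun x => g (f x)) := by
  have h1 : Dp L M (fun w : (Γ × Ξ) × Δ => f w.1.1 = w.2 ∧ g w.2 = w.1.2) :=
    (Dp.crd hf (h := fun w : (Γ × Ξ) × Δ => (w.1.1, w.2))
      (Crd.pair Crd.id.fst.fst Crd.id.snd)).and
    (Dp.crd hg (h := fun w : (Γ × Ξ) × Δ => (w.2, w.1.2))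
      (Crd.pair Crd.id.snd Crd.id.fst.snd))
  refine (Dp.ex (P := fun (w : Γ × Ξ) (y : Δ) => f w.1 = y ∧ g y = w.2) h1).congr fun x => ?_
  simp
@[fun_prop]
theorem DefFun.fst {f : Γ → Δ × Ξ} (hf : DefFun L M f) : DefFun L M (fun x => (f x).1) :=
  DefFun.comp (g := Prod.fst) (DefFun.ofCrd Crd.id.fst) hf
@[fun_prop]
theorem DefFun.snd {f : Γ → Δ × Ξ} (hf : DefFun L M f) : DefFun L M (fun x => (f x).2) :=
  DefFun.comp (g := Prod.snd) (DefFun.ofCrd Crd.id.snd) hf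
@[fun_prop]
theorem DefFun.prodMk {f : Γ → Δ} {g : Γ → Ξ} (hf : DefFun L M f) (hg : DefFun L M g) :
    DefFun L M (fun x => (f x, g x)) := by
  have h1 := (Dp.crd hf (h := fun w : Γ × (Δ × Ξ) => (w.1, w.2.1))
      (Crd.pair Crd.id.fst Crd.id.snd.fst)).and
    (Dp.crd hg (h := fun w : Γ × (Δ × Ξ) => (w.1, w.2.2))
      (Crd.pair Crd.id.fst Crd.id.snd.snd))
  exact h1.congr fun x => by simp [Prod.ext_iff]
@[fun_prop]
theorem DefFun.apply {J : Type} [Finite J] (j : J) :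
    DefFun L M (fun x : J → Δ => x j) := DefFun.ofCrd (Crd.id.apply j)
@[fun_prop]
theorem DefFun.pi {J : Type} [Finite J] {f : Γ → J → Δ}
    (hf : ∀ j, DefFun L M (fun x => f x j)) : DefFun L M (fun x j => f x j) := by
  have h1 := fun j => (Dp.crd (hf j) (h := fun w : Γ × (J → Δ) => (w.1, w.2 j))
      (Crd.pair Crd.id.fst (Crd.id.snd.apply j)))
  exact (Dp.allFin h1).congr fun x => by simp [funext_iff]

theorem Dp.comp {P : Δ → Prop} (hP : Dp L M P) {f : Γ → Δ} (hf : DefFun L M f) :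
    Dp L M (fun x => P (f x)) :=
  (Dp.ex (P := fun x y => f x = y ∧ P y) (hf.and (hP.crd Crd.id.snd))).congr fun x => by simp
theorem Dp.mem {D : Set Δ} {f : Γ → Δ} (hD : DSet L M D) (hf : DefFun L M f) :
    Dp L M (fun x => f x ∈ D) := Dp.comp hD hf
theorem Dp.notMem {D : Set Δ} {f : Γ → Δ} (hD : DSet L M D) (hf : DefFun L M f) :
    Dp L M (fun x => f x ∉ D) := (Dp.mem hD hf).not
theorem Dp.eq {f g : Γ → Δ} (hf : DefFun L M f) (hg : DefFun L M g) :
    Dp L M (fun x => f x = g x) :=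
  Dp.comp (P := fun z : Δ × Δ => z.1 = z.2) Dp.eqCrd (hf.prodMk hg)
theorem Dp.ne {f g : Γ → Δ} (hf : DefFun L M f) (hg : DefFun L M g) :
    Dp L M (fun x => f x ≠ g x) := (Dp.eq hf hg).not

theorem DSet.of {P : Γ → Prop} (hP : Dp L M P) : DSet L M {x | P x} := hP

theorem DefFun.of_graph {f : Γ → Δ} {G : Γ → Δ → Prop}
    (hG : Dp L M (fun z : Γ × Δ => G z.1 z.2)) (h : ∀ x y, f x = y ↔ G x y) : DefFun L M f :=
  hG.congr fun z => (h z.1 z.2).symm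

open Classical in
theorem DefFun.ite {P : Γ → Prop} (hP : Dp L M P) {f g : Γ → Δ} (hf : DefFun L M f)
    (hg : DefFun L M g) : DefFun L M (fun x => if P x then f x else g x) := by
  have h1 : Dp L M (fun z : Γ × Δ => (P z.1 ∧ f z.1 = z.2) ∨ (¬ P z.1 ∧ g z.1 = z.2)) :=
    ((hP.crd Crd.id.fst).and hf).or ((hP.crd Crd.id.fst).not.and hg)
  exact h1.congr fun z => by by_cases h : P z.1 <;> simp [h]

/-- o-minimality as a class. -/
class OMin (L : FirstOrder.Language) (M : Type u) [L.Structure M] [LinearOrder M] : Prop where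
  h : IsOMinimal L M

/-- Dense linear orders without endpoints. -/
class DOrd (M : Type u) [LinearOrder M] : Prop extends
  DenselyOrdered M, NoMinOrder M, NoMaxOrder M where
  ne : Nonempty M

attribute [instance] DOrd.ne

theorem DOrd.of {L : FirstOrder.Language} {M : Type u} [L.Structure M] [LinearOrder M]
    (h : IsOMinimal L M) : DOrd M :=
  { toDenselyOrdered := h.2.1, toNoMinOrder := h.2.2.1, toNoMaxOrder := h.2.2.2.1,
    ne := h.1 }

section near
variable [LinearOrder M]

/-- `P` holds immediately to the right of `a`. -/
def RN (a : M) (P : M → Prop) : Prop := ∃ b, a < b ∧ ∀ y, a < y → y < b → P y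
/-- `P` holds immediately to the left of `a`. -/
def LN (a : M) (P : M → Prop) : Prop := ∃ b, b < a ∧ ∀ y, y < a → b < y → P y
/-- `P` holds near `+∞`. -/
def TN (P : M → Prop) : Prop := ∃ b, ∀ y, b < y → P y
/-- `P` holds near `-∞`. -/
def BN (P : M → Prop) : Prop := ∃ b, ∀ y, y < b → P y
/-- `P` holds near `a` (including at `a`). -/
def NR (a : M) (P : M → Prop) : Prop := ∃ b c, b < a ∧ a < c ∧ ∀ y, b < y → y < c → P y
end near

section order
variable [LinearOrder M] [OMin L M]

theorem Dp.lt {f g : Γ → M} (hf : DefFun L M f) (hg : DefFun L M g) :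
    Dp L M (fun x => f x < g x) := by
  have h0 : Dp L M (fun z : M × M => z.1 < z.2) := by
    have h := (OMin.h (L := L) (M := M)).2.2.2.2.1.mono (Set.subset_univ _)
    have h2 := h.preimage_comp (β := Unit ⊕ Unit) ![Sum.inl (), Sum.inr ()]
    exact h2
  exact Dp.comp h0 (hf.prodMk hg)
theorem Dp.le {f g : Γ → M} (hf : DefFun L M f) (hg : DefFun L M g) :
    Dp L M (fun x => f x ≤ g x) := (Dp.lt hg hf).not.congr fun x => by simp

theorem Dp.RN {f : Γ → M} {P : Γ → M → Prop} (hf : DefFun L M f)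
    (hP : Dp L M (fun z : Γ × M => P z.1 z.2)) : Dp L M (fun x => OM.RN (f x) (P x)) := by
  unfold OM.RN
  have : Dp L M (fun z : (Γ × M) × M => P z.1.1 z.2) :=
    Dp.crd hP (Crd.pair Crd.id.fst.fst Crd.id.snd)
  exact Dp.ex (Dp.and (Dp.lt (by fun_prop) (by fun_prop)) (Dp.all (Dp.imp
    (Dp.lt (by fun_prop) (by fun_prop)) (Dp.imp (Dp.lt (by fun_prop) (by fun_prop)) this))))
theorem Dp.LN {f : Γ → M} {P : Γ → M → Prop} (hf : DefFun L M f)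
    (hP : Dp L M (fun z : Γ × M => P z.1 z.2)) : Dp L M (fun x => OM.LN (f x) (P x)) := by
  unfold OM.LN
  have : Dp L M (fun z : (Γ × M) × M => P z.1.1 z.2) :=
    Dp.crd hP (Crd.pair Crd.id.fst.fst Crd.id.snd)
  exact Dp.ex (Dp.and (Dp.lt (by fun_prop) (by fun_prop)) (Dp.all (Dp.imp
    (Dp.lt (by fun_prop) (by fun_prop)) (Dp.imp (Dp.lt (by fun_prop) (by fun_prop)) this))))
theorem Dp.TN {P : Γ → M → Prop}
    (hP : Dp L M (fun z : Γ × M => P z.1 z.2)) : Dp L M (fun x => OM.TN (P x)) := by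
  unfold OM.TN
  have : Dp L M (fun z : (Γ × M) × M => P z.1.1 z.2) :=
    Dp.crd hP (Crd.pair Crd.id.fst.fst Crd.id.snd)
  exact Dp.ex (Dp.all (Dp.imp (Dp.lt (by fun_prop) (by fun_prop)) this))
theorem Dp.BN {P : Γ → M → Prop}
    (hP : Dp L M (fun z : Γ × M => P z.1 z.2)) : Dp L M (fun x => OM.BN (P x)) := by
  unfold OM.BN
  have : Dp L M (fun z : (Γ × M) × M => P z.1.1 z.2) :=
    Dp.crd hP (Crd.pair Crd.id.fst.fst Crd.id.snd)
  exact Dp.ex (Dp.all (Dp.imp (Dp.lt (by fun_prop) (by fun_prop)) this))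
theorem Dp.NR {f : Γ → M} {P : Γ → M → Prop} (hf : DefFun L M f)
    (hP : Dp L M (fun z : Γ × M => P z.1 z.2)) : Dp L M (fun x => OM.NR (f x) (P x)) := by
  unfold OM.NR
  have : Dp L M (fun z : ((Γ × M) × M) × M => P z.1.1.1 z.2) :=
    Dp.crd hP (Crd.pair Crd.id.fst.fst.fst Crd.id.snd)
  exact Dp.ex (Dp.ex (Dp.and (Dp.lt (by fun_prop) (by fun_prop)) (Dp.and
    (Dp.lt (by fun_prop) (by fun_prop)) (Dp.all (Dp.imp
    (Dp.lt (by fun_prop) (by fun_prop)) (Dp.imp (Dp.lt (by fun_prop) (by fun_prop)) this))))))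
end order

end OM

/-- Automatic definability: the argument is found by the default tactic block. -/
theorem dfn {p : Prop} (h : p := by
    repeat' first
    | assumption
    | with_reducible apply OM.Dp.const
    | with_reducible apply OM.DSet.of
    | with_reducible apply OM.Dp.and
    | with_reducible apply OM.Dp.or
    | with_reducible apply OM.Dp.lt
    | with_reducible apply OM.Dp.le
    | with_reducible apply OM.Dp.eq
    | with_reducible apply OM.Dp.ne
    | with_reducible apply OM.Dp.RN
    | with_reducible apply OM.Dp.LN
    | with_reducible apply OM.Dp.NR
    | with_reducible apply OM.Dp.TN
    | with_reducible apply OM.Dp.BN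
    | with_reducible apply OM.Dp.notMem
    | with_reducible apply OM.Dp.mem
    | with_reducible apply OM.Dp.not
    | with_reducible apply OM.Dp.iff
    | with_reducible apply OM.Dp.ex
    | with_reducible apply OM.Dp.imp
    | with_reducible apply OM.Dp.all
    | (with_reducible apply OM.Dp.exFin; intro _)
    | (with_reducible apply OM.Dp.allFin; intro _)
    | fun_prop) : p := h
namespace OM
section
variable {L : FirstOrder.Language} {M : Type u} [L.Structure M] [LinearOrder M] [OMin L M]
variable {Γ Δ Ξ Θ : Type u} [Coded M Γ] [Coded M Δ] [Coded M Ξ] [Coded M Θ]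
end

end OM

namespace OM
section tools

/-- The reversed order. -/
@[reducible] def dualOrd (M : Type u) [o : LinearOrder M] : LinearOrder M :=
  inferInstanceAs (LinearOrder Mᵒᵈ)

theorem DOrd.dual {M : Type u} [o : LinearOrder M] [h : DOrd M] : @DOrd M (dualOrd M) :=
  @DOrd.mk M (dualOrd M) (inferInstanceAs (DenselyOrdered Mᵒᵈ)) (inferInstanceAs (NoMinOrder Mᵒᵈ))
    (inferInstanceAs (NoMaxOrder Mᵒᵈ)) h.ne

variable {L : FirstOrder.Language} {M : Type u} [L.Structure M]
variable {Γ Δ Ξ Θ : Type u} [Coded M Γ] [Coded M Δ] [Coded M Ξ] [Coded M Θ]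

theorem definable₁_of_dset {S : Set M} (h : DSet L M S) : (univ : Set M).Definable₁ L S := by
  have := Set.Definable.preimage_comp (fun _ : Unit => (0 : Fin 1)) h
  exact this

theorem dset_of_definable₁ {S : Set M} (h : (univ : Set M).Definable₁ L S) : DSet L M S := by
  have := Set.Definable.preimage_comp (fun _ : Fin 1 => ()) h
  exact this

variable [LinearOrder M] [DOrd M] [OMin L M]

theorem OMin.dual : @OMin L M _ (dualOrd M) := by
  have h := OMin.h (L := L) (M := M)
  have d1 : DenselyOrdered Mᵒᵈ := inferInstance
  have d2 : NoMinOrder Mᵒᵈ := inferInstance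
  have d3 : NoMaxOrder Mᵒᵈ := inferInstance
  let d := dualOrd M
  refine @OMin.mk L M _ d ?_
  refine ⟨h.1, d1, d2, d3, ?_, ?_⟩
  · exact h.2.2.2.2.1.preimage_comp (![1, 0] : Fin 2 → Fin 2)
  · intro s hs
    obtain ⟨F, hF, hF2⟩ := h.2.2.2.2.2 s hs
    refine ⟨F, hF, fun t ht => ?_⟩
    rcases hF2 t ht with ⟨a, rfl⟩ | ⟨a, b, rfl⟩ | ⟨a, rfl⟩ | ⟨a, rfl⟩ | rfl
    · exact Or.inl ⟨a, rfl⟩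
    · exact Or.inr (Or.inl ⟨b, a, by ext x; exact and_comm⟩)
    · exact Or.inr (Or.inr (Or.inr (Or.inl ⟨a, rfl⟩)))
    · exact Or.inr (Or.inr (Or.inl ⟨a, rfl⟩))
    · exact Or.inr (Or.inr (Or.inr (Or.inr rfl)))

theorem omin_cells {S : Set M} (h : DSet L M S) : ∃ F : Finset (Set M), S = ⋃₀ (F : Set (Set M)) ∧
      ∀ t ∈ F, (∃ a : M, t = {a}) ∨ (∃ a b : M, t = Set.Ioo a b) ∨
        (∃ a : M, t = Set.Ioi a) ∨ (∃ a : M, t = Set.Iio a) ∨ t = Set.univ :=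
  (OMin.h (L := L) (M := M)).2.2.2.2.2 S (definable₁_of_dset h)

theorem RN.mono {a : M} {P Q : M → Prop} (h : RN a P) (hh : ∀ y, P y → Q y) : RN a Q := by
  obtain ⟨b, hb, h⟩ := h; exact ⟨b, hb, fun y h1 h2 => hh y (h y h1 h2)⟩
theorem RN.and {a : M} {P Q : M → Prop} (h : RN a P) (h' : RN a Q) : RN a (fun y => P y ∧ Q y) := by
  obtain ⟨b, hb, h⟩ := h
  obtain ⟨c, hc, h'⟩ := h'
  exact ⟨min b c, lt_min hb hc, fun y h1 h2 =>
    ⟨h y h1 (lt_of_lt_of_le h2 (min_le_left _ _)), h' y h1 (lt_of_lt_of_le h2 (min_le_right _ _))⟩⟩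
theorem RN.exists {a : M} {P : M → Prop} (h : RN a P) : ∃ y, a < y ∧ P y := by
  obtain ⟨b, hb, h⟩ := h
  obtain ⟨y, h1, h2⟩ := exists_between hb
  exact ⟨y, h1, h y h1 h2⟩
theorem RN.gt (a : M) : RN a (fun y => a < y) := by
  obtain ⟨b, hb⟩ := exists_gt a
  exact ⟨b, hb, fun y h _ => h⟩
theorem RN.lt {a b : M} (h : a < b) : RN a (fun y => y < b) := ⟨b, h, fun _ _ h => h⟩
theorem LN.mono {a : M} {P Q : M → Prop} (h : LN a P) (hh : ∀ y, P y → Q y) : LN a Q := by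
  obtain ⟨b, hb, h⟩ := h; exact ⟨b, hb, fun y h1 h2 => hh y (h y h1 h2)⟩
theorem LN.and {a : M} {P Q : M → Prop} (h : LN a P) (h' : LN a Q) : LN a (fun y => P y ∧ Q y) :=
  @RN.and M (dualOrd M) DOrd.dual a P Q h h'
theorem LN.exists {a : M} {P : M → Prop} (h : LN a P) : ∃ y, y < a ∧ P y :=
  @RN.exists M (dualOrd M) DOrd.dual a P h
theorem LN.lt (a : M) : LN a (fun y => y < a) := @RN.gt M (dualOrd M) DOrd.dual a
theorem LN.gt {a b : M} (h : b < a) : LN a (fun y => b < y) := ⟨b, h, fun _ _ h => h⟩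
theorem TN.mono {P Q : M → Prop} (h : TN P) (hh : ∀ y, P y → Q y) : TN Q := by
  obtain ⟨b, h⟩ := h; exact ⟨b, fun y h1 => hh y (h y h1)⟩
theorem TN.and {P Q : M → Prop} (h : TN P) (h' : TN Q) : TN (fun y => P y ∧ Q y) := by
  obtain ⟨b, h⟩ := h
  obtain ⟨c, h'⟩ := h'
  exact ⟨max b c, fun y h1 => ⟨h y (lt_of_le_of_lt (le_max_left _ _) h1),
    h' y (lt_of_le_of_lt (le_max_right _ _) h1)⟩⟩
theorem TN.exists {P : M → Prop} (h : TN P) : ∃ y, P y := by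
  obtain ⟨b, h⟩ := h
  obtain ⟨y, h1⟩ := exists_gt b
  exact ⟨y, h y h1⟩
theorem NR.mono {a : M} {P Q : M → Prop} (h : NR a P) (hh : ∀ y, P y → Q y) : NR a Q := by
  obtain ⟨b, c, hb, hc, h⟩ := h; exact ⟨b, c, hb, hc, fun y h1 h2 => hh y (h y h1 h2)⟩
theorem NR.and {a : M} {P Q : M → Prop} (h : NR a P) (h' : NR a Q) : NR a (fun y => P y ∧ Q y) := by
  obtain ⟨b, c, hb, hc, h⟩ := h
  obtain ⟨b', c', hb', hc', h'⟩ := h'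
  exact ⟨max b b', min c c', max_lt hb hb', lt_min hc hc', fun y h1 h2 => by
    simp only [max_lt_iff, lt_min_iff] at h1 h2
    exact ⟨h y h1.1 h2.1, h' y h1.2 h2.2⟩⟩
theorem NR.self {a : M} {P : M → Prop} (h : NR a P) : P a := by
  obtain ⟨b, c, hb, hc, h⟩ := h; exact h a hb hc
theorem NR.rn {a : M} {P : M → Prop} (h : NR a P) : RN a P := by
  obtain ⟨b, c, hb, hc, h⟩ := h; exact ⟨c, hc, fun y h1 h2 => h y (hb.trans h1) h2⟩
theorem NR.ln {a : M} {P : M → Prop} (h : NR a P) : LN a P := by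
  obtain ⟨b, c, hb, hc, h⟩ := h; exact ⟨b, hb, fun y h1 h2 => h y h2 (h1.trans hc)⟩
theorem NR.of {a : M} {P : M → Prop} (h : P a) (hr : RN a P) (hl : LN a P) : NR a P := by
  obtain ⟨c, hc, h1⟩ := hr
  obtain ⟨b, hb, h2⟩ := hl
  refine ⟨b, c, hb, hc, fun y h3 h4 => ?_⟩
  rcases lt_trichotomy y a with h5 | h5 | h5
  · exact h2 y h5 h3
  · exact h5 ▸ h
  · exact h1 y h5 h4
theorem NR.all {a : M} {P : M → Prop} (h : ∀ y, P y) : NR a P := by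
  obtain ⟨b, hb⟩ := exists_lt a
  obtain ⟨c, hc⟩ := exists_gt a
  exact ⟨b, c, hb, hc, fun y _ _ => h y⟩
theorem NR.mem_Ioo {a b c : M} (hb : b < a) (hc : a < c) : NR a (fun y => b < y ∧ y < c) :=
  ⟨b, c, hb, hc, fun y h1 h2 => ⟨h1, h2⟩⟩

theorem rn_dich {S : Set M} (h : DSet L M S) (a : M) :
    RN a (fun y => y ∈ S) ∨ RN a (fun y => y ∉ S) := by
  classical
  obtain ⟨F, rfl, hF⟩ := omin_cells h
  clear h
  induction F using Finset.induction_on with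
  | empty => right; exact (RN.gt a).mono (by simp)
  | insert t F ht ih =>
    have h1 : RN a (fun y => y ∈ t) ∨ RN a (fun y => y ∉ t) := by
      rcases hF t (by simp) with ⟨b, rfl⟩ | ⟨b, c, rfl⟩ | ⟨b, rfl⟩ | ⟨b, rfl⟩ | rfl
      · right
        rcases le_or_gt b a with h | h
        · exact (RN.gt a).mono fun y hy => (h.trans_lt hy).ne'
        · exact (RN.lt h).mono fun y hy => hy.ne
      · rcases lt_or_ge a b with h | h
        · right; exact (RN.lt h).mono fun y hy h => hy.not_gt h.1
        rcases lt_or_ge a c with h' | h'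
        · left; exact ((RN.gt a).and (RN.lt h')).mono fun y hy => ⟨h.trans_lt hy.1, hy.2⟩
        · right; exact (RN.gt a).mono fun y hy h => (h'.trans_lt hy).not_gt h.2
      · rcases lt_or_ge a b with h | h
        · right; exact (RN.lt h).mono fun y hy h => hy.not_gt h
        · left; exact (RN.gt a).mono fun y hy => h.trans_lt hy
      · rcases lt_or_ge a b with h | h
        · left; exact (RN.lt h).mono fun y hy => hy
        · right; exact (RN.gt a).mono fun y hy h' => (h.trans_lt hy).not_gt h'
      · left; exact (RN.gt a).mono fun y hy => trivial
    have h2 := ih (fun t ht => hF t (by simp [ht]))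
    simp only [Finset.coe_insert, sUnion_insert, mem_union]
    rcases h1 with h1 | h1
    · left; exact h1.mono fun y hy => Or.inl hy
    rcases h2 with h2 | h2
    · left; exact h2.mono fun y hy => Or.inr hy
    · right; exact (h1.and h2).mono fun y hy => by tauto

theorem ln_dich {S : Set M} (h : DSet L M S) (a : M) :
    LN a (fun y => y ∈ S) ∨ LN a (fun y => y ∉ S) :=
  @rn_dich L M _ (dualOrd M) DOrd.dual OMin.dual S h a

theorem tn_dich {S : Set M} (h : DSet L M S) :
    TN (fun y => y ∈ S) ∨ TN (fun y => y ∉ S) := by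
  classical
  obtain ⟨F, rfl, hF⟩ := omin_cells h
  clear h
  have T1 : ∀ b : M, TN (fun y => b < y) := fun b => ⟨b, fun y h => h⟩
  obtain ⟨m⟩ := (inferInstance : Nonempty M)
  induction F using Finset.induction_on with
  | empty => right; exact ⟨m, by simp⟩
  | insert t F ht ih =>
    have h1 : TN (fun y => y ∈ t) ∨ TN (fun y => y ∉ t) := by
      rcases hF t (by simp) with ⟨b, rfl⟩ | ⟨b, c, rfl⟩ | ⟨b, rfl⟩ | ⟨b, rfl⟩ | rfl
      · right; exact (T1 b).mono fun y hy => hy.ne'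
      · right; exact (T1 c).mono fun y hy h => hy.not_gt h.2
      · left; exact T1 b
      · right; exact (T1 b).mono fun y hy h => hy.not_gt h
      · left; exact (T1 m).mono fun y hy => trivial
    have h2 := ih (fun t ht => hF t (by simp [ht]))
    simp only [Finset.coe_insert, sUnion_insert, mem_union]
    rcases h1 with h1 | h1
    · left; exact h1.mono fun y hy => Or.inl hy
    rcases h2 with h2 | h2
    · left; exact h2.mono fun y hy => Or.inr hy
    · right; exact (h1.and h2).mono fun y hy => by tauto

theorem bn_dich {S : Set M} (h : DSet L M S) :
    BN (fun y => y ∈ S) ∨ BN (fun y => y ∉ S) :=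
  @tn_dich L M _ (dualOrd M) DOrd.dual OMin.dual S h

theorem exists_Ioo_of_infinite {S : Set M} (h : DSet L M S) (hS : S.Infinite) :
    ∃ a b, a < b ∧ Ioo a b ⊆ S := by
  obtain ⟨F, rfl, hF⟩ := omin_cells h
  by_contra hcon
  apply hS
  apply Set.Finite.sUnion F.finite_toSet
  intro t ht
  have hsub : t ⊆ ⋃₀ (F : Set (Set M)) := subset_sUnion_of_mem ht
  obtain ⟨m⟩ := (inferInstance : Nonempty M)
  rcases hF t ht with ⟨b, rfl⟩ | ⟨b, c, rfl⟩ | ⟨b, rfl⟩ | ⟨b, rfl⟩ | rfl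
  · exact finite_singleton b
  · rcases lt_or_ge b c with h | h
    · exact absurd ⟨b, c, h, hsub⟩ hcon
    · simp [Ioo_eq_empty h.not_gt]
  · obtain ⟨c, hc⟩ := exists_gt b
    exact absurd ⟨b, c, hc, fun y hy => hsub hy.1⟩ hcon
  · obtain ⟨c, hc⟩ := exists_lt b
    exact absurd ⟨c, b, hc, fun y hy => hsub hy.2⟩ hcon
  · obtain ⟨c, hc⟩ := exists_gt m
    exact absurd ⟨m, c, hc, fun y hy => hsub trivial⟩ hcon

theorem exists_lub {S : Set M} (h : DSet L M S) (hS : S.Nonempty) (hb : BddAbove S) :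
    ∃ a, IsLUB S a := by
  classical
  obtain ⟨F, rfl, hF⟩ := omin_cells h
  clear h
  induction F using Finset.induction_on with
  | empty => simp at hS
  | insert t F ht ih =>
    simp only [Finset.coe_insert, sUnion_insert] at hS hb ⊢
    have hbt : BddAbove t := hb.mono subset_union_left
    have hbF : BddAbove (⋃₀ (F : Set (Set M))) := hb.mono subset_union_right
    have h1 : t.Nonempty → ∃ a, IsLUB t a := by
      intro hne
      rcases hF t (by simp) with ⟨b, rfl⟩ | ⟨b, c, rfl⟩ | ⟨b, rfl⟩ | ⟨b, rfl⟩ | rfl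
      · exact ⟨b, isLUB_singleton⟩
      · exact ⟨c, isLUB_Ioo (by obtain ⟨x, hx⟩ := hne; exact hx.1.trans hx.2)⟩
      · exact absurd hbt (not_bddAbove_Ioi b)
      · exact ⟨b, isLUB_Iio⟩
      · exact absurd hbt not_bddAbove_univ
    rcases t.eq_empty_or_nonempty with h2 | h2
    · subst h2
      simp only [empty_union] at hS ⊢
      exact ih (fun t ht => hF t (by simp [ht])) hS hbF
    · obtain ⟨a, ha⟩ := h1 h2
      rcases (⋃₀ (F : Set (Set M))).eq_empty_or_nonempty with h3 | h3
      · rw [h3]; exact ⟨a, by simpa using ha⟩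
      · obtain ⟨b, hb⟩ := ih (fun t ht => hF t (by simp [ht])) h3 hbF
        exact ⟨_, ha.union hb⟩

theorem exists_glb {S : Set M} (h : DSet L M S) (hS : S.Nonempty) (hb : BddBelow S) :
    ∃ a, IsGLB S a :=
  @exists_lub L M _ (dualOrd M) DOrd.dual OMin.dual S h hS hb

theorem DSet.compl {D : Set Γ} (h : DSet L M D) : DSet L M Dᶜ := Dp.not h

/-- Connectedness of closed intervals. -/
theorem conn {S : Set M} (h : DSet L M S) {a b : M} (hab : a ≤ b) (ha : a ∈ S)
    (hr : ∀ x, a ≤ x → x < b → x ∈ S → RN x (fun y => y ∈ S))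
    (hl : ∀ x, a < x → x ≤ b → LN x (fun y => y ∈ S) → x ∈ S) : b ∈ S := by
  have hT : DSet L M {z | a ≤ z ∧ z ≤ b ∧ ∀ y, a ≤ y → y ≤ z → y ∈ S} := dfn
  obtain ⟨s, hs⟩ := exists_lub hT ⟨a, le_rfl, hab, fun y h1 h2 => le_antisymm h2 h1 ▸ ha⟩
    ⟨b, fun z hz => hz.2.1⟩
  have hs0 : a ≤ s := hs.1 ⟨le_rfl, hab, fun y h1 h2 => le_antisymm h2 h1 ▸ ha⟩
  have hsb : s ≤ b := hs.2 fun z hz => hz.2.1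
  have h1 : ∀ y, a ≤ y → y < s → y ∈ S := by
    intro y hy hys
    by_contra hcon
    refine hys.not_ge (hs.2 fun z hz => ?_)
    by_contra hlt
    exact hcon (hz.2.2 y hy (not_le.mp hlt).le)
  have h2 : s ∈ S := by
    rcases hs0.eq_or_lt with h | h
    · exact h ▸ ha
    · exact hl s h hsb ⟨a, h, fun y h3 h4 => h1 y h4.le h3⟩
  have h3 : ∀ y, a ≤ y → y ≤ s → y ∈ S := fun y h4 h5 => by
    rcases h5.eq_or_lt with h | h
    · exact h ▸ h2
    · exact h1 y h4 h
  rcases hsb.eq_or_lt with h | h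
  · exact h ▸ h2
  · exfalso
    obtain ⟨y, hy1, hy⟩ := (((hr s hs0 h h2).and (RN.lt h)))
    obtain ⟨c, hc1, hc2⟩ := exists_between hy1
    have : c ≤ s := hs.1 ⟨hs0.trans hc1.le, (hy c hc1 hc2).2.le, fun z hz1 hz2 => by
      rcases le_or_gt z s with h6 | h6
      · exact h3 z hz1 h6
      · exact (hy z h6 (hz2.trans_lt hc2)).1⟩
    exact this.not_gt hc1

/-- Points at which membership in `S` is not locally constant. -/
def bd (S : Set M) : Set M :=
  {a | ¬ (NR a (fun y => y ∈ S) ∨ NR a (fun y => y ∉ S))}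

theorem infinite_Ioo {a b : M} (h : a < b) : (Ioo a b).Infinite := Set.Ioo_infinite h

theorem exists_sub_Ioo {S : Set M} (h : DSet L M S) {a b : M} (hab : a < b) :
    ∃ c d, a < c ∧ c < d ∧ d < b ∧ ((∀ y ∈ Ioo c d, y ∈ S) ∨ (∀ y ∈ Ioo c d, y ∉ S)) := by
  rcases rn_dich h a with h1 | h1
  all_goals
    obtain ⟨d, hd, h2⟩ := h1.and (RN.lt hab)
    obtain ⟨d', hd1, hd2⟩ := exists_between hd
    obtain ⟨c, hc1, hc2⟩ := exists_between hd1
    refine ⟨c, d', hc1, hc2, (h2 d' hd1 hd2).2, ?_⟩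
  · left; exact fun y hy => (h2 y (hc1.trans hy.1) (hy.2.trans hd2)).1
  · right; exact fun y hy => (h2 y (hc1.trans hy.1) (hy.2.trans hd2)).1

theorem bd_dset {S : Set M} (h : DSet L M S) : DSet L M (bd S) := by unfold bd; exact dfn

theorem bd_finite {S : Set M} (h : DSet L M S) : (bd S).Finite := by
  by_contra hinf
  obtain ⟨a, b, hab, hsub⟩ := exists_Ioo_of_infinite (bd_dset h) hinf
  obtain ⟨c, d, h1, h2, h3, h4⟩ := exists_sub_Ioo h hab
  obtain ⟨x, hx1, hx2⟩ := exists_between h2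
  refine hsub ⟨h1.trans hx1, hx2.trans h3⟩ ?_
  rcases h4 with h4 | h4
  · left; exact ⟨c, d, hx1, hx2, fun y h5 h6 => h4 y ⟨h5, h6⟩⟩
  · right; exact ⟨c, d, hx1, hx2, fun y h5 h6 => h4 y ⟨h5, h6⟩⟩

/-- A closed interval without boundary points of `S` is inside or outside `S`. -/
theorem mem_of_no_bd {S : Set M} (h : DSet L M S) {a b : M} (hab : a ≤ b) (ha : a ∈ S)
    (hn : ∀ x, a ≤ x → x ≤ b → x ∉ bd S) : b ∈ S := by
  refine conn h hab ha ?_ ?_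
  · intro x h1 h2 h3
    have := hn x h1 h2.le
    simp only [bd, mem_ofPred_eq, not_not] at this
    rcases this with h | h
    · exact h.rn
    · exact absurd h3 h.self
  · intro x h1 h2 h3
    have := hn x h1.le h2
    simp only [bd, mem_ofPred_eq, not_not] at this
    rcases this with h | h
    · exact h.self
    · obtain ⟨y, _, hy1, hy2⟩ := (h3.and h.ln).exists
      exact absurd hy1 hy2

theorem bd_compl (S : Set M) : bd Sᶜ = bd S := by
  ext x; simp only [bd, mem_compl_iff, mem_ofPred_eq, not_not]; tauto

theorem mem_iff_of_no_bd {S : Set M} (h : DSet L M S) {a b : M} (hab : a ≤ b)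
    (hn : ∀ x, a ≤ x → x ≤ b → x ∉ bd S) : a ∈ S ↔ b ∈ S := by
  constructor
  · exact fun ha => mem_of_no_bd h hab ha hn
  · intro hb
    by_contra ha
    exact mem_of_no_bd h.compl hab ha (by rwa [bd_compl]) hb

end tools
end OM

namespace OM
section mono

variable {L : FirstOrder.Language} {M : Type u} [L.Structure M]
variable {Γ Δ Ξ Θ : Type u} [Coded M Γ] [Coded M Δ] [Coded M Ξ] [Coded M Θ]
variable [LinearOrder M] [DOrd M] [OMin L M]
variable {K : Type*} [LinearOrder K]

/-- Definable order relation pulled back along `f`. -/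
def OrdDef (L : FirstOrder.Language) (M : Type u) [L.Structure M] {Γ : Type u} [Coded M Γ]
    {K : Type*} [LinearOrder K] (f : Γ → K) : Prop :=
  DSet L M {z : Γ × Γ | f z.1 < f z.2}

theorem OrdDef.lt {f : Δ → K} (h : OrdDef L M f) {g g' : Γ → Δ} (hg : DefFun L M g)
    (hg' : DefFun L M g') : Dp L M (fun x => f (g x) < f (g' x)) :=
  Dp.mem h (hg.prodMk hg')
theorem OrdDef.le {f : Δ → K} (h : OrdDef L M f) {g g' : Γ → Δ} (hg : DefFun L M g)
    (hg' : DefFun L M g') : Dp L M (fun x => f (g x) ≤ f (g' x)) :=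
  (h.lt hg' hg).not.congr fun x => by simp
theorem OrdDef.eq {f : Δ → K} (h : OrdDef L M f) {g g' : Γ → Δ} (hg : DefFun L M g)
    (hg' : DefFun L M g') : Dp L M (fun x => f (g x) = f (g' x)) :=
  ((h.le hg' hg).and (h.le hg hg')).congr fun x => by rw [← le_antisymm_iff, eq_comm]

theorem LN.of_cofinal {S : Set M} (hS : DSet L M S) {b c : M} (hcb : c < b)
    (h : ∀ x, c < x → x < b → ∃ y, x < y ∧ y < b ∧ y ∈ S) : LN b (fun y => y ∈ S) := by
  rcases ln_dich hS b with h1 | h1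
  · exact h1
  · obtain ⟨e, he, h2⟩ := h1
    obtain ⟨x, hx1, hx2⟩ := exists_between (max_lt he hcb)
    obtain ⟨y, hy1, hy2, hy3⟩ := h x (lt_of_le_of_lt (le_max_right _ _) hx1) hx2
    exact absurd hy3 (h2 y hy2 ((lt_of_le_of_lt (le_max_left _ _) hx1).trans hy1))

theorem hc_half (f : M → K) (hR : OrdDef L M f) {a b : M} (hab : a < b)
    (hr : ∀ x, a < x → x < b → RN x (fun y => f x < f y))
    (hl : ∀ x, a < x → x < b → LN x (fun y => f x < f y)) :
    ∃ c d, a ≤ c ∧ c < d ∧ d ≤ b ∧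
      ∀ z, c < z → z < d → ∃ k, LN z (fun y => k < f y) ∧ RN z (fun y => f y < k) := by
  have hne : ∀ x z, a < z → z ≤ b → LN z (fun y => f y ≠ f x) := by
    intro x z haz hzb
    have : DSet L M {y | f y = f x} := DSet.of (hR.eq (by fun_prop) (by fun_prop))
    rcases ln_dich this z with h | h
    · exfalso
      obtain ⟨e, he, h1⟩ := h.and (LN.gt haz)
      obtain ⟨y, hy1, hy2⟩ := exists_between he
      obtain ⟨y', hy', h2, h3⟩ := ((hr y (h1 y hy2 hy1).2 (hy2.trans_le hzb)).and
        (RN.lt hy2)).exists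
      have e1 : f y = f x := (h1 y hy2 hy1).1
      have e2 : f y' = f x := (h1 y' h3 (hy1.trans hy')).1
      rw [e1, e2] at h2
      exact lt_irrefl _ h2
    · exact h
  have hB : DSet L M {x | a < x ∧ x < b ∧ ∀ y, x < y → y < b → f x < f y} := by
    have : Dp L M (fun z : M × M => f z.1 < f z.2) := hR
    exact dfn
  rcases ln_dich hB b with h | h
  · exfalso
    obtain ⟨c, hc, h1⟩ := h
    obtain ⟨z, hz1, hz2⟩ := exists_between hc
    obtain ⟨y, hy, h2, h3⟩ := ((hl z (h1 z hz2 hz1).1 hz2).and (LN.gt hz1)).exists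
    exact lt_asymm h2 ((h1 y (hy.trans hz2) h3).2.2 z hy hz2)
  obtain ⟨c, hcb, hc⟩ := h.and (LN.gt hab)
  have hc1 : ∀ x, c < x → x < b → a < x := fun x h1 h2 => (hc x h2 h1).2
  have hc2 : ∀ x, c < x → x < b → ∃ y, x < y ∧ y < b ∧ f y ≤ f x := by
    intro x h1 h2
    have := (hc x h2 h1).1
    simp only [mem_ofPred_eq, not_and, not_forall, not_lt] at this
    obtain ⟨y, hy1, hy2, hy3⟩ := this (hc1 x h1 h2) h2
    exact ⟨y, hy1, hy2, hy3⟩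
  clear hc hB h
  have claim1 : ∀ x, c < x → x < b → LN b (fun y => f y < f x) := by
    intro x hx1 hx2
    have hT : DSet L M {y | f y ≤ f x} := DSet.of (hR.le (by fun_prop) (by fun_prop))
    rcases ln_dich hT b with h | h
    · exact (h.and (hne x b hab le_rfl)).mono fun y hy => lt_of_le_of_ne hy.1 hy.2
    exfalso
    have hT' : DSet L M {y | (x < y ∧ y < b) ∧ y ∈ {y | f y ≤ f x}} := dfn
    obtain ⟨y0, hy01, hy02, hy03⟩ := hc2 x hx1 hx2
    obtain ⟨s, hs⟩ := exists_lub hT' ⟨y0, ⟨hy01, hy02⟩, hy03⟩ ⟨b, fun y hy => hy.1.2.le⟩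
    obtain ⟨e, he, h1⟩ := h
    have hsb : s < b := by
      refine lt_of_le_of_lt (hs.2 fun y hy => ?_) he
      by_contra hlt
      exact h1 y hy.1.2 (not_le.mp hlt) hy.2
    have hxs : x < s := hy01.trans_le (hs.1 ⟨⟨hy01, hy02⟩, hy03⟩)
    by_cases hsT : f s ≤ f x
    · obtain ⟨y, hy1, hy2, hy3⟩ := hc2 s (hx1.trans hxs) hsb
      exact hy1.not_ge (hs.1 ⟨⟨hxs.trans hy1, hy2⟩, hy3.trans hsT⟩)
    · rcases ln_dich hT s with h2 | h2
      · obtain ⟨y, _, hy1, hy2⟩ :=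
          (h2.and (hl s (hc1 s (hx1.trans hxs) hsb) hsb)).exists
        exact hsT (hy2.le.trans hy1)
      · obtain ⟨e', he', h3⟩ := h2
        refine he'.not_ge (hs.2 fun y hy => ?_)
        by_contra hlt
        rcases (hs.1 hy).eq_or_lt with h4 | h4
        · exact hsT (h4 ▸ hy.2)
        · exact h3 y h4 (not_le.mp hlt) hy.2
  have hP : DSet L M {z | ∃ x, LN z (fun y => f x < f y) ∧ RN z (fun y => f y < f x)} := by
    have h1 : Dp L M (fun z : (M × M) × M => f z.1.2 < f z.2) := hR.lt (by fun_prop) (by fun_prop)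
    have h2 : Dp L M (fun z : (M × M) × M => f z.2 < f z.1.2) := hR.lt (by fun_prop) (by fun_prop)
    exact dfn
  have hfin : LN b (fun y => y ∈ {z | ∃ x, LN z (fun y => f x < f y) ∧ RN z (fun y => f y < f x)}) := by
    refine LN.of_cofinal hP hcb fun x hx1 hx2 => ?_
    have hT : DSet L M {t | x ≤ t ∧ t < b ∧ ∀ y, t < y → y < b → f y < f x} := by
      have h2 : Dp L M (fun z : M × M => f z.2 < f x) := hR.lt (by fun_prop) (by fun_prop)
      exact dfn
    obtain ⟨e, he, h1⟩ := claim1 x hx1 hx2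
    obtain ⟨β, hβ⟩ := exists_glb hT ⟨max e x, le_max_right _ _, max_lt he hx2, fun y h2 h3 =>
      h1 y h3 (lt_of_le_of_lt (le_max_left _ _) h2)⟩ ⟨x, fun y hy => hy.1⟩
    have hβb : β < b := lt_of_le_of_lt (hβ.1 ⟨le_max_right _ _, max_lt he hx2, fun y h2 h3 =>
      h1 y h3 (lt_of_le_of_lt (le_max_left _ _) h2)⟩) (max_lt he hx2)
    have hxβ0 : x ≤ β := hβ.2 fun y hy => hy.1
    have h2 : ∀ y, β < y → y < b → f y < f x := by
      intro y hy1 hy2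
      by_contra hcon
      refine hy1.not_ge (hβ.2 fun t ht => ?_)
      by_contra hlt
      exact hcon (ht.2.2 y (not_le.mp hlt) hy2)
    have hxβ : x < β := by
      refine lt_of_le_of_ne hxβ0 fun h => ?_
      subst h
      obtain ⟨y, hy1, hy2, hy3⟩ := ((hr x (hc1 x hx1 hx2) hx2).and (RN.lt hx2)).exists
      exact lt_asymm hy2 (h2 y hy1 hy3)
    have haβ := hc1 β (hx1.trans hxβ) hβb
    refine ⟨β, hxβ, hβb, x, ?_, b, hβb, h2⟩
    have hU : DSet L M {y | f y < f x} := DSet.of (hR.lt (by fun_prop) (by fun_prop))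
    rcases ln_dich hU β with h3 | h3
    · exfalso
      obtain ⟨e', he', h4⟩ := h3
      obtain ⟨y, hy1, hy2, hy3⟩ := ((hr β haβ hβb).and (RN.lt hβb)).exists
      have h5 : f β < f x := hy2.trans (h2 y hy1 hy3)
      refine (max_lt he' hxβ).not_ge (hβ.1 ⟨le_max_right _ _, max_lt (he'.trans hβb) hx2, ?_⟩)
      intro t ht1 ht2
      rcases lt_trichotomy t β with h | h | h
      · exact h4 t h (lt_of_le_of_lt (le_max_left _ _) ht1)
      · exact h ▸ h5
      · exact h2 t h ht2
    · exact (h3.and (hne x β haβ hβb.le)).mono fun y hy =>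
        lt_of_le_of_ne (not_lt.mp hy.1) hy.2.symm
  obtain ⟨d, hd, h⟩ := hfin
  refine ⟨max a d, b, le_max_left _ _, max_lt hab hd, le_rfl, fun z hz1 hz2 => ?_⟩
  obtain ⟨x, hx⟩ := h z hz2 (lt_of_le_of_lt (le_max_right _ _) hz1)
  exact ⟨f x, hx⟩

/-- There is no definable function with strict local minima everywhere. -/
theorem hc (f : M → K) (hR : OrdDef L M f) {a b : M} (hab : a < b)
    (hr : ∀ x, a < x → x < b → RN x (fun y => f x < f y))
    (hl : ∀ x, a < x → x < b → LN x (fun y => f x < f y)) : False := by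
  obtain ⟨c, d, hac, hcd, hdb, h⟩ := hc_half f hR hab hr hl
  obtain ⟨d', c', hd', hcd', hc', h'⟩ := @hc_half L M _ (dualOrd M) DOrd.dual OMin.dual K _ f hR
    d c hcd (fun x h1 h2 => hl x (lt_of_le_of_lt hac h2) (lt_of_lt_of_le h1 hdb))
      (fun x h1 h2 => hr x (lt_of_le_of_lt hac h2) (lt_of_lt_of_le h1 hdb))
  change d' ≤ d at hd'
  change c' < d' at hcd'
  change c ≤ c' at hc'
  obtain ⟨z, hz1, hz2⟩ := exists_between hcd'
  obtain ⟨k, hk1, hk2⟩ := h z (lt_of_le_of_lt hc' hz1) (lt_of_lt_of_le hz2 hd')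
  obtain ⟨k', hk1', hk2'⟩ := h' z hz2 hz1
  obtain ⟨y1, _, h1, h2⟩ := (hk1.and hk2').exists
  obtain ⟨y2, _, h3, h4⟩ := (hk2.and hk1').exists
  exact lt_irrefl _ (((h1.trans h2).trans h4).trans h3)

theorem OrdDef.flip {f : Γ → K} (h : OrdDef L M f) : OrdDef L M (fun x => OrderDual.toDual (f x)) :=
  Dp.mem (f := fun z : Γ × Γ => (z.2, z.1)) h (by fun_prop)

theorem inc_of_local (f : M → K) (hR : OrdDef L M f) {a b : M}
    (hr : ∀ x, a < x → x < b → RN x (fun y => f x < f y))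
    (hl : ∀ x, a < x → x < b → LN x (fun y => f y < f x)) : StrictMonoOn f (Ioo a b) := by
  intro x hx y hy hxy
  obtain ⟨x', hx'1, hx'2, hx'3⟩ := ((hr x hx.1 hx.2).and (RN.lt hxy)).exists
  have hS : DSet L M {z | f x < f z} := DSet.of (hR.lt (by fun_prop) (by fun_prop))
  refine conn hS hx'3.le hx'2 ?_ ?_
  · intro z h1 h2 h3
    exact (hr z (hx.1.trans (hx'1.trans_le h1)) (h2.trans hy.2)).mono fun y hy => h3.trans hy
  · intro z h1 h2 h3
    obtain ⟨w, hw1, hw2, hw3⟩ :=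
      (h3.and (hl z (hx.1.trans (hx'1.trans h1)) (h2.trans_lt hy.2))).exists
    exact lt_trans hw2 hw3

theorem exists_mono (f : M → K) (hR : OrdDef L M f) {a b : M} (hab : a < b) :
    ∃ c d, a ≤ c ∧ c < d ∧ d ≤ b ∧ ((∀ x ∈ Ioo c d, ∀ y ∈ Ioo c d, f x = f y) ∨
      StrictMonoOn f (Ioo c d) ∨ StrictAntiOn f (Ioo c d)) := by
  have h1 : Dp L M (fun z : M × M => f z.1 < f z.2) := hR
  have h2 : Dp L M (fun z : M × M => f z.2 < f z.1) := hR.lt (by fun_prop) (by fun_prop)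
  have h3 : Dp L M (fun z : M × M => f z.2 = f z.1) := hR.eq (by fun_prop) (by fun_prop)
  have dR : ∀ x, RN x (fun y => f x < f y) ∨ RN x (fun y => f y < f x) ∨ RN x (fun y => f y = f x) := by
    intro x
    have e1 : DSet L M {y | f x < f y} := DSet.of (hR.lt (by fun_prop) (by fun_prop))
    have e2 : DSet L M {y | f y < f x} := DSet.of (hR.lt (by fun_prop) (by fun_prop))
    rcases rn_dich e1 x with h | h
    · exact Or.inl h
    rcases rn_dich e2 x with h' | h'
    · exact Or.inr (Or.inl h')
    · exact Or.inr (Or.inr ((h.and h').mono fun y hy => le_antisymm (not_lt.mp hy.1) (not_lt.mp hy.2)))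
  have dL : ∀ x, LN x (fun y => f x < f y) ∨ LN x (fun y => f y < f x) ∨ LN x (fun y => f y = f x) := by
    intro x
    have e1 : DSet L M {y | f x < f y} := DSet.of (hR.lt (by fun_prop) (by fun_prop))
    have e2 : DSet L M {y | f y < f x} := DSet.of (hR.lt (by fun_prop) (by fun_prop))
    rcases ln_dich e1 x with h | h
    · exact Or.inl h
    rcases ln_dich e2 x with h' | h'
    · exact Or.inr (Or.inl h')
    · exact Or.inr (Or.inr ((h.and h').mono fun y hy => le_antisymm (not_lt.mp hy.1) (not_lt.mp hy.2)))
  have s1 : DSet L M {x | RN x (fun y => f x < f y)} := dfn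
  have s2 : DSet L M {x | RN x (fun y => f y < f x)} := dfn
  have s3 : DSet L M {x | LN x (fun y => f x < f y)} := dfn
  have s4 : DSet L M {x | LN x (fun y => f y < f x)} := dfn
  obtain ⟨a1, b1, ha1, hab1, hb1, t1⟩ := exists_sub_Ioo s1 hab
  obtain ⟨a2, b2, ha2, hab2, hb2, t2⟩ := exists_sub_Ioo s2 hab1
  obtain ⟨a3, b3, ha3, hab3, hb3, t3⟩ := exists_sub_Ioo s3 hab2
  obtain ⟨a4, b4, ha4, hab4, hb4, t4⟩ := exists_sub_Ioo s4 hab3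
  have i1 : Ioo a4 b4 ⊆ Ioo a1 b1 := Ioo_subset_Ioo
    ((ha2.trans (ha3.trans ha4)).le) (hb4.trans (hb3.trans hb2)).le
  have i2 : Ioo a4 b4 ⊆ Ioo a2 b2 := Ioo_subset_Ioo
    ((ha3.trans ha4).le) (hb4.trans hb3).le
  have i3 : Ioo a4 b4 ⊆ Ioo a3 b3 := Ioo_subset_Ioo ha4.le hb4.le
  refine ⟨a4, b4, (ha1.trans (ha2.trans (ha3.trans ha4))).le, hab4,
    (hb4.trans (hb3.trans (hb2.trans hb1))).le, ?_⟩
  have eqc : (∀ x ∈ Ioo a4 b4, RN x (fun y => f y = f x)) →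
      (∀ x ∈ Ioo a4 b4, LN x (fun y => f y = f x)) →
      ∀ x ∈ Ioo a4 b4, ∀ y ∈ Ioo a4 b4, f x = f y := by
    intro hR' hL' 
    have key : ∀ x ∈ Ioo a4 b4, ∀ y ∈ Ioo a4 b4, x ≤ y → f y = f x := by
      intro x hx y hy hxy
      have hS : DSet L M {z | f z = f x} := DSet.of (hR.eq (by fun_prop) (by fun_prop))
      refine conn hS hxy rfl ?_ ?_
      · intro z g1 g2 g3
        exact (hR' z ⟨hx.1.trans_le g1, g2.trans hy.2⟩).mono fun w hw => hw.trans g3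
      · intro z g1 g2 g3
        obtain ⟨w, _, hw1, hw2⟩ := (g3.and (hL' z ⟨hx.1.trans g1, g2.trans_lt hy.2⟩)).exists
        exact hw2.symm.trans hw1
    intro x hx y hy
    rcases le_total x y with h | h
    · exact (key x hx y hy h).symm
    · exact key y hy x hx h
  obtain ⟨m, hm1, hm2⟩ := exists_between hab4
  -- exclude mixed equal cases
  have mixR : (∀ x ∈ Ioo a4 b4, RN x (fun y => f y = f x)) →
      (∀ x ∈ Ioo a4 b4, ¬ LN x (fun y => f y = f x)) → False := by
    intro g1 g2
    obtain ⟨e, he, g3⟩ := (g1 m ⟨hm1, hm2⟩).and (RN.lt hm2)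
    obtain ⟨t, ht1, ht2⟩ := exists_between he
    refine g2 t ⟨hm1.trans ht1, (g3 t ht1 ht2).2⟩ ⟨m, ht1, fun y y1 y2 => ?_⟩
    exact (g3 y y2 (y1.trans ht2)).1.trans (g3 t ht1 ht2).1.symm
  have mixL : (∀ x ∈ Ioo a4 b4, LN x (fun y => f y = f x)) →
      (∀ x ∈ Ioo a4 b4, ¬ RN x (fun y => f y = f x)) → False := by
    intro g1 g2
    obtain ⟨e, he, g3⟩ := (g1 m ⟨hm1, hm2⟩).and (LN.gt hm1)
    obtain ⟨t, ht1, ht2⟩ := exists_between he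
    refine g2 t ⟨(g3 t ht2 ht1).2, ht2.trans hm2⟩ ⟨m, ht2, fun y y1 y2 => ?_⟩
    exact (g3 y y2 (ht1.trans y1)).1.trans (g3 t ht2 ht1).1.symm
  have xR1 : ∀ x, RN x (fun y => f y = f x) → ¬ RN x (fun y => f x < f y) := fun x g1 g2 => by
    obtain ⟨y, _, g3, g4⟩ := (g1.and g2).exists; exact g4.ne g3.symm
  have xR2 : ∀ x, RN x (fun y => f y = f x) → ¬ RN x (fun y => f y < f x) := fun x g1 g2 => by
    obtain ⟨y, _, g3, g4⟩ := (g1.and g2).exists; exact g4.ne g3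
  have xL1 : ∀ x, LN x (fun y => f y = f x) → ¬ LN x (fun y => f x < f y) := fun x g1 g2 => by
    obtain ⟨y, _, g3, g4⟩ := (g1.and g2).exists; exact g4.ne g3.symm
  have xL2 : ∀ x, LN x (fun y => f y = f x) → ¬ LN x (fun y => f y < f x) := fun x g1 g2 => by
    obtain ⟨y, _, g3, g4⟩ := (g1.and g2).exists; exact g4.ne g3
  have HR : (∀ x ∈ Ioo a4 b4, RN x (fun y => f x < f y)) ∨ (∀ x ∈ Ioo a4 b4, RN x (fun y => f y < f x))
     ∨ (∀ x ∈ Ioo a4 b4, RN x (fun y => f y = f x)) := by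
    rcases t1 with t1 | t1
    · exact Or.inl fun x hx => t1 x (i1 hx)
    rcases t2 with t2 | t2
    · exact Or.inr (Or.inl fun x hx => t2 x (i2 hx))
    · refine Or.inr (Or.inr fun x hx => ?_)
      rcases dR x with h | h | h
      · exact absurd h (t1 x (i1 hx))
      · exact absurd h (t2 x (i2 hx))
      · exact h
  have HL : (∀ x ∈ Ioo a4 b4, LN x (fun y => f x < f y)) ∨ (∀ x ∈ Ioo a4 b4, LN x (fun y => f y < f x))
     ∨ (∀ x ∈ Ioo a4 b4, LN x (fun y => f y = f x)) := by
    rcases t3 with t3 | t3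
    · exact Or.inl fun x hx => t3 x (i3 hx)
    rcases t4 with t4 | t4
    · exact Or.inr (Or.inl fun x hx => t4 x (hx))
    · refine Or.inr (Or.inr fun x hx => ?_)
      rcases dL x with h | h | h
      · exact absurd h (t3 x (i3 hx))
      · exact absurd h (t4 x (hx))
      · exact h
  rcases HR with HR | HR | HR <;> rcases HL with HL | HL | HL
  · exact (hc f hR hab4 (fun x g1 g2 => HR x ⟨g1, g2⟩) (fun x g1 g2 => HL x ⟨g1, g2⟩)).elim
  · exact Or.inr (Or.inl (inc_of_local f hR
      (fun x g1 g2 => HR x ⟨g1, g2⟩) (fun x g1 g2 => HL x ⟨g1, g2⟩)))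
  · exact (mixL HL fun x hx h => xR1 x h (HR x hx)).elim
  · refine Or.inr (Or.inr ?_)
    have := inc_of_local (fun x => OrderDual.toDual (f x)) hR.flip
      (fun x g1 g2 => HR x ⟨g1, g2⟩) (fun x g1 g2 => HL x ⟨g1, g2⟩)
    exact fun x hx y hy hxy => this hx hy hxy
  · exact (hc (fun x => OrderDual.toDual (f x)) hR.flip hab4
      (fun x g1 g2 => HR x ⟨g1, g2⟩) (fun x g1 g2 => HL x ⟨g1, g2⟩)).elim
  · exact (mixL HL fun x hx h => xR2 x h (HR x hx)).elim
  · exact (mixR HR fun x hx h => xL1 x h (HL x hx)).elim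
  · exact (mixR HR fun x hx h => xL2 x h (HL x hx)).elim
  · exact Or.inl (eqc HR HL)

/-- Continuity at a point. -/
def CtsAt (f : M → M) (r : M) : Prop :=
  ∀ a b, a < f r → f r < b → NR r (fun x => a < f x ∧ f x < b)

theorem exists_ctsAt {f : M → M} (hf : DefFun L M f) {a b : M} (hab : a < b) :
    ∃ x, a < x ∧ x < b ∧ CtsAt f x := by
  have hR : OrdDef L M f := by unfold OrdDef; exact dfn
  obtain ⟨c, d, hac, hcd, hdb, h⟩ := exists_mono f hR hab
  by_cases hconst : ∀ x ∈ Ioo c d, ∀ y ∈ Ioo c d, f x = f y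
  · obtain ⟨m, hm1, hm2⟩ := exists_between hcd
    refine ⟨m, hac.trans_lt hm1, hm2.trans_le hdb, fun u v hu hv => ?_⟩
    exact ⟨c, d, hm1, hm2, fun y h1 h2 => by
      beta_reduce; rw [hconst y ⟨h1, h2⟩ m ⟨hm1, hm2⟩]; exact ⟨hu, hv⟩⟩
  have h := h.resolve_left hconst
  have hinj : InjOn f (Ioo c d) := by
    rcases h with h | h
    · exact h.injOn
    · exact h.injOn
  have hI : DSet L M {y | ∃ x, (c < x ∧ x < d) ∧ f x = y} := dfn
  have hinf : ({y | ∃ x, (c < x ∧ x < d) ∧ f x = y}).Infinite :=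
    (infinite_Ioo hcd).image hinj
  obtain ⟨p, q, hpq, hsub⟩ := exists_Ioo_of_infinite hI hinf
  obtain ⟨y, hy1, hy2⟩ := exists_between hpq
  obtain ⟨x, hx, rfl⟩ := hsub ⟨hy1, hy2⟩
  refine ⟨x, hac.trans_lt hx.1, hx.2.trans_le hdb, fun u v hu hv => ?_⟩
  obtain ⟨u', hu1, hu2⟩ := exists_between (max_lt hu hy1)
  obtain ⟨v', hv1, hv2⟩ := exists_between (lt_min hv hy2)
  obtain ⟨x1, hx1, rfl⟩ := hsub ⟨(le_max_right _ _).trans_lt hu1, hu2.trans hy2⟩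
  obtain ⟨x2, hx2, rfl⟩ := hsub ⟨hy1.trans hv1, hv2.trans_le (min_le_right _ _)⟩
  have hu1 := (le_max_left _ _).trans_lt hu1
  have hv2 := hv2.trans_le (min_le_left _ _)
  rcases h with h | h
  · refine ⟨x1, x2, (h.lt_iff_lt hx1 hx).1 hu2, (h.lt_iff_lt hx hx2).1 hv1, fun y g1 g2 => ?_⟩
    have hy : y ∈ Ioo c d := ⟨hx1.1.trans g1, g2.trans hx2.2⟩
    exact ⟨hu1.trans (h hx1 hy g1), (h hy hx2 g2).trans hv2⟩
  · refine ⟨x2, x1, (h.lt_iff_gt hx hx2).1 hv1, (h.lt_iff_gt hx1 hx).1 hu2, fun y g1 g2 => ?_⟩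
    have hy : y ∈ Ioo c d := ⟨hx2.1.trans g1, g2.trans hx1.2⟩
    exact ⟨hu1.trans (h hy hx1 g2), (h hx2 hy g1).trans hv2⟩

theorem discont_finite {f : M → M} (hf : DefFun L M f) : {r | ¬ CtsAt f r}.Finite := by
  have hD : DSet L M {r | ¬ CtsAt f r} := by unfold CtsAt; exact dfn
  by_contra hinf
  obtain ⟨a, b, hab, hsub⟩ := exists_Ioo_of_infinite hD hinf
  obtain ⟨x, h1, h2, h3⟩ := exists_ctsAt hf hab
  exact hsub ⟨h1, h2⟩ h3

/-- In an interval, cofinitely many points are available. -/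
theorem exists_notMem {a b : M} (hab : a < b) {F : Set M} (hF : F.Finite) :
    ∃ x, a < x ∧ x < b ∧ x ∉ F := by
  obtain ⟨x, hx, hx2⟩ := (infinite_Ioo hab).exists_notMem_finite hF
  exact ⟨x, hx.1, hx.2, hx2⟩

theorem exists_fun {G : Set (Γ × Δ)} (hG : DSet L M G)
    (hu : ∀ x y y', (x, y) ∈ G → (x, y') ∈ G → y = y') (d : Δ) :
    ∃ f : Γ → Δ, DefFun L M f ∧ (∀ x y, (x, y) ∈ G → f x = y) ∧
      ∀ x, (¬ ∃ y, (x, y) ∈ G) → f x = d := by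
  classical
  refine ⟨fun x => if h : ∃ y, (x, y) ∈ G then h.choose else d, ?_, ?_, ?_⟩
  · refine DefFun.of_graph (G := fun x y => (x, y) ∈ G ∨ ((¬ ∃ y, (x, y) ∈ G) ∧ d = y)) dfn ?_
    intro x y
    by_cases h : ∃ y, (x, y) ∈ G
    · simp only [h, dite_true, not_true_eq_false, false_and, or_false]
      exact ⟨fun e => e ▸ h.choose_spec, fun h' => hu x _ _ h.choose_spec h'⟩
    · have h' := h
      push Not at h'
      simp only [h, dite_false, h' y, false_or, not_false_eq_true, true_and]
  · intro x y hxy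
    have h : ∃ y, (x, y) ∈ G := ⟨y, hxy⟩
    simp only [h, dite_true]
    exact hu x _ _ h.choose_spec hxy
  · intro x h
    simp [h]

/-- Definable supremum function. -/
theorem exists_supF {D : Set (Γ × M)} (hD : DSet L M D) :
    ∃ f : Γ → M, DefFun L M f ∧ ∀ x, (∃ y, (x, y) ∈ D) → (∃ b, ∀ y, (x, y) ∈ D → y ≤ b) →
      IsLUB {y | (x, y) ∈ D} (f x) := by
  obtain ⟨m⟩ := (inferInstance : Nonempty M)
  have hG : DSet L M {z : Γ × M | (∀ y, (z.1, y) ∈ D → y ≤ z.2) ∧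
      ∀ b, (∀ y, (z.1, y) ∈ D → y ≤ b) → z.2 ≤ b} := dfn
  obtain ⟨f, hf, hf1, -⟩ := exists_fun hG
    (fun x y y' h h' => le_antisymm (h.2 _ h'.1) (h'.2 _ h.1)) m
  refine ⟨f, hf, fun x h1 h2 => ?_⟩
  have hDx : DSet L M {y | (x, y) ∈ D} := dfn
  obtain ⟨b, hb⟩ := h2
  obtain ⟨s, hs⟩ := exists_lub hDx h1 ⟨b, hb⟩
  rw [hf1 x s ⟨hs.1, fun b hb => hs.2 hb⟩]
  exact hs

theorem exists_infF {D : Set (Γ × M)} (hD : DSet L M D) :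
    ∃ f : Γ → M, DefFun L M f ∧ ∀ x, (∃ y, (x, y) ∈ D) → (∃ b, ∀ y, (x, y) ∈ D → b ≤ y) →
      IsGLB {y | (x, y) ∈ D} (f x) :=
  @exists_supF L M _ Γ _ (dualOrd M) DOrd.dual OMin.dual D hD

end mono
end OM

namespace OM
section dim

variable {L : FirstOrder.Language} {M : Type u} [L.Structure M]
variable {Γ Δ Ξ Θ : Type u} [Coded M Γ] [Coded M Δ] [Coded M Ξ] [Coded M Θ]
variable [LinearOrder M] [DOrd M] [OMin L M]

theorem infinite_iff {S : Set M} (h : DSet L M S) :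
    S.Infinite ↔ ∃ a b, a < b ∧ ∀ y, a < y → y < b → y ∈ S := by
  constructor
  · intro hS
    obtain ⟨a, b, hab, h⟩ := exists_Ioo_of_infinite h hS
    exact ⟨a, b, hab, fun y h1 h2 => h ⟨h1, h2⟩⟩
  · rintro ⟨a, b, hab, h⟩
    exact (infinite_Ioo hab).mono fun y hy => h y hy.1 hy.2

theorem dim_half {H : Set (M × M)} (hH : DSet L M H) (hfin : ∀ s, {r | (r, s) ∈ H}.Finite)
    {a b y1 : M} (hab : a < b)
    (h : ∀ r, a < r → r < b → ∃ p q, y1 ≤ p ∧ p < q ∧ ∀ y, p < y → y < q → (r, y) ∈ H) : False := by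
  have hHr : ∀ r, DSet L M {y | (r, y) ∈ H} := fun r => dfn
  have hG : DSet L M {z : M × M | y1 ≤ z.2 ∧ RN z.2 (fun y => (z.1, y) ∈ H)} := dfn
  obtain ⟨α, hα, hα1⟩ := exists_infF hG
  have hα2 : ∀ r, a < r → r < b → IsGLB {y | y1 ≤ y ∧ RN y (fun y => (r, y) ∈ H)} (α r) := by
    intro r h1 h2
    obtain ⟨p, q, h3, h4, h5⟩ := h r h1 h2
    exact hα1 r ⟨p, h3, q, h4, h5⟩ ⟨y1, fun y hy => hy.1⟩
  have hα3 : ∀ r, a < r → r < b → RN (α r) (fun y => (r, y) ∈ H) := by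
    intro r h1 h2
    rcases rn_dich (hHr r) (α r) with h3 | ⟨e, he, h3⟩
    · exact h3
    exfalso
    refine he.not_ge ((hα2 r h1 h2).2 fun y hy => ?_)
    by_contra hlt
    obtain ⟨w, hw1, hw2, hw3⟩ := (hy.2.and (RN.lt (not_le.mp hlt))).exists
    exact h3 w (((hα2 r h1 h2).1 hy).trans_lt hw1) hw3 hw2
  obtain ⟨r0, hr1, hr2, hr3⟩ := exists_ctsAt hα hab
  obtain ⟨s, hs⟩ := exists_gt (α r0)
  obtain ⟨s', hs'⟩ := exists_lt (α r0)
  obtain ⟨c, d, hc, hd, hcd⟩ := (hr3 s' s hs' hs).and (NR.mem_Ioo hr1 hr2)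
  have hD : DSet L M {z : M × M | z.2 ≤ s ∧ ∀ y, α z.1 < y → y < z.2 → (z.1, y) ∈ H} := dfn
  obtain ⟨β, hβ, hβ1⟩ := exists_supF hD
  have hβ2 : ∀ r, c < r → r < d → α r < β r ∧ ∀ y, α r < y → y < β r → (r, y) ∈ H := by
    intro r h1 h2
    obtain ⟨⟨h3, h4⟩, h5, h6⟩ := hcd r h1 h2
    obtain ⟨e, he, h7⟩ := hα3 r h5 h6
    have hm : min e s ∈ {y | y ≤ s ∧ ∀ z, α r < z → z < y → (r, z) ∈ H} :=
      ⟨min_le_right _ _, fun z h8 h9 => h7 z h8 (h9.trans_le (min_le_left _ _))⟩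
    have hl : IsLUB {y | y ≤ s ∧ ∀ z, α r < z → z < y → (r, z) ∈ H} (β r) :=
      hβ1 r ⟨_, hm⟩ ⟨s, fun y hy => hy.1⟩
    refine ⟨(lt_min he h4).trans_le (hl.1 hm), fun y h8 h9 => ?_⟩
    by_contra hcon
    refine h9.not_ge (hl.2 fun z hz => ?_)
    by_contra hlt
    exact hcon (hz.2 y h8 (not_le.mp hlt))
  obtain ⟨x, hx1, hx2, hx3⟩ := exists_notMem (hc.trans hd)
    ((discont_finite hα).union (discont_finite hβ))
  simp only [mem_union, mem_ofPred_eq, not_or, not_not] at hx3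
  obtain ⟨s0, hs1, hs2⟩ := exists_between (hβ2 x hx1 hx2).1
  obtain ⟨l, hl⟩ := exists_lt (α x)
  obtain ⟨u, hu⟩ := exists_gt (β x)
  obtain ⟨c', d', hc', hd', h'⟩ := ((hx3.1 l s0 hl hs1).and (hx3.2 s0 u hs2 hu)).and
    (NR.mem_Ioo hx1 hx2)
  refine ((infinite_Ioo (hc'.trans hd')).mono ?_) (hfin s0)
  intro r hr
  have := h' r hr.1 hr.2
  exact (hβ2 r this.2.1 this.2.2).2 s0 this.1.1.2 this.1.2.1

theorem dim_fin {H : Set (M × M)} (hH : DSet L M H) (hfin : ∀ s, {r | (r, s) ∈ H}.Finite) :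
    {r | {s | (r, s) ∈ H}.Infinite}.Finite := by
  have hHr : ∀ r, DSet L M {y | (r, y) ∈ H} := fun r => dfn
  have hI : DSet L M {r | {s | (r, s) ∈ H}.Infinite} := by
    have : Dp L M (fun r => ∃ a b, a < b ∧ ∀ y, a < y → y < b → (r, y) ∈ H) := dfn
    exact this.congr fun r => (infinite_iff (hHr r)).symm
  by_contra hinf
  obtain ⟨a, b, hab, hsub⟩ := exists_Ioo_of_infinite hI hinf
  obtain ⟨y1⟩ := (inferInstance : Nonempty M)
  have hA : DSet L M {r | ∃ p q, y1 ≤ p ∧ p < q ∧ ∀ y, p < y → y < q → (r, y) ∈ H} := dfn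
  obtain ⟨c, d, hac, hcd, hdb, h | h⟩ := exists_sub_Ioo hA hab
  · exact dim_half hH hfin hcd fun r h1 h2 => h r ⟨h1, h2⟩
  · refine @dim_half L M _ (dualOrd M) DOrd.dual OMin.dual H hH hfin d c y1 hcd
      fun r h2 h1 => ?_
    change r < d at h2
    change c < r at h1
    have h3 : {s | (r, s) ∈ H}.Infinite := hsub ⟨hac.trans h1, h2.trans hdb⟩
    obtain ⟨p, q, hpq, h4⟩ := (infinite_iff (hHr r)).1 h3
    have hp : p < y1 := by
      by_contra hcon
      exact h r ⟨h1, h2⟩ ⟨p, q, not_lt.mp hcon, hpq, h4⟩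
    exact ⟨min q y1, p, min_le_right _ _, lt_min hpq hp,
      fun y h5 h6 => h4 y h6 (lt_of_lt_of_le h5 (min_le_left _ _))⟩

/-- Normality of the point `y` with respect to `D` at `r`. -/
def Nml (D : Set (M × M)) (r y : M) : Prop :=
  ((r, y) ∉ D ∧ ∃ y1 y2, y1 < y ∧ y < y2 ∧ NR r (fun r' => ∀ z, y1 < z → z < y2 → (r', z) ∉ D)) ∨
  ((r, y) ∈ D ∧ ∃ y1 y2, y1 < y ∧ y < y2 ∧ ∀ u v, y1 ≤ u → u < y → y < v → v ≤ y2 →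
    NR r (fun r' => ∃ z, (u < z ∧ z < v ∧ (r', z) ∈ D) ∧
      ∀ w, u < w → w < v → (r', w) ∈ D → w = z))

/-- Good points of a family with finite fibers. -/
def GoodAt (D : Set (M × M)) (r : M) : Prop :=
  (∃ c1 c2, NR r (fun r' => ∀ z, (r', z) ∈ D → c1 < z ∧ z < c2)) ∧ ∀ y, Nml D r y

theorem sep_low {D : Set (M × M)} (hD : DSet L M D) (hfin : ∀ r, {y | (r, y) ∈ D}.Finite)
    {β : M → M} (hβ : DefFun L M β) :
    {r | ¬ ∃ y1, y1 < β r ∧ NR r (fun r' => ∀ z, (r', z) ∈ D → z < β r' → z ≤ y1)}.Finite := by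
  have hE : DSet L M {r | ∃ z, (r, z) ∈ D ∧ z < β r} := dfn
  have hD' : DSet L M {z : M × M | z ∈ D ∧ z.2 < β z.1} := dfn
  obtain ⟨γ, hγ, hγ1⟩ := exists_supF hD'
  have hγ2 : ∀ r, (∃ z, (r, z) ∈ D ∧ z < β r) → γ r < β r ∧ ∀ z, (r, z) ∈ D → z < β r → z ≤ γ r := by
    intro r hr
    have hl : IsLUB {z | (r, z) ∈ D ∧ z < β r} (γ r) := hγ1 r hr ⟨β r, fun y hy => hy.2.le⟩
    refine ⟨?_, fun z h1 h2 => hl.1 ⟨h1, h2⟩⟩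
    have hf : {z | (r, z) ∈ D ∧ z < β r}.Finite := (hfin r).subset fun z hz => hz.1
    obtain ⟨m, hm⟩ := hf.exists_maximal hr
    have hm2 : IsGreatest {z | (r, z) ∈ D ∧ z < β r} m :=
      ⟨hm.1, fun z hz => (le_total z m).elim id fun h => hm.2 hz h⟩
    rw [hl.unique hm2.isLUB]
    exact hm.1.2
  refine Set.Finite.subset (((bd_finite hE).union (discont_finite hβ)).union (discont_finite hγ)) ?_
  intro r hr
  by_contra hcon
  simp only [mem_union, mem_ofPred_eq, not_or, not_not, bd] at hcon
  obtain ⟨⟨h1, h2⟩, h3⟩ := hcon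
  apply hr
  rcases Classical.or_iff_not_imp_left.2 fun g1 => by_contra fun g2 => h1 ⟨g1, g2⟩ with h1 | h1
  · obtain ⟨y1, hy1, hy2⟩ := exists_between (hγ2 r h1.self).1
    obtain ⟨l, hl⟩ := exists_lt (γ r)
    exact ⟨y1, hy2, (h1.and (h3 l y1 hl hy1)).mono fun r' h z h4 h5 =>
      ((hγ2 r' h.1).2 z h4 h5).trans h.2.2.le⟩
  · obtain ⟨y1, hy1⟩ := exists_lt (β r)
    exact ⟨y1, hy1, h1.mono fun r' h z h4 h5 => absurd ⟨z, h4, h5⟩ h⟩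

theorem NR.dual {a : M} {P : M → Prop} (h : @NR M (dualOrd M) a P) : NR a P := by
  obtain ⟨b, c, h1, h2, h3⟩ := h
  exact ⟨c, b, h2, h1, fun y h4 h5 => h3 y h5 h4⟩
theorem NR.dual' {a : M} {P : M → Prop} (h : NR a P) : @NR M (dualOrd M) a P := by
  obtain ⟨b, c, h1, h2, h3⟩ := h
  exact ⟨c, b, h2, h1, fun y h4 h5 => h3 y h5 h4⟩

theorem sep_high {D : Set (M × M)} (hD : DSet L M D) (hfin : ∀ r, {y | (r, y) ∈ D}.Finite)
    {β : M → M} (hβ : DefFun L M β) :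
    {r | ¬ ∃ y1, β r < y1 ∧ NR r (fun r' => ∀ z, (r', z) ∈ D → β r' < z → y1 ≤ z)}.Finite := by
  refine (@sep_low L M _ (dualOrd M) DOrd.dual OMin.dual D hD hfin β hβ).subset ?_
  rintro r hr ⟨y1, h1, h2⟩
  exact hr ⟨y1, h1, NR.dual h2⟩

theorem nml_dset {D : Set (M × M)} (hD : DSet L M D) : DSet L M {z : M × M | Nml D z.1 z.2} := by
  unfold Nml; exact dfn

theorem top_fin {D : Set (M × M)} (hD : DSet L M D) (hfin : ∀ r, {y | (r, y) ∈ D}.Finite) :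
    {r | ¬ ∃ c2, NR r (fun r' => ∀ z, (r', z) ∈ D → z < c2)}.Finite := by
  obtain ⟨γ, hγ, hγ1⟩ := exists_supF hD
  refine (discont_finite hγ).subset fun r hr hc => hr ?_
  obtain ⟨c2, h2⟩ := exists_gt (γ r)
  obtain ⟨c1, h1⟩ := exists_lt (γ r)
  refine ⟨c2, (hc c1 c2 h1 h2).mono fun r' h z hz => lt_of_le_of_lt ?_ h.2⟩
  obtain ⟨b, hb⟩ := (hfin r').bddAbove
  exact (hγ1 r' ⟨z, hz⟩ ⟨b, hb⟩).1 hz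

theorem bot_fin {D : Set (M × M)} (hD : DSet L M D) (hfin : ∀ r, {y | (r, y) ∈ D}.Finite) :
    {r | ¬ ∃ c1, NR r (fun r' => ∀ z, (r', z) ∈ D → c1 < z)}.Finite := by
  refine (@top_fin L M _ (dualOrd M) DOrd.dual OMin.dual D hD hfin).subset ?_
  rintro r hr ⟨c, hc⟩
  exact hr ⟨c, NR.dual hc⟩

theorem nml_of {D : Set (M × M)} (hD : DSet L M D) (hfin : ∀ r, {y | (r, y) ∈ D}.Finite)
    {β : M → M} (hβ : DefFun L M β) : {r | ¬ Nml D r (β r)}.Finite := by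
  have hE : DSet L M {r | (r, β r) ∈ D} := dfn
  refine Set.Finite.subset ((((bd_finite hE).union (discont_finite hβ)).union
    (sep_low hD hfin hβ)).union (sep_high hD hfin hβ)) ?_
  intro r hr
  by_contra hcon
  simp only [mem_union, mem_ofPred_eq, not_or, not_not, bd] at hcon
  obtain ⟨⟨⟨h1, h2⟩, y1, hy1, h3⟩, y2, hy2, h4⟩ := hcon
  apply hr
  rcases Classical.or_iff_not_imp_left.2 fun g1 => by_contra fun g2 => h1 ⟨g1, g2⟩ with h1 | h1
  · refine Or.inr ⟨h1.self, y1, y2, hy1, hy2, fun u v hu1 hu2 hv1 hv2 => ?_⟩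
    refine (((h1.and (h2 u v hu2 hv1)).and h3).and h4).mono ?_
    rintro r' ⟨⟨⟨g1, g2⟩, g3⟩, g4⟩
    refine ⟨β r', ⟨g2.1, g2.2, g1⟩, fun w hw1 hw2 hw3 => ?_⟩
    rcases lt_trichotomy w (β r') with h | h | h
    · exact absurd (hu1.trans_lt hw1) (g3 w hw3 h).not_gt
    · exact h
    · exact absurd (hw2.trans_le hv2) (g4 w hw3 h).not_gt
  · refine Or.inl ⟨h1.self, y1, y2, hy1, hy2, ?_⟩
    refine ((h1.and h3).and h4).mono ?_
    rintro r' ⟨⟨g1, g3⟩, g4⟩ w hw1 hw2 hw3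
    rcases lt_trichotomy w (β r') with h | h | h
    · exact absurd hw1 (g3 w hw3 h).not_gt
    · exact g1 (h ▸ hw3)
    · exact absurd hw2 (g4 w hw3 h).not_gt

theorem bad_finite {D : Set (M × M)} (hD : DSet L M D) (hfin : ∀ r, {y | (r, y) ∈ D}.Finite) :
    {r | ¬ GoodAt D r}.Finite := by
  have hN : DSet L M {z : M × M | ¬ Nml D z.1 z.2} := Dp.not (nml_dset hD)
  have key : {r | ∃ y, ¬ Nml D r y}.Finite := by
    have hH : ∀ s, {r | (r, s) ∈ {z : M × M | ¬ Nml D z.1 z.2}}.Finite := fun s =>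
      nml_of hD hfin (β := fun _ => s) (by fun_prop)
    have hV := dim_fin hN hH
    obtain ⟨β, hβ, hβ1⟩ := exists_infF hN
    refine (hV.union (nml_of hD hfin hβ)).subset ?_
    rintro r ⟨y, hy⟩
    by_contra hcon
    simp only [mem_union, mem_ofPred_eq, not_or, not_not, Set.not_infinite] at hcon
    obtain ⟨b, hb⟩ := hcon.1.bddBelow
    have hl : IsGLB {y | ¬ Nml D r y} (β r) := hβ1 r ⟨y, hy⟩ ⟨b, hb⟩
    obtain ⟨m, hm⟩ := hcon.1.exists_minimal ⟨y, hy⟩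
    have hm2 : IsLeast {y | ¬ Nml D r y} m :=
      ⟨hm.1, fun z hz => (le_total m z).elim id fun h => hm.2 hz h⟩
    have e := hl.unique hm2.isGLB
    exact hm2.1 (e ▸ hcon.2)
  refine ((key.union (top_fin hD hfin)).union (bot_fin hD hfin)).subset ?_
  intro r hr
  by_contra hcon
  simp only [mem_union, mem_ofPred_eq, not_or, not_not] at hcon
  obtain ⟨⟨h1, c2, h2⟩, c1, h3⟩ := hcon
  exact hr ⟨⟨c1, c2, (h3.and h2).mono fun r' h z hz => ⟨h.1 z hz, h.2 z hz⟩⟩,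
    fun y => by_contra fun h => h1 ⟨y, h⟩⟩

theorem NR.finite_all {ι : Type*} {r : M} {F : Set ι} (hF : F.Finite) {P : ι → M → Prop}
    (h : ∀ y ∈ F, NR r (P y)) : NR r (fun x => ∀ y ∈ F, P y x) := by
  induction F, hF using Set.Finite.induction_on with
  | empty => exact NR.all (by simp)
  | @insert a s _ _ ih =>
    refine ((h a (by simp)).and (ih fun y hy => h y (by simp [hy]))).mono ?_
    rintro x ⟨h1, h2⟩ y (rfl | hy)
    · exact h1
    · exact h2 y hy

/-- No points accumulate outside of windows, from the right. -/
theorem right_empty {E : Set (M × M)} (hE : DSet L M E) {r c1 c2 : M} (hfin : ∀ r, {y | (r, y) ∈ E}.Finite)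
    (hb : RN r (fun r' => ∀ z, (r', z) ∈ E → c1 < z ∧ z < c2))
    (hw : ∀ y, ∃ y1 y2, y1 < y ∧ y < y2 ∧ RN r (fun r' => ∀ z, y1 < z → z < y2 → (r', z) ∉ E)) :
    RN r (fun r' => ∀ z, (r', z) ∉ E) := by
  have h1 : DSet L M {r' | ∀ z, (r', z) ∉ E} := dfn
  rcases rn_dich h1 r with h | h
  · exact h
  exfalso
  obtain ⟨γ, hγ, hγ1⟩ := exists_infF hE
  have hγ2 : ∀ r', (∃ z, (r', z) ∈ E) → (r', γ r') ∈ E := by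
    intro r' hr'
    obtain ⟨b, hb⟩ := (hfin r').bddBelow
    have hl := hγ1 r' hr' ⟨b, hb⟩
    obtain ⟨m, hm⟩ := (hfin r').exists_minimal hr'
    have hm2 : IsLeast {y | (r', y) ∈ E} m :=
      ⟨hm.1, fun z hz => (le_total m z).elim id fun h => hm.2 hz h⟩
    rw [hl.unique hm2.isGLB]; exact hm.1
  have h2 : RN r (fun r' => (r', γ r') ∈ E) := h.mono fun r' hr' => hγ2 r' (by
    by_contra hc; exact hr' fun z hz => hc ⟨z, hz⟩)
  have hS : DSet L M {y | RN r (fun r' => y < γ r')} := dfn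
  have h3 := (h2.and hb).mono fun r' hr' => hr'.2 _ hr'.1
  obtain ⟨s, hs⟩ := exists_lub hS ⟨c1, h3.mono fun _ h => h.1⟩ ⟨c2, fun y hy => by
    obtain ⟨w, _, hw1, hw2⟩ := (RN.and hy h3).exists
    exact (hw1.trans hw2.2).le⟩
  obtain ⟨y1, y2, hy1, hy2, hw⟩ := hw s
  have h4 : RN r (fun r' => y1 < γ r') := by
    by_contra hcon
    refine hy1.not_ge (hs.2 fun y hy => ?_)
    by_contra hlt
    exact hcon (RN.mono hy fun _ h => (not_le.mp hlt).trans h)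
  have h5 : RN r (fun r' => γ r' < y2) := by
    obtain ⟨v, hv1, hv2⟩ := exists_between hy2
    have hd : DSet L M {r' | v < γ r'} := dfn
    rcases rn_dich hd r with h | h
    · exact absurd (hs.1 h) hv1.not_ge
    · exact h.mono fun _ h => (not_lt.mp h).trans_lt hv2
  obtain ⟨w, _, ⟨hw1, hw2⟩, hw3, hw4⟩ := ((h4.and h5).and (hw.and h2)).exists
  exact hw3 _ hw1 hw2 hw4

theorem near_empty {E : Set (M × M)} (hE : DSet L M E) {r c1 c2 : M} (hfin : ∀ r, {y | (r, y) ∈ E}.Finite)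
    (hb : NR r (fun r' => ∀ z, (r', z) ∈ E → c1 < z ∧ z < c2))
    (hw : ∀ y, ∃ y1 y2, y1 < y ∧ y < y2 ∧ NR r (fun r' => ∀ z, y1 < z → z < y2 → (r', z) ∉ E)) :
    NR r (fun r' => ∀ z, (r', z) ∉ E) := by
  refine NR.of ?_ ?_ ?_
  · intro z
    obtain ⟨y1, y2, h1, h2, h3⟩ := hw z
    exact h3.self z h1 h2
  · refine right_empty hE hfin hb.rn fun y => ?_
    obtain ⟨y1, y2, h1, h2, h3⟩ := hw y
    exact ⟨y1, y2, h1, h2, h3.rn⟩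
  · refine @right_empty L M _ (dualOrd M) DOrd.dual OMin.dual E hE r c2 c1 hfin ?_ fun y => ?_
    · exact hb.ln.mono fun r' h z hz => ⟨(h z hz).2, (h z hz).1⟩
    obtain ⟨y1, y2, h1, h2, h3⟩ := hw y
    exact ⟨y2, y1, h2, h1, h3.ln.mono fun r' h z h4 h5 => h z h5 h4⟩

theorem exists_sep {F : Set M} (hF : F.Finite) :
    ∃ l u : M → M, (∀ y, l y < y ∧ y < u y) ∧ ∀ y ∈ F, ∀ y' ∈ F, y < y' → u y ≤ l y' := by
  have h1 : ∀ p : M × M, ∃ s, p.1 < p.2 → p.1 < s ∧ s < p.2 := by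
    intro p
    by_cases h : p.1 < p.2
    · obtain ⟨s, hs⟩ := exists_between h
      exact ⟨s, fun _ => hs⟩
    · exact ⟨p.1, fun h' => absurd h' h⟩
  choose s hs using h1
  have hu : ∀ y, ∃ u, y < u ∧ ∀ y' ∈ F, y < y' → u ≤ s (y, y') := by
    intro y
    obtain ⟨b, hb⟩ := exists_gt y
    have hfin : (insert b ((fun y' => s (y, y')) '' (F ∩ Ioi y))).Finite :=
      ((hF.inter_of_left _).image _).insert b
    obtain ⟨m, hm⟩ := hfin.exists_minimal ⟨b, by simp⟩
    refine ⟨m, ?_, fun y' h1 h2 => ?_⟩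
    · rcases hm.1 with h | ⟨y', ⟨h1, h2⟩, rfl⟩
      · rw [h]; exact hb
      · exact (hs (y, y') h2).1
    · exact (le_total m _).elim id fun h => hm.2 (Or.inr ⟨y', ⟨h1, h2⟩, rfl⟩) h
  have hl : ∀ y', ∃ l, l < y' ∧ ∀ y ∈ F, y < y' → s (y, y') ≤ l := by
    intro y'
    obtain ⟨b, hb⟩ := exists_lt y'
    have hfin : (insert b ((fun y => s (y, y')) '' (F ∩ Iio y'))).Finite :=
      ((hF.inter_of_left _).image _).insert b
    obtain ⟨m, hm⟩ := hfin.exists_maximal ⟨b, by simp⟩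
    refine ⟨m, ?_, fun y h1 h2 => ?_⟩
    · rcases hm.1 with h | ⟨y, ⟨h1, h2⟩, rfl⟩
      · rw [h]; exact hb
      · exact (hs (y, y') h2).2
    · exact (le_total _ m).elim id fun h => hm.2 (Or.inr ⟨y, ⟨h1, h2⟩, rfl⟩) h
  choose u hu using hu
  choose l hl using hl
  exact ⟨l, u, fun y => ⟨(hl y).1, (hu y).1⟩, fun y hy y' hy' h =>
    ((hu y).2 y' hy' h).trans ((hl y').2 y hy h)⟩

theorem locally_const {D : Set (M × M)} (hD : DSet L M D) (hfin : ∀ r, {y | (r, y) ∈ D}.Finite)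
    {r : M} (hr : GoodAt D r) :
    NR r (fun r' => {y | (r', y) ∈ D}.ncard = {y | (r, y) ∈ D}.ncard) := by
  obtain ⟨⟨c1, c2, hc⟩, hN⟩ := hr
  obtain ⟨l0, u0, hlu0, hsep⟩ := exists_sep (hfin r)
  have h1 : ∀ y, ∃ l u, l < y ∧ y < u ∧ l0 y ≤ l ∧ u ≤ u0 y ∧ ((r, y) ∈ D →
      NR r (fun r' => ∃ z, (l < z ∧ z < u ∧ (r', z) ∈ D) ∧
      ∀ w, l < w → w < u → (r', w) ∈ D → w = z)) := by
    intro y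
    by_cases hy : (r, y) ∈ D
    · rcases hN y with h | ⟨_, y1, y2, h2, h3, h4⟩
      · exact absurd hy h.1
      · exact ⟨max (l0 y) y1, min (u0 y) y2, max_lt (hlu0 y).1 h2, lt_min (hlu0 y).2 h3,
          le_max_left _ _, min_le_left _ _, fun _ => h4 _ _ (le_max_right _ _)
            (max_lt (hlu0 y).1 h2) (lt_min (hlu0 y).2 h3) (min_le_right _ _)⟩
    · exact ⟨l0 y, u0 y, (hlu0 y).1, (hlu0 y).2, le_rfl, le_rfl, fun h => absurd h hy⟩
  choose l u hl hu hl0 hu0 hW using h1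
  have hdis : ∀ y ∈ {y | (r, y) ∈ D}, ∀ y' ∈ {y | (r, y) ∈ D}, ∀ z, l y < z → z < u y →
      l y' < z → z < u y' → y = y' := by
    intro y hy y' hy' z g1 g2 g3 g4
    rcases lt_trichotomy y y' with h | h | h
    · exact absurd (g2.trans_le ((hu0 y).trans ((hsep y hy y' hy' h).trans (hl0 y')))) g3.not_gt
    · exact h
    · exact absurd (g4.trans_le ((hu0 y').trans ((hsep y' hy' y hy h).trans (hl0 y)))) g1.not_gt
  have hE : DSet L M {z : M × M | z ∈ D ∧ ∀ y : {y | (r, y) ∈ D}, ¬ (l y < z.2 ∧ z.2 < u y)} := by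
    have := (hfin r).to_subtype
    exact dfn
  have hemp := near_empty hE (r := r) (c1 := c1) (c2 := c2)
    (fun r => (hfin r).subset fun y hy => hy.1)
    (hc.mono fun r' h z hz => h z hz.1) (by
      intro y
      rcases hN y with ⟨_, y1, y2, g1, g2, g3⟩ | ⟨g0, _⟩
      · exact ⟨y1, y2, g1, g2, g3.mono fun r' h z h4 h5 h6 => h z h4 h5 h6.1⟩
      · exact ⟨l y, u y, hl y, hu y, NR.all fun r' z h4 h5 h6 => h6.2 ⟨y, g0⟩ ⟨h4, h5⟩⟩)
  have hall := NR.finite_all (hfin r) (P := fun y r' => ∃ z, (l y < z ∧ z < u y ∧ (r', z) ∈ D) ∧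
      ∀ w, l y < w → w < u y → (r', w) ∈ D → w = z) fun y hy => hW y hy
  refine (hemp.and hall).mono ?_
  rintro r' ⟨h2, h3⟩
  choose! z hz hz2 using h3
  have hinj : InjOn z {y | (r, y) ∈ D} := by
    intro y hy y' hy' h
    exact hdis y hy y' hy' (z y) (hz y hy).1 (hz y hy).2.1 (h ▸ (hz y' hy').1) (h ▸ (hz y' hy').2.1)
  rw [← hinj.ncard_image]
  congr 1
  ext w
  constructor
  · intro hw
    have h4 := h2 w
    simp only [mem_ofPred_eq, not_and, not_forall, not_not] at h4
    obtain ⟨⟨y, hy⟩, h5, h6⟩ := h4 hw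
    exact ⟨y, hy, (hz2 y hy w h5 h6 hw).symm⟩
  · rintro ⟨y, hy, rfl⟩
    exact (hz y hy).2.2

end dim
end OM

namespace OM
section unif

variable {L : FirstOrder.Language} {M : Type u} [L.Structure M]
variable {Γ Δ Ξ Θ : Type u} [Coded M Γ] [Coded M Δ] [Coded M Ξ] [Coded M Θ]
variable [LinearOrder M] [DOrd M] [OMin L M]

/-- Non-dependent `Fin.cons`. -/
def cns {k : ℕ} (s : M) (x : Fin k → M) : Fin (k+1) → M := Fin.cons s x
/-- Non-dependent `Fin.tail`. -/
def tl {k : ℕ} (x : Fin (k+1) → M) : Fin k → M := fun i => x i.succ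
/-- Non-dependent `Function.update`. -/
def upd {k : ℕ} (x : Fin k → M) (j : Fin k) (r : M) : Fin k → M := Function.update x j r
/-- Non-dependent `Fin.insertNth`. -/
def insn {k : ℕ} (j : Fin (k+1)) (r : M) (x : Fin k → M) : Fin (k+1) → M := Fin.insertNth j r x

@[fun_prop]
theorem DefFun.cns {k : ℕ} {f : Γ → M} {g : Γ → Fin k → M} (hf : DefFun L M f) (hg : DefFun L M g) :
    DefFun L M (fun x => OM.cns (f x) (g x)) := by
  apply DefFun.pi
  intro j
  induction j using Fin.cases with
  | zero => exact hf
  | succ i => exact (DefFun.apply i).comp hg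
@[fun_prop]
theorem DefFun.tl {k : ℕ} {g : Γ → Fin (k+1) → M} (hg : DefFun L M g) :
    DefFun L M (fun x => OM.tl (g x)) := by
  unfold OM.tl; fun_prop
@[fun_prop]
theorem DefFun.upd {k : ℕ} (j : Fin k) {f : Γ → M} {g : Γ → Fin k → M} (hf : DefFun L M f)
    (hg : DefFun L M g) : DefFun L M (fun x => OM.upd (g x) j (f x)) := by
  apply DefFun.pi
  intro i
  by_cases h : i = j
  · subst h; simpa [OM.upd] using hf
  · simpa [OM.upd, h] using (DefFun.apply i).comp hg
@[fun_prop]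
theorem DefFun.insn {k : ℕ} (j : Fin (k+1)) {f : Γ → M} {g : Γ → Fin k → M} (hf : DefFun L M f)
    (hg : DefFun L M g) : DefFun L M (fun x => OM.insn j (f x) (g x)) := by
  apply DefFun.pi
  intro i
  induction i using Fin.succAboveCases j with
  | x => simpa [OM.insn] using hf
  | p i => simpa [OM.insn] using (DefFun.apply i).comp hg

theorem cns_tl {k : ℕ} (x : Fin (k+1) → M) : cns (x 0) (tl x) = x := Fin.cons_self_tail x
@[simp] theorem tl_cns {k : ℕ} (s : M) (x : Fin k → M) : tl (cns s x) = x := by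
  ext i; simp [tl, cns]
@[simp] theorem cns_zero {k : ℕ} (s : M) (x : Fin k → M) : cns s x 0 = s := rfl
@[simp] theorem cns_succ {k : ℕ} (s : M) (x : Fin k → M) (i : Fin k) : cns s x i.succ = x i := by
  simp [cns]
@[simp] theorem upd_cns_zero {k : ℕ} (s r : M) (x : Fin k → M) : upd (cns s x) 0 r = cns r x := by
  simp [upd, cns]
@[simp] theorem upd_cns_succ {k : ℕ} (s r : M) (x : Fin k → M) (j : Fin k) :
    upd (cns s x) j.succ r = cns s (upd x j r) := by
  simp [upd, cns, Fin.cons_update]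
theorem tl_upd {k : ℕ} (r : M) (x : Fin (k+1) → M) (j : Fin k) :
    tl (upd x j.succ r) = upd (tl x) j r := by
  rw [← cns_tl x]; simp
@[simp] theorem upd_self {k : ℕ} (x : Fin k → M) (j : Fin k) : upd x j (x j) = x := by simp [upd]
@[simp] theorem upd_upd {k : ℕ} (x : Fin k → M) (j : Fin k) (r r' : M) :
    upd (upd x j r) j r' = upd x j r' := by simp [upd]
@[simp] theorem upd_at {k : ℕ} (x : Fin k → M) (j : Fin k) (r : M) : upd x j r j = r := by
  simp [upd]

theorem finite_card {S : Set M} (h : S.Finite) (n : ℕ) :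
    S.ncard = n ↔ ∃ f : Fin n → M, (∀ i j, i ≠ j → f i ≠ f j) ∧ ∀ y, y ∈ S ↔ ∃ i, y = f i := by
  constructor
  · rintro rfl
    have := h.to_subtype
    let e := (Finite.equivFin S)
    rw [Nat.card_coe_set_eq] at e
    refine ⟨fun i => (e.symm i : M), fun i j hij h => hij (e.symm.injective (Subtype.ext h)), ?_⟩
    intro y
    constructor
    · intro hy
      exact ⟨e ⟨y, hy⟩, by simp⟩
    · rintro ⟨i, rfl⟩
      exact (e.symm i).2
  · rintro ⟨f, hf, hS⟩
    have : S = f '' univ := by ext y; simp [hS, eq_comm]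
    rw [this, (Set.InjOn.ncard_image (f := f) (fun i _ j _ h => by_contra fun hij => hf i j hij h))]
    simp

theorem card_dset {D : Set (Γ × M)} (hD : DSet L M D) (hfin : ∀ x, {y | (x, y) ∈ D}.Finite) (n : ℕ) :
    Dp L M (fun x => {y | (x, y) ∈ D}.ncard = n) := by
  have : Dp L M (fun x : Γ => ∃ f : Fin n → M, (∀ i j, i ≠ j → f i ≠ f j) ∧
    ∀ y, (x, y) ∈ D ↔ ∃ i, y = f i) := by
    apply Dp.ex
    apply Dp.and
    · exact dfn
    · apply Dp.all; apply Dp.iff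
      · exact dfn
      · apply Dp.exFin; intro i; exact dfn
  exact this.congr fun x => (finite_card (hfin x) n).symm

/-- Finite along lines of direction `j`. -/
def FinAlong {k : ℕ} (j : Fin k) (H : Set (Fin k → M)) : Prop :=
  ∀ x, {r | upd x j r ∈ H}.Finite

/-- Uniform finiteness. -/
def UF (L : FirstOrder.Language) (M : Type u) [L.Structure M] (Γ : Type u) [Coded M Γ] : Prop :=
  ∀ D : Set (Γ × M), DSet L M D → (∀ x, {y | (x, y) ∈ D}.Finite) →
    ∃ N, ∀ x, {y | (x, y) ∈ D}.ncard ≤ N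

theorem finite_bound {n : ℕ} {P : ℕ → ℕ → Prop} (hm : ∀ i a b, a ≤ b → P i a → P i b)
    (h : ∀ i, ∃ N, P i N) : ∃ N, ∀ i ≤ n, P i N := by
  choose N hN using h
  refine ⟨∑ i ∈ Finset.range (n+1), N i, fun i hi => hm i _ _ ?_ (hN i)⟩
  exact Finset.single_le_sum (f := N) (fun _ _ => Nat.zero_le _) (by simp; omega)

theorem NR.exists_ne {a : M} {P : M → Prop} (h : NR a P) : {y | P y}.Infinite := by
  obtain ⟨b, c, h1, h2, h3⟩ := h
  exact (infinite_Ioo (h1.trans h2)).mono fun y hy => h3 y hy.1 hy.2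

theorem NR.notMem_finite {a : M} {F : Set M} (hF : F.Finite) (ha : a ∉ F) : NR a (fun y => y ∉ F) := by
  have := NR.finite_all (r := a) hF (P := fun y x => x ≠ y) (fun y hy => by
    rcases lt_or_gt_of_ne (fun e : a = y => ha (e ▸ hy)) with h | h
    · obtain ⟨l, hl⟩ := exists_lt a
      exact (NR.mem_Ioo hl h).mono fun z hz => hz.2.ne
    · obtain ⟨l, hl⟩ := exists_gt a
      exact (NR.mem_Ioo h hl).mono fun z hz => hz.1.ne')
  exact this.mono fun y h hy => h y hy rfl

theorem claim (k : ℕ) (hUF : ∀ j < k, UF L M (Fin j → M)) (g : (Fin k → M) → ℕ)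
    (ha : ∀ j, ∀ H, DSet L M H → FinAlong j H → ∃ N, ∀ x ∈ H, g x ≤ N)
    (hb : ∀ j, ∃ H, DSet L M H ∧ FinAlong j H ∧ ∀ x, x ∉ H → NR (x j) (fun r => g (upd x j r) = g x))
    (hc : ∀ n, Dp L M (fun x => g x = n)) : ∃ N, ∀ x, g x ≤ N := by
  induction k with
  | zero => exact ⟨g Fin.elim0, fun x => by rw [Subsingleton.elim x Fin.elim0]⟩
  | succ k ih =>
    obtain ⟨H0, hH0, hF0, hL0⟩ := hb 0
    have hfib : ∀ x' : Fin k → M, {s | cns s x' ∈ H0}.Finite := fun x' => by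
      obtain ⟨m⟩ := (inferInstance : Nonempty M)
      simpa using hF0 (cns m x')
    obtain ⟨K, hK⟩ := hUF k (by omega) {z | cns z.2 z.1 ∈ H0} dfn hfib
    have hfib2 : ∀ z : (Fin k → M) × M, {s | (z, s) ∈ {w : ((Fin k → M) × M) × M |
        w.2 < w.1.2 ∧ cns w.2 w.1.1 ∈ H0}}.Finite := fun z =>
      (hfib z.1).subset fun s hs => hs.2
    let cnt : (Fin k → M) → M → ℕ := fun x' s => {s' | s' < s ∧ cns s' x' ∈ H0}.ncard
    let G : ℕ → (Fin k → M) → M → Prop := fun n x' s => cns s x' ∉ H0 ∧ cnt x' s = n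
    have hG : ∀ n, Dp L M (fun z : (Fin k → M) × M => G n z.1 z.2) := by
      intro n
      have h1 := card_dset (L := L) (D := {w : ((Fin k → M) × M) × M |
        w.2 < w.1.2 ∧ cns w.2 w.1.1 ∈ H0}) dfn hfib2 n
      exact Dp.and dfn h1
    have hGnr : ∀ n x' s, G n x' s → NR s (fun s' => G n x' s') := by
      intro n x' s hs
      refine (NR.notMem_finite (hfib x') hs.1).and ?_ |>.mono fun s' h => h
      obtain ⟨b, c, h1, h2, h3⟩ := NR.notMem_finite (hfib x') hs.1
      refine ⟨b, c, h1, h2, fun y hy1 hy2 => ?_⟩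
      rw [← hs.2]
      refine congrArg Set.ncard (Set.ext fun s' => ?_)
      constructor
      · rintro ⟨h4, h5⟩
        refine ⟨?_, h5⟩
        by_contra h6
        exact h3 s' (h1.trans_le (not_lt.1 h6)) (h4.trans hy2) h5
      · rintro ⟨h4, h5⟩
        refine ⟨?_, h5⟩
        by_contra h6
        exact h3 s' (hy1.trans_le (not_lt.1 h6)) (h4.trans h2) h5
    have hconst0 : ∀ n x' s s', s ≤ s' → G n x' s → G n x' s' → g (cns s x') = g (cns s' x') := by
      intro n x' s s' hle hs hs'
      have hno : ∀ y, s ≤ y → y ≤ s' → cns y x' ∉ H0 := by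
        intro y h1 h2 h3
        have h4 : s < y := lt_of_le_of_ne h1 fun e => hs.1 (e ▸ h3)
        have h5 : y < s' := lt_of_le_of_ne h2 fun e => hs'.1 (e ▸ h3)
        have : cnt x' s < cnt x' s' := by
          apply Set.ncard_lt_ncard _ (hfib2 (x', s'))
          refine ⟨fun w hw => ⟨hw.1.trans_le hle, hw.2⟩, fun h => ?_⟩
          exact (h (show y ∈ _ from ⟨h5, h3⟩)).1.not_gt h4
        rw [hs.2, hs'.2] at this
        exact lt_irrefl _ this
      have hS : DSet L M {y | g (cns y x') = g (cns s x')} :=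
        (hc (g (cns s x'))).comp (f := fun y => cns y x') (by fun_prop)
      refine (mem_of_no_bd hS hle rfl ?_).symm
      intro y h1 h2 h3
      have := hL0 _ (hno y h1 h2)
      simp only [upd_cns_zero, cns_zero] at this
      by_cases he : g (cns y x') = g (cns s x')
      · exact h3 (Or.inl (this.mono fun z hz => hz.trans he))
      · exact h3 (Or.inr (this.mono fun z hz hz2 => he (hz.symm.trans hz2)))
    have hconst : ∀ n x' s s', G n x' s → G n x' s' → g (cns s x') = g (cns s' x') := by
      intro n x' s s' h1 h2
      rcases le_total s s' with h | h
      · exact hconst0 n x' s s' h h1 h2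
      · exact (hconst0 n x' s' s h h2 h1).symm
    classical
    let gn : ℕ → (Fin k → M) → ℕ := fun n x' =>
      if h : ∃ s, G n x' s then g (cns h.choose x') else 0
    have hgn : ∀ n x' s, G n x' s → gn n x' = g (cns s x') := by
      intro n x' s hs
      have h : ∃ s, G n x' s := ⟨s, hs⟩
      simp only [gn, h, dite_true]
      exact hconst n x' _ _ h.choose_spec hs
    have hgn0 : ∀ n x', (∀ s, ¬ G n x' s) → gn n x' = 0 := by
      intro n x' h
      have h : ¬ ∃ s, G n x' s := fun ⟨s, hs⟩ => h s hs
      simp only [gn, h, dite_false]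
    have hbn : ∀ n, ∃ N, ∀ x', gn n x' ≤ N := by
      intro n
      have hGn := hG n
      refine ih (fun j hj => hUF j (by omega)) (gn n) ?_ ?_ ?_
      · intro j H hH hF
        obtain ⟨N, hN⟩ := ha j.succ {x | tl x ∈ H} dfn (fun x => by
          simp only [mem_ofPred_eq, tl_upd]; exact hF _)
        refine ⟨N, fun x' hx' => ?_⟩
        by_cases h : ∃ s, G n x' s
        · obtain ⟨s, hs⟩ := h
          rw [hgn n x' s hs]
          exact hN _ (by simpa using hx')
        · rw [hgn0 n x' fun s hs => h ⟨s, hs⟩]; omega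
      · intro j
        obtain ⟨H1, hH1, hF1, hL1⟩ := hb j.succ
        have hGu : Dp L M (fun z : ((Fin k → M) × M) × M => G n (upd z.1.1 j z.2) z.1.2) :=
          hGn.comp (f := fun z : ((Fin k → M) × M) × M => (upd z.1.1 j z.2, z.1.2)) (by fun_prop)
        have hGu' : Dp L M (fun z : ((Fin k → M) × M) × M => G n (upd z.1.1 j z.1.2) z.2) :=
          hGn.comp (f := fun z : ((Fin k → M) × M) × M => (upd z.1.1 j z.1.2, z.2)) (by fun_prop)
        refine ⟨{x' | ¬ (NR (x' j) (fun r => ∀ s, ¬ G n (upd x' j r) s) ∨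
          ∃ s, G n x' s ∧ cns s x' ∉ H1 ∧ NR (x' j) (fun r => G n (upd x' j r) s))}, dfn, ?_, ?_⟩
        · intro x'
          have hE : DSet L M {z : M × M | G n (upd x' j z.1) z.2} :=
            hGn.comp (f := fun z : M × M => (upd x' j z.1, z.2)) (by fun_prop)
          have hE' : Dp L M (fun z : (M × M) × M => G n (upd x' j z.2) z.1.2) :=
            hGn.comp (f := fun z : (M × M) × M => (upd x' j z.2, z.1.2)) (by fun_prop)
          have hH : DSet L M {z : M × M | G n (upd x' j z.1) z.2 ∧ (cns z.2 (upd x' j z.1) ∈ H1 ∨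
              ¬ NR z.1 (fun r => G n (upd x' j r) z.2))} := dfn
          have hdim := dim_fin hH (by
            intro s
            have hS : DSet L M {r | G n (upd x' j r) s} :=
              hGn.comp (f := fun r => (upd x' j r, s)) (by fun_prop)
            have h1 : {r | cns s (upd x' j r) ∈ H1}.Finite := by
              have := hF1 (cns s x')
              simpa using this
            refine (h1.union (bd_finite hS)).subset ?_
            rintro r ⟨h2, h3 | h3⟩
            · exact Or.inl h3
            · refine Or.inr ?_
              rintro (h | h)
              · exact h3 h
              · exact h.self h2)
          have hNe : DSet L M {r | ∃ s, G n (upd x' j r) s} := dfn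
          refine (hdim.union (bd_finite hNe)).subset ?_
          intro r hr
          by_contra hcon
          simp only [mem_union, not_or] at hcon
          obtain ⟨h1, h2⟩ := hcon
          apply hr
          simp only [upd_at, upd_upd]
          simp only [bd, mem_ofPred_eq, not_not] at h2
          rcases h2 with h2 | h2
          · right
            obtain ⟨s0, hs0⟩ := h2.self
            have hinf := (hGnr n _ s0 hs0).exists_ne
            have h1' := Set.not_infinite.1 h1
            obtain ⟨s, hs1, hs2⟩ := hinf.exists_notMem_finite h1'
            refine ⟨s, hs1, ?_, ?_⟩
            · exact fun h => hs2 ⟨hs1, Or.inl h⟩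
            · by_contra h; exact hs2 ⟨hs1, Or.inr h⟩
          · left
            exact h2.mono fun r' h s hs => h ⟨s, hs⟩
        · intro x' hx'
          simp only [mem_ofPred_eq, not_not] at hx'
          rcases hx' with h | ⟨s, h1, h2, h3⟩
          · have h0 := h.self
            rw [upd_self] at h0
            exact h.mono fun r hr => by rw [hgn0 n _ hr, hgn0 n _ h0]
          · have := hL1 _ h2
            simp only [cns_succ, upd_cns_succ] at this
            exact (h3.and this).mono fun r hr => by
              rw [hgn n _ s hr.1, hgn n _ s h1, hr.2]
      · intro m
        have h1 : Dp L M (fun z : (Fin k → M) × M => g (cns z.2 z.1) = m) :=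
          (hc m).comp (f := fun z : (Fin k → M) × M => cns z.2 z.1) (by fun_prop)
        have h2 : Dp L M (fun x' : Fin k → M => (∃ s, G n x' s ∧ g (cns s x') = m) ∨
          ((∀ s, ¬ G n x' s) ∧ 0 = m)) := dfn
        refine h2.congr fun x' => ?_
        by_cases h : ∃ s, G n x' s
        · obtain ⟨s, hs⟩ := h
          rw [hgn n x' s hs]
          constructor
          · rintro (⟨s', h1, h2⟩ | ⟨h, -⟩)
            · rw [← h2]; exact hconst n x' s s' hs h1
            · exact absurd hs (h s)
          · exact fun h => Or.inl ⟨s, hs, h⟩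
        · rw [hgn0 n x' fun s hs => h ⟨s, hs⟩]
          constructor
          · rintro (⟨s', h1, h2⟩ | ⟨-, h⟩)
            · exact absurd ⟨s', h1⟩ h
            · exact h
          · exact fun h' => Or.inr ⟨fun s hs => h ⟨s, hs⟩, h'⟩
    obtain ⟨N1, hN1⟩ := finite_bound (n := K) (P := fun n N => ∀ x', gn n x' ≤ N)
      (fun i a b hab h x' => (h x').trans hab) hbn
    obtain ⟨N0, hN0⟩ := ha 0 H0 hH0 hF0
    refine ⟨max N0 N1, fun x => ?_⟩
    by_cases hx : x ∈ H0
    · exact (hN0 x hx).trans (le_max_left _ _)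
    · refine le_trans ?_ (le_max_right _ _)
      have h1 : G (cnt (tl x) (x 0)) (tl x) (x 0) := ⟨by rwa [cns_tl], rfl⟩
      have h2 := hgn _ _ _ h1
      rw [cns_tl] at h2
      rw [← h2]
      refine hN1 _ ?_ _
      refine le_trans ?_ (hK (tl x))
      exact Set.ncard_le_ncard (fun s hs => hs.2) (hfib _)

theorem insn_upd {k : ℕ} (j : Fin (k+1)) (x : Fin (k+1) → M) (r : M) :
    insn j r (fun i => x (j.succAbove i)) = upd x j r := by
  ext i
  induction i using Fin.succAboveCases j with
  | x => simp [insn, upd]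
  | p i => simp [insn, upd]

theorem UF_fin (k : ℕ) : UF L M (Fin k → M) := by
  induction k using Nat.strong_induction_on with
  | _ k ih =>
  intro D hD hfin
  refine claim k ih (fun x => {y | (x, y) ∈ D}.ncard) ?_ ?_ (fun n => card_dset hD hfin n)
  · intro j H hH hF
    obtain ⟨k, rfl⟩ : ∃ k', k = k' + 1 := ⟨k - 1, by have := j.2; omega⟩
    have hF' : ∀ x'' : Fin k → M, {r | insn j r x'' ∈ H}.Finite := by
      intro x''
      obtain ⟨m⟩ := (inferInstance : Nonempty M)
      have := hF (insn j m x'')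
      simp only [← insn_upd] at this
      simpa [insn] using this
    obtain ⟨N, hN⟩ := ih k (by omega) {z | ∃ r, insn j r z.1 ∈ H ∧ (insn j r z.1, z.2) ∈ D} dfn (by
      intro x''
      have := (hF' x'').biUnion (t := fun r => {y | (insn j r x'', y) ∈ D}) fun r _ => hfin _
      refine this.subset ?_
      rintro y ⟨r, h1, h2⟩
      simp only [mem_iUnion]
      exact ⟨r, h1, h2⟩)
    refine ⟨N, fun x hx => le_trans ?_ (hN (fun i => x (j.succAbove i)))⟩
    apply Set.ncard_le_ncard
    · intro y hy
      have := insn_upd j x (x j)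
      rw [upd_self] at this
      exact ⟨x j, by rwa [this], by rwa [this]⟩
    · have := (hF' (fun i => x (j.succAbove i))).biUnion
        (t := fun r => {y | (insn j r (fun i => x (j.succAbove i)), y) ∈ D}) fun r _ => hfin _
      refine this.subset ?_
      rintro y ⟨r, h1, h2⟩
      simp only [mem_iUnion]
      exact ⟨r, h1, h2⟩
  · intro j
    have hd : ∀ x, DSet L M {z : M × M | (upd x j z.1, z.2) ∈ D} := fun x => dfn
    refine ⟨{x | ¬ GoodAt {z : M × M | (upd x j z.1, z.2) ∈ D} (x j)}, ?_, ?_, ?_⟩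
    · unfold GoodAt Nml
      simp only [mem_ofPred_eq]
      exact dfn
    · intro x
      simp only [mem_ofPred_eq, upd_upd, upd_at]
      exact bad_finite (hd x) fun r => hfin (upd x j r)
    · intro x hx
      simp only [mem_ofPred_eq, not_not] at hx
      have := locally_const (hd x) (fun r => hfin (upd x j r)) hx
      simpa using this


/-- Definable bijection of a coded type with a standard power. -/
theorem exists_code (M : Type u) [L.Structure M] (Γ : Type u) [Coded M Γ] :
    ∃ (n : ℕ) (f : Γ → (Fin n → M)) (g : (Fin n → M) → Γ), DefFun L M f ∧ DefFun L M g ∧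
      (∀ x, g (f x) = x) ∧ ∀ y, f (g y) = y := by
  obtain ⟨n, ⟨e⟩⟩ := Finite.exists_equiv_fin (Coded.ι M Γ)
  refine ⟨n, fun x i => Coded.e (M := M) x (e.symm i),
    fun y => (Coded.e (M := M) (Γ := Γ)).symm (fun i => y (e i)), ?_, ?_, ?_, ?_⟩
  · apply DefFun.ofCrd
    refine ⟨fun i => e.symm i.1, fun x => ?_⟩
    ext ⟨i, j⟩
    rfl
  · apply DefFun.ofCrd
    refine ⟨fun i => (e i, ()), fun x => ?_⟩
    rw [Equiv.apply_symm_apply]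
    rfl
  · intro x; simp
  · intro y; simp

theorem UF_all : UF L M Γ := by
  intro D hD hfin
  obtain ⟨n, f, g, hf, hg, h1, h2⟩ := exists_code (L := L) M Γ
  obtain ⟨N, hN⟩ := UF_fin (L := L) (M := M) n {z | (g z.1, z.2) ∈ D} dfn fun x => hfin (g x)
  exact ⟨N, fun x => by simpa [h1] using hN (f x)⟩

theorem UF_fun {D : Set (Γ × M)} (hD : DSet L M D) (hfin : ∀ x, {y | (x, y) ∈ D}.Finite) :
    ∃ (N : ℕ) (f : Fin N → Γ → M), (∀ i, DefFun L M (f i)) ∧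
      ∀ x y, (x, y) ∈ D → ∃ i, f i x = y := by
  obtain ⟨N, hN⟩ := UF_all (L := L) D hD hfin
  refine ⟨N, ?_⟩
  induction N generalizing D with
  | zero =>
    refine ⟨fun i => i.elim0, fun i => i.elim0, fun x y hxy => ?_⟩
    have := (Set.ncard_eq_zero (hfin x)).1 (Nat.le_zero.1 (hN x))
    exact absurd (show y ∈ {y | (x, y) ∈ D} from hxy) (by simp [this])
  | succ N ih =>
    obtain ⟨b, hb, hb1⟩ := exists_infF hD
    have hmin : ∀ x, (∃ y, (x, y) ∈ D) → (x, b x) ∈ D := by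
      intro r' hr'
      obtain ⟨b, hb⟩ := (hfin r').bddBelow
      have hl := hb1 r' hr' ⟨b, hb⟩
      obtain ⟨m, hm⟩ := (hfin r').exists_minimal hr'
      have hm2 : IsLeast {y | (r', y) ∈ D} m :=
        ⟨hm.1, fun z hz => (le_total m z).elim id fun h => hm.2 hz h⟩
      rw [hl.unique hm2.isGLB]; exact hm.1
    have hfin' : ∀ x, {y | (x, y) ∈ {z : Γ × M | z ∈ D ∧ z.2 ≠ b z.1}}.Finite := fun x =>
      (hfin x).subset fun y hy => hy.1
    obtain ⟨f, hf, hf1⟩ := ih (D := {z | z ∈ D ∧ z.2 ≠ b z.1}) dfn hfin' (by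
        intro x
        by_cases hx : ∃ y, (x, y) ∈ D
        · have : {y | (x, y) ∈ {z : Γ × M | z ∈ D ∧ z.2 ≠ b z.1}}.ncard < {y | (x, y) ∈ D}.ncard := by
            apply Set.ncard_lt_ncard _ (hfin x)
            refine ⟨fun y hy => hy.1, fun h => ?_⟩
            exact (h (show b x ∈ {y | (x, y) ∈ D} from hmin x hx)).2 rfl
          have := hN x
          omega
        · have : {y | (x, y) ∈ {z : Γ × M | z ∈ D ∧ z.2 ≠ b z.1}} = ∅ := by
            ext y; simp only [mem_ofPred_eq, mem_empty_iff_false, iff_false]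
            exact fun h => hx ⟨y, h.1⟩
          rw [this]; simp)
    refine ⟨Fin.cons b f, fun i => ?_, fun x y hxy => ?_⟩
    · induction i using Fin.cases with
      | zero => exact hb
      | succ i => exact hf i
    · by_cases h : y = b x
      · exact ⟨0, h.symm⟩
      · obtain ⟨i, hi⟩ := hf1 x y ⟨hxy, h⟩
        exact ⟨i.succ, hi⟩

end unif
end OM

namespace OM
section nice

variable {L : FirstOrder.Language} {M : Type u} [L.Structure M]
variable {Γ Δ Ξ Θ : Type u} [Coded M Γ] [Coded M Δ] [Coded M Ξ] [Coded M Θ]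

/-- `P` holds on some basic neighbourhood of the scheme `(V, N)` at `x`. -/
def Near {Γ M : Type u} (V : Set (Γ × M)) (N : Set ((Γ × M) × M)) (x : Γ) (P : M → Prop) : Prop :=
  ∃ y, (x, y) ∈ V ∧ ∀ z, ((x, y), z) ∈ N → P z

/-- A definable scheme of nested neighbourhoods generating a one-variable type at each point. -/
structure Scheme (L : FirstOrder.Language) {M : Type u} [L.Structure M] {Γ : Type u} [Coded M Γ]
    (V : Set (Γ × M)) (N : Set ((Γ × M) × M)) : Prop where
  hV : DSet L M V
  hN : DSet L M N
  self : ∀ x y, (x, y) ∈ V → ((x, y), y) ∈ N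
  trans : ∀ x y z, (x, y) ∈ V → ((x, y), z) ∈ N →
    (x, z) ∈ V ∧ ∀ w, ((x, z), w) ∈ N → ((x, y), w) ∈ N
  tot : ∀ x y y', (x, y) ∈ V → (x, y') ∈ V →
    (∀ w, ((x, y), w) ∈ N → ((x, y'), w) ∈ N) ∨ (∀ w, ((x, y'), w) ∈ N → ((x, y), w) ∈ N)
  dich : ∀ x (D : Set M), DSet L M D → Near V N x (fun z => z ∈ D) ∨ Near V N x (fun z => z ∉ D)

/-- The class of ultrafilters built by iterating schemes and definable maps. -/
inductive Nice (L : FirstOrder.Language) (M : Type u) [L.Structure M] :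
    (Γ : Type u) → [Coded M Γ] → Ultrafilter Γ → Prop
  | unit (p : Ultrafilter PUnit.{u+1}) : Nice L M PUnit.{u+1} p
  | map (Γ Δ : Type u) [Coded M Γ] [Coded M Δ] (p : Ultrafilter Γ) (hp : Nice L M Γ p) (g : Γ → Δ)
      (hg : DefFun L M g) : Nice L M Δ (p.map g)
  | scheme (Γ : Type u) [Coded M Γ] (p : Ultrafilter Γ) (hp : Nice L M Γ p) (V : Set (Γ × M))
      (N : Set ((Γ × M) × M)) (hS : Scheme L V N) (q : Ultrafilter (Γ × M))
      (hq : ∀ D : Set (Γ × M), DSet L M D → (D ∈ q ↔ {x | Near V N x (fun z => (x, z) ∈ D)} ∈ p)) :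
      Nice L M (Γ × M) q

theorem DSet.pre {D : Set Δ} (hD : DSet L M D) {f : Γ → Δ} (hf : DefFun L M f) :
    DSet L M (f ⁻¹' D) := Dp.comp hD hf

theorem Near.mono {V : Set (Γ × M)} {N : Set ((Γ × M) × M)} {x : Γ} {P Q : M → Prop}
    (h : Near V N x P) (hh : ∀ z, P z → Q z) : Near V N x Q := by
  obtain ⟨y, h1, h2⟩ := h
  exact ⟨y, h1, fun z hz => hh z (h2 z hz)⟩

theorem Near.and {V : Set (Γ × M)} {N : Set ((Γ × M) × M)} (hS : Scheme L V N) {x : Γ}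
    {P Q : M → Prop} (h : Near V N x P) (h' : Near V N x Q) : Near V N x (fun z => P z ∧ Q z) := by
  obtain ⟨y, h1, h2⟩ := h
  obtain ⟨y', h1', h2'⟩ := h'
  rcases hS.tot x y y' h1 h1' with h | h
  · exact ⟨y, h1, fun z hz => ⟨h2 z hz, h2' z (h z hz)⟩⟩
  · exact ⟨y', h1', fun z hz => ⟨h2 z (h z hz), h2' z hz⟩⟩

theorem Near.exists {V : Set (Γ × M)} {N : Set ((Γ × M) × M)} (hS : Scheme L V N) {x : Γ}
    {P : M → Prop} (h : Near V N x P) : ∃ z, P z := by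
  obtain ⟨y, h1, h2⟩ := h
  exact ⟨y, h2 y (hS.self x y h1)⟩

/-- Extension of an ultrafilter along a scheme. -/
theorem exists_scheme_ultra {V : Set (Γ × M)} {N : Set ((Γ × M) × M)} (hS : Scheme L V N)
    (p : Ultrafilter Γ) : ∃ q : Ultrafilter (Γ × M), ∀ D : Set (Γ × M), DSet L M D →
      (D ∈ q ↔ {x | Near V N x (fun z => (x, z) ∈ D)} ∈ p) := by
  have huniv : ∀ x, Near V N x (fun _ => True) := by
    intro x
    rcases hS.dich x ∅ (Dp.const False) with h | h
    · exact h.mono fun _ _ => trivial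
    · exact h.mono fun _ _ => trivial
  let F : Filter (Γ × M) :=
    { sets := {A | {x | Near V N x (fun z => (x, z) ∈ A)} ∈ p}
      univ_sets := by
        refine Filter.mem_of_superset (Filter.univ_mem) fun x _ => ?_
        exact (huniv x).mono fun _ _ => mem_univ _
      sets_of_superset := by
        intro A B hA hAB
        exact Filter.mem_of_superset hA fun x hx => Near.mono hx fun z hz => hAB hz
      inter_sets := by
        intro A B hA hB
        exact Filter.mem_of_superset (Filter.inter_mem hA hB) fun x hx =>
          (Near.and hS hx.1 hx.2).mono fun z hz => hz }
  have hmem : ∀ A, A ∈ F ↔ {x | Near V N x (fun z => (x, z) ∈ A)} ∈ p := fun A => Iff.rfl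
  have : F.NeBot := by
    refine ⟨fun h => ?_⟩
    have h1 : (∅ : Set (Γ × M)) ∈ F := by rw [h]; trivial
    rw [hmem] at h1
    obtain ⟨x, hx⟩ := Ultrafilter.nonempty_of_mem h1
    obtain ⟨z, hz⟩ := Near.exists hS hx
    exact hz
  refine ⟨Ultrafilter.of F, fun D hD => ⟨fun h => ?_, fun h => Ultrafilter.of_le F h⟩⟩
  by_contra hcon
  rw [← Ultrafilter.compl_mem_iff_notMem] at hcon
  have h1 : Dᶜ ∈ F := by
    rw [hmem]
    refine Filter.mem_of_superset hcon fun x hx => ?_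
    have hDx : DSet L M {z | (x, z) ∈ D} := Dp.comp hD (f := fun z => (x, z)) (by fun_prop)
    exact (hS.dich x _ hDx).resolve_left hx
  exact Ultrafilter.compl_notMem_iff.2 h (Ultrafilter.of_le F h1)

/-- Directed definable bases for definable families. -/
def Good (L : FirstOrder.Language) (M : Type u) [L.Structure M] {Γ : Type u} [Coded M Γ]
    (p : Ultrafilter Γ) : Prop :=
  ∀ (Θ : Type u) [Coded M Θ] (D : Set (Θ × Γ)), DSet L M D →
    ∃ (Θ' : Type u) (_ : Coded M Θ') (W : Set Θ') (D' : Set (Θ' × Γ)), DSet L M W ∧ DSet L M D' ∧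
      (∀ w ∈ W, {x | (w, x) ∈ D'} ∈ p) ∧
      (∀ w ∈ W, ∀ w' ∈ W, ∃ w'' ∈ W, ∀ x, (w'', x) ∈ D' → (w, x) ∈ D' ∧ (w', x) ∈ D') ∧
      ∀ u, {x | (u, x) ∈ D} ∈ p → ∃ w ∈ W, ∀ x, (w, x) ∈ D' → (u, x) ∈ D

theorem Good.dp {p : Ultrafilter Γ} (hp : Good L M p) {D : Set (Θ × Γ)} (hD : DSet L M D) :
    Dp L M (fun u => {x | (u, x) ∈ D} ∈ p) := by
  obtain ⟨Θ', _, W, D', hW, hD', h1, h2, h3⟩ := hp Θ D hD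
  have : Dp L M (fun u : Θ => ∃ w, w ∈ W ∧ ∀ x, (w, x) ∈ D' → (u, x) ∈ D) := by
    refine Dp.ex (Dp.and ?_ (Dp.all (Dp.imp ?_ ?_)))
    · exact Dp.mem hW (by fun_prop)
    · exact Dp.mem hD' (by fun_prop)
    · exact Dp.mem hD (by fun_prop)
  refine this.congr fun u => ⟨?_, h3 u⟩
  rintro ⟨w, hw, h⟩
  exact Filter.mem_of_superset (h1 w hw) fun x hx => h x hx

theorem Good.scheme {p : Ultrafilter Γ} (hp : Good L M p) {V : Set (Γ × M)} {N : Set ((Γ × M) × M)}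
    (hS : Scheme L V N) {q : Ultrafilter (Γ × M)}
    (hq : ∀ D : Set (Γ × M), DSet L M D → (D ∈ q ↔ {x | Near V N x (fun z => (x, z) ∈ D)} ∈ p)) :
    Good L M q := by
  intro Θ _ D hD
  have hV := hS.hV
  have hN := hS.hN
  let R : Set (Θ × (Γ × M)) := {a | a.2 ∈ V ∧ ∀ z, (a.2, z) ∈ N → (a.1, (a.2.1, z)) ∈ D}
  have hR : DSet L M R := by
    refine Dp.and ?_ (Dp.all (Dp.imp ?_ ?_))
    · exact Dp.mem hV (by fun_prop)
    · exact Dp.mem hN (by fun_prop)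
    · exact Dp.mem hD (by fun_prop)
  let E : Set ((Θ × Θ) × Γ) := {a | (∃ y, (a.1.1, (a.2, y)) ∈ R) ∧
    ∀ y, (a.1.1, (a.2, y)) ∈ R → (a.1.2, (a.2, y)) ∈ R}
  have hE : DSet L M E := by
    refine Dp.and (Dp.ex ?_) (Dp.all (Dp.imp ?_ ?_))
    all_goals exact Dp.mem hR (by fun_prop)
  obtain ⟨Θ', _, W, F, hW, hF, h1, h2, h3⟩ := hp _ E hE
  have hdown : ∀ u x y, (u, (x, y)) ∈ R → ∀ z, ((x, y), z) ∈ N → (u, (x, z)) ∈ R := by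
    intro u x y hy z hz
    obtain ⟨h4, h5⟩ := hS.trans x y z hy.1 hz
    exact ⟨h4, fun w hw => hy.2 w (h5 w hw)⟩
  refine ⟨Θ' × Θ, inferInstance, {a | a.1 ∈ W ∧ ∀ x, (a.1, x) ∈ F → ((a.2, a.2), x) ∈ E},
    {a | (a.1.1, a.2.1) ∈ F ∧ (a.1.2, a.2) ∈ R}, ?_, ?_, ?_, ?_, ?_⟩
  · refine Dp.and ?_ (Dp.all (Dp.imp ?_ ?_))
    · exact Dp.mem hW (by fun_prop)
    · exact Dp.mem hF (by fun_prop)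
    · exact Dp.mem hE (by fun_prop)
  · exact Dp.and (Dp.mem hF (by fun_prop)) (Dp.mem hR (by fun_prop))
  · rintro ⟨w, u⟩ ⟨hw, hwE⟩
    rw [hq]
    · refine Filter.mem_of_superset (h1 w hw) fun x hx => ?_
      obtain ⟨⟨y, hy⟩, -⟩ := hwE x hx
      exact ⟨y, hy.1, fun z hz => ⟨hx, hdown u x y hy z hz⟩⟩
    · exact Dp.and (Dp.mem hF (by fun_prop)) (Dp.mem hR (by fun_prop))
  · rintro ⟨w, u⟩ ⟨hw, hwE⟩ ⟨w', u'⟩ ⟨hw', hwE'⟩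
    have hun : {x | ((u, u'), x) ∈ E} ∪ {x | ((u', u), x) ∈ E} ∈ p := by
      refine Filter.mem_of_superset (Filter.inter_mem (h1 w hw) (h1 w' hw')) ?_
      rintro x ⟨hx1, hx2⟩
      have e1 := (hwE x hx1).1
      have e2 := (hwE' x hx2).1
      by_contra hcon
      simp only [mem_union, not_or] at hcon
      have c1 : ∃ y, (u, (x, y)) ∈ R ∧ (u', (x, y)) ∉ R := by
        by_contra hc; push Not at hc; exact hcon.1 ⟨e1, hc⟩
      have c2 : ∃ y, (u', (x, y)) ∈ R ∧ (u, (x, y)) ∉ R := by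
        by_contra hc; push Not at hc; exact hcon.2 ⟨e2, hc⟩
      obtain ⟨y, hy1, hy2⟩ := c1
      obtain ⟨y', hy1', hy2'⟩ := c2
      rcases hS.tot x y y' hy1.1 hy1'.1 with h | h
      · exact hy2 ⟨hy1.1, fun z hz => hy1'.2 z (h z hz)⟩
      · exact hy2' ⟨hy1'.1, fun z hz => hy1.2 z (h z hz)⟩
    rcases Ultrafilter.union_mem_iff.1 hun with h | h
    · obtain ⟨w1, hw1, hw1E⟩ := h3 _ h
      obtain ⟨w2, hw2, hw2E⟩ := h2 w hw w' hw'
      obtain ⟨w3, hw3, hw3E⟩ := h2 w1 hw1 w2 hw2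
      refine ⟨(w3, u), ⟨hw3, fun x hx => hwE x (hw2E x (hw3E x hx).2).1⟩, ?_⟩
      rintro ⟨x, y⟩ ⟨g1, g2⟩
      exact ⟨⟨(hw2E x (hw3E x g1).2).1, g2⟩, (hw2E x (hw3E x g1).2).2,
        (hw1E x (hw3E x g1).1).2 y g2⟩
    · obtain ⟨w1, hw1, hw1E⟩ := h3 _ h
      obtain ⟨w2, hw2, hw2E⟩ := h2 w hw w' hw'
      obtain ⟨w3, hw3, hw3E⟩ := h2 w1 hw1 w2 hw2
      refine ⟨(w3, u'), ⟨hw3, fun x hx => hwE' x (hw2E x (hw3E x hx).2).2⟩, ?_⟩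
      rintro ⟨x, y⟩ ⟨g1, g2⟩
      exact ⟨⟨(hw2E x (hw3E x g1).2).1, (hw1E x (hw3E x g1).1).2 y g2⟩,
        (hw2E x (hw3E x g1).2).2, g2⟩
  · intro u hu
    rw [hq _ (DSet.of (Dp.mem hD (by fun_prop)))] at hu
    obtain ⟨w, hw, hwE⟩ := h3 (u, u) (Filter.mem_of_superset hu fun x hx => by
      obtain ⟨y, hy1, hy2⟩ := hx
      exact ⟨⟨y, hy1, hy2⟩, fun _ h => h⟩)
    refine ⟨(w, u), ⟨hw, hwE⟩, ?_⟩
    rintro ⟨x, y⟩ ⟨g1, g2⟩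
    exact g2.2 y (hS.self x y g2.1)

theorem Nice.good {p : Ultrafilter Γ} (hp : Nice L M Γ p) : Good L M p := by
  induction hp with
  | unit p =>
    intro Θ _ D hD
    refine ⟨PUnit, inferInstance, univ, univ, Dp.const True, Dp.const True,
      fun w _ => Filter.univ_mem, fun w _ w' _ => ⟨w, trivial, fun _ h => ⟨h, h⟩⟩, fun u hu =>
      ⟨PUnit.unit, trivial, fun x _ => ?_⟩⟩
    obtain ⟨x', hx'⟩ := Ultrafilter.nonempty_of_mem hu
    exact hx'
  | map Γ Δ p hp g hg ih =>
    intro Θ _ D hD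
    obtain ⟨Θ', _, W, F, hW, hF, h1, h2, h3⟩ := ih Θ {a | (a.1, g a.2) ∈ D} (DSet.of (Dp.mem hD (by fun_prop)))
    refine ⟨Θ', inferInstance, W, {a | ∃ x, (a.1, x) ∈ F ∧ g x = a.2}, hW, ?_, ?_, ?_, ?_⟩
    · exact Dp.ex (Dp.and (Dp.mem hF (by fun_prop)) (Dp.eq (by fun_prop) (by fun_prop)))
    · intro w hw
      rw [Ultrafilter.mem_map]
      exact Filter.mem_of_superset (h1 w hw) fun x hx => ⟨x, hx, rfl⟩
    · intro w hw w' hw'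
      obtain ⟨w2, hw2, hw2E⟩ := h2 w hw w' hw'
      refine ⟨w2, hw2, ?_⟩
      rintro y ⟨x, hx, rfl⟩
      exact ⟨⟨x, (hw2E x hx).1, rfl⟩, ⟨x, (hw2E x hx).2, rfl⟩⟩
    · intro u hu
      rw [Ultrafilter.mem_map] at hu
      obtain ⟨w, hw, hwE⟩ := h3 u hu
      refine ⟨w, hw, ?_⟩
      rintro y ⟨x, hx, rfl⟩
      exact hwE x hx
  | scheme Γ p hp V N hS q hq ih => exact ih.scheme hS hq

theorem Nice.pure (v : Γ) : Nice L M Γ (Pure.pure v : Ultrafilter Γ) := by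
  have := Nice.map (L := L) (M := M) PUnit Γ (Pure.pure PUnit.unit) (Nice.unit _) (fun _ => v)
    (by fun_prop)
  rwa [Ultrafilter.map_pure] at this

theorem Nice.prod {r : Ultrafilter Θ} (hr : Nice L M Θ r) {p : Ultrafilter Γ} (hp : Nice L M Γ p) :
    ∃ P : Ultrafilter (Θ × Γ), Nice L M (Θ × Γ) P ∧ ∀ D : Set (Θ × Γ), DSet L M D →
      (D ∈ P ↔ {v | {x | (v, x) ∈ D} ∈ p} ∈ r) := by
  induction hp with
  | unit p =>
    refine ⟨r.map fun v => (v, PUnit.unit), Nice.map _ _ r hr _ (by fun_prop), fun D hD => ?_⟩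
    rw [Ultrafilter.mem_map]
    have : ∀ v, {x | (v, x) ∈ D} ∈ p ↔ (v, PUnit.unit) ∈ D := by
      intro v
      constructor
      · intro h
        obtain ⟨x', hx'⟩ := Ultrafilter.nonempty_of_mem h
        exact hx'
      · intro h
        exact Filter.mem_of_superset Filter.univ_mem fun x _ => h
    simp only [this]
    rfl
  | map Γ Δ p hp g hg ih =>
    obtain ⟨P, hP, hP1⟩ := ih
    refine ⟨P.map fun z => (z.1, g z.2), Nice.map _ _ P hP _ (by fun_prop), fun D hD => ?_⟩
    rw [Ultrafilter.mem_map, hP1 _ (DSet.pre hD (by fun_prop))]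
    rfl
  | scheme Γ p hp V N hS q hq ih =>
    obtain ⟨P, hP, hP1⟩ := ih
    let V' : Set ((Θ × Γ) × M) := {a | (a.1.2, a.2) ∈ V}
    let N' : Set (((Θ × Γ) × M) × M) := {a | ((a.1.1.2, a.1.2), a.2) ∈ N}
    have hV := hS.hV
    have hN := hS.hN
    have hS' : Scheme L V' N' :=
      { hV := DSet.of (Dp.mem hV (by fun_prop))
        hN := DSet.of (Dp.mem hN (by fun_prop))
        self := fun x y h => hS.self x.2 y h
        trans := fun x y z h h' => hS.trans x.2 y z h h'
        tot := fun x y y' h h' => hS.tot x.2 y y' h h'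
        dich := fun x D hD => hS.dich x.2 D hD }
    obtain ⟨Q, hQ⟩ := exists_scheme_ultra hS' P
    refine ⟨Q.map fun z => (z.1.1, (z.1.2, z.2)),
      Nice.map _ _ Q (Nice.scheme _ P hP V' N' hS' Q hQ) _ (by fun_prop), fun D hD => ?_⟩
    rw [Ultrafilter.mem_map, hQ _ (DSet.pre hD (by fun_prop)), hP1]
    · have : ∀ v, {x | (v, x) ∈ D} ∈ q ↔ {x | Near V N x (fun z => (v, (x, z)) ∈ D)} ∈ p :=
        fun v => hq _ (DSet.of (Dp.mem hD (by fun_prop)))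
      simp only [this]
      rfl
    · refine Dp.ex (Dp.and (Dp.mem hS'.hV (by fun_prop)) (Dp.all (Dp.imp ?_ ?_)))
      · exact Dp.mem hS'.hN (by fun_prop)
      · exact Dp.mem hD (f := fun z : ((Θ × Γ) × M) × M => (z.1.1.1, (z.1.1.2, z.2))) (by fun_prop)

variable [LinearOrder M] [DOrd M] [OMin L M]

/-- `P` holds at the position `(a, ε)`: just left of `a`, at `a`, or just right of `a`. -/
def Holds (a : M) (ε : Fin 3) (P : M → Prop) : Prop :=
  (ε = 0 ∧ LN a P) ∨ (ε = 1 ∧ P a) ∨ (ε = 2 ∧ RN a P)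

theorem scheme_pt {f : Γ → M} (hf : DefFun L M f) :
    Scheme L {a : Γ × M | a.2 = f a.1} {a : (Γ × M) × M | a.2 = a.1.2} where
  hV := dfn
  hN := dfn
  self := fun x y h => rfl
  trans := by
    rintro x y z (h1 : y = f x) (h : z = y); subst h; exact ⟨h1, fun _ h => h⟩
  tot := by
    rintro x y y' (h1 : y = f x) (h : y' = f x); subst h1; subst h; exact Or.inl fun _ h => h
  dich := by
    intro x D hD
    by_cases h : f x ∈ D
    · exact Or.inl ⟨f x, rfl, by rintro z (rfl : z = f x); exact h⟩
    · exact Or.inr ⟨f x, rfl, by rintro z (rfl : z = f x); exact h⟩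

theorem near_pt {f : Γ → M} (x : Γ) (P : M → Prop) :
    Near {a : Γ × M | a.2 = f a.1} {a : (Γ × M) × M | a.2 = a.1.2} x P ↔ P (f x) := by
  constructor
  · rintro ⟨y, (rfl : y = f x), h⟩; exact h _ rfl
  · intro h; exact ⟨f x, rfl, by rintro z (rfl : z = f x); exact h⟩

theorem near_right {f : Γ → M} (x : Γ) (P : M → Prop) :
    Near {a : Γ × M | f a.1 < a.2} {a : (Γ × M) × M | f a.1.1 < a.2 ∧ a.2 ≤ a.1.2} x P ↔
      RN (f x) P := by
  constructor
  · rintro ⟨y, h1, h2⟩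
    exact ⟨y, h1, fun z h3 h4 => h2 z ⟨h3, h4.le⟩⟩
  · rintro ⟨b, h1, h2⟩
    obtain ⟨y, hy1, hy2⟩ := exists_between h1
    exact ⟨y, hy1, fun z hz => h2 z hz.1 (lt_of_le_of_lt hz.2 hy2)⟩

theorem scheme_right {f : Γ → M} (hf : DefFun L M f) :
    Scheme L {a : Γ × M | f a.1 < a.2} {a : (Γ × M) × M | f a.1.1 < a.2 ∧ a.2 ≤ a.1.2} where
  hV := dfn
  hN := dfn
  self := fun x y h => ⟨h, le_rfl⟩
  trans := fun x y z h h' => ⟨h'.1, fun w hw => ⟨hw.1, hw.2.trans h'.2⟩⟩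
  tot := fun x y y' h h' => (le_total y y').imp (fun h w hw => ⟨hw.1, hw.2.trans h⟩)
    (fun h w hw => ⟨hw.1, hw.2.trans h⟩)
  dich := by
    intro x D hD
    rw [near_right, near_right]
    exact rn_dich hD _

theorem near_top (x : Γ) (P : M → Prop) :
    Near (univ : Set (Γ × M)) {a : (Γ × M) × M | a.1.2 ≤ a.2} x P ↔ TN P := by
  constructor
  · rintro ⟨y, h1, h2⟩
    exact ⟨y, fun z h3 => h2 z h3.le⟩
  · rintro ⟨b, h1⟩
    obtain ⟨y, hy⟩ := exists_gt b
    exact ⟨y, trivial, fun z hz => h1 z (lt_of_lt_of_le hy hz)⟩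

theorem scheme_top : Scheme L (univ : Set (Γ × M)) {a : (Γ × M) × M | a.1.2 ≤ a.2} where
  hV := Dp.const True
  hN := dfn
  self := fun x y h => le_rfl
  trans := fun x y z h h' => ⟨trivial, fun w (hw : z ≤ w) => le_trans (b := z) h' hw⟩
  tot := fun x y y' h h' => (le_total y' y).imp (fun h w (hw : y ≤ w) => le_trans (b := y) h hw)
    (fun h w (hw : y' ≤ w) => le_trans (b := y') h hw)
  dich := by
    intro x D hD
    rw [near_top, near_top]
    exact tn_dich hD

theorem Nice.top {p : Ultrafilter Γ} (hp : Nice L M Γ p) : ∃ q : Ultrafilter (Γ × M), Nice L M (Γ × M) q ∧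
    ∀ D : Set (Γ × M), DSet L M D → (D ∈ q ↔ {x | TN (fun z => (x, z) ∈ D)} ∈ p) := by
  obtain ⟨q, hq⟩ := exists_scheme_ultra (L := L) (M := M) (Γ := Γ) scheme_top p
  refine ⟨q, Nice.scheme _ p hp _ _ scheme_top q hq, fun D hD => ?_⟩
  rw [hq D hD]
  simp only [near_top]

theorem Nice.bot {p : Ultrafilter Γ} (hp : Nice L M Γ p) : ∃ q : Ultrafilter (Γ × M), Nice L M (Γ × M) q ∧
    ∀ D : Set (Γ × M), DSet L M D → (D ∈ q ↔ {x | BN (fun z => (x, z) ∈ D)} ∈ p) :=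
  @Nice.top L M _ Γ _ (dualOrd M) DOrd.dual OMin.dual p hp

theorem Nice.right {p : Ultrafilter Γ} (hp : Nice L M Γ p) {f : Γ → M} (hf : DefFun L M f) :
    ∃ q : Ultrafilter (Γ × M), Nice L M (Γ × M) q ∧
    ∀ D : Set (Γ × M), DSet L M D → (D ∈ q ↔ {x | RN (f x) (fun z => (x, z) ∈ D)} ∈ p) := by
  obtain ⟨q, hq⟩ := exists_scheme_ultra (L := L) (M := M) (Γ := Γ) (scheme_right hf) p
  refine ⟨q, Nice.scheme _ p hp _ _ (scheme_right hf) q hq, fun D hD => ?_⟩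
  rw [hq D hD]
  simp only [near_right]

theorem Nice.left {p : Ultrafilter Γ} (hp : Nice L M Γ p) {f : Γ → M} (hf : DefFun L M f) :
    ∃ q : Ultrafilter (Γ × M), Nice L M (Γ × M) q ∧
    ∀ D : Set (Γ × M), DSet L M D → (D ∈ q ↔ {x | LN (f x) (fun z => (x, z) ∈ D)} ∈ p) :=
  @Nice.right L M _ Γ _ (dualOrd M) DOrd.dual OMin.dual p hp f hf

theorem Nice.point {p : Ultrafilter Γ} (hp : Nice L M Γ p) {f : Γ → M} (hf : DefFun L M f) :
    ∃ q : Ultrafilter (Γ × M), Nice L M (Γ × M) q ∧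
    ∀ D : Set (Γ × M), DSet L M D → (D ∈ q ↔ {x | (x, f x) ∈ D} ∈ p) := by
  obtain ⟨q, hq⟩ := exists_scheme_ultra (L := L) (M := M) (Γ := Γ) (scheme_pt hf) p
  refine ⟨q, Nice.scheme _ p hp _ _ (scheme_pt hf) q hq, fun D hD => ?_⟩
  rw [hq D hD]
  simp only [near_pt]

theorem Nice.holds {p : Ultrafilter Γ} (hp : Nice L M Γ p) {f : Γ → M} (hf : DefFun L M f) (ε : Fin 3) :
    ∃ q : Ultrafilter (Γ × M), Nice L M (Γ × M) q ∧
    ∀ D : Set (Γ × M), DSet L M D → (D ∈ q ↔ {x | Holds (f x) ε (fun z => (x, z) ∈ D)} ∈ p) := by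
  have : ε = 0 ∨ ε = 1 ∨ ε = 2 := by fin_cases ε <;> simp
  rcases this with rfl | rfl | rfl
  · simpa [Holds] using hp.left hf
  · simpa [Holds] using hp.point hf
  · simpa [Holds] using hp.right hf

end nice
end OM

namespace OM
section chain

variable {L : FirstOrder.Language} {M : Type u} [L.Structure M]
variable {Γ Δ Ξ Θ : Type u} [Coded M Γ] [Coded M Δ] [Coded M Ξ] [Coded M Θ]
variable [LinearOrder M] [DOrd M] [OMin L M]

theorem coded_induction (C : ∀ (Γ : Type u) [Coded M Γ], Prop) (h0 : C PUnit.{u+1})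
    (hs : ∀ (Γ : Type u) [Coded M Γ], C Γ → C (Γ × M))
    (ht : ∀ (Γ Δ : Type u) [Coded M Γ] [Coded M Δ] (g : Γ → Δ) (f : Δ → Γ), DefFun L M g →
      DefFun L M f → (∀ y, g (f y) = y) → C Γ → C Δ) (Γ : Type u) [Coded M Γ] : C Γ := by
  have h1 : ∀ n, C (Fin n → M) := by
    intro n
    induction n with
    | zero =>
      have e1 : DefFun L M (fun _ : PUnit.{u+1} => (Fin.elim0 : Fin 0 → M)) := by fun_prop
      have e2 : DefFun L M (fun _ : Fin 0 → M => PUnit.unit.{u+1}) := by fun_prop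
      exact ht PUnit.{u+1} (Fin 0 → M) _ _ e1 e2 (fun y => Subsingleton.elim _ _) h0
    | succ n ih =>
      have e1 : DefFun L M (fun z : (Fin n → M) × M => cns z.2 z.1) := by fun_prop
      have e2 : DefFun L M (fun x : Fin (n+1) → M => (tl x, x 0)) := by fun_prop
      exact ht ((Fin n → M) × M) _ _ _ e1 e2 (fun y => cns_tl y) (hs _ ih)
  obtain ⟨n, f, g, hf, hg, h2, h3⟩ := exists_code (L := L) M Γ
  exact ht _ _ g f hg hf h2 (h1 n)

/-- The chain property. -/
def ChainP (L : FirstOrder.Language) (M : Type u) [L.Structure M] (Γ : Type u) [Coded M Γ] : Prop :=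
  ∀ (Θ : Type u) [Coded M Θ] (Ω : Set Θ) (S : Set (Θ × Γ)), DSet L M Ω → DSet L M S →
    (∀ u ∈ Ω, ∃ x, (u, x) ∈ S) →
    (∀ u ∈ Ω, ∀ v ∈ Ω, (∀ x, (u, x) ∈ S → (v, x) ∈ S) ∨ (∀ x, (v, x) ∈ S → (u, x) ∈ S)) →
    ∃ r : Ultrafilter Γ, Nice L M Γ r ∧ ∀ u ∈ Ω, {x | (u, x) ∈ S} ∈ r

theorem chain_step (h : ChainP L M Γ) : ChainP L M (Γ × M) := by
  intro Θ _ Ω S hΩ hS hne hch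
  obtain ⟨p, hp, hpS⟩ := h Θ Ω {z | ∃ y, (z.1, (z.2, y)) ∈ S} hΩ dfn (by
      intro u hu
      obtain ⟨⟨x, y⟩, hxy⟩ := hne u hu
      exact ⟨x, y, hxy⟩) (by
      intro u hu v hv
      refine (hch u hu v hv).imp ?_ ?_
      · rintro h x ⟨y, hy⟩
        exact ⟨y, h _ hy⟩
      · rintro h x ⟨y, hy⟩
        exact ⟨y, h _ hy⟩)
  have hfib : ∀ u x, DSet L M {z | (u, (x, z)) ∈ S} := fun u x => dfn
  let Low : Γ → M → Prop := fun x y => ∃ u, u ∈ Ω ∧ (∃ z, (u, (x, z)) ∈ S) ∧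
    ∀ z, (u, (x, z)) ∈ S → y < z
  have hLow : DSet L M {z : Γ × M | Low z.1 z.2} := dfn
  have hdown : ∀ x y y', y' ≤ y → Low x y → Low x y' := by
    rintro x y y' hy ⟨u, h1, h2, h3⟩
    exact ⟨u, h1, h2, fun z hz => hy.trans_lt (h3 z hz)⟩
  have hkey : ∀ x y u, u ∈ Ω → (∃ z, (u, (x, z)) ∈ S) → Low x y → ∃ w ∈ Ω,
      (∃ z, (w, (x, z)) ∈ S) ∧ ∀ z, (w, (x, z)) ∈ S → (u, (x, z)) ∈ S ∧ y < z := by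
    rintro x y u hu hz ⟨v, h1, h2, h3⟩
    rcases hch u hu v h1 with h | h
    · exact ⟨u, hu, hz, fun z hz => ⟨hz, h3 _ (h _ hz)⟩⟩
    · exact ⟨v, h1, h2, fun z hz => ⟨h _ hz, h3 _ hz⟩⟩
  by_cases c1 : {x | ∀ y, ¬ Low x y} ∈ p
  · obtain ⟨q, hq, hq1⟩ := hp.bot
    refine ⟨q, hq, fun u hu => ?_⟩
    have hd : DSet L M {x | (u, x) ∈ S} := dfn
    rw [hq1 _ hd]
    refine Filter.mem_of_superset (Filter.inter_mem c1 (hpS u hu)) ?_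
    rintro x ⟨h1, h2⟩
    rcases bn_dich (hfib u x) with h | h
    · exact h
    · exfalso
      obtain ⟨b, hb⟩ := h
      obtain ⟨b', hb'⟩ := exists_lt b
      exact h1 b' ⟨u, hu, h2, fun z hz => hb'.trans_le (not_lt.1 fun h' => hb z h' hz)⟩
  by_cases c2 : {x | ∀ y, Low x y} ∈ p
  · obtain ⟨q, hq, hq1⟩ := hp.top
    refine ⟨q, hq, fun u hu => ?_⟩
    have hd : DSet L M {x | (u, x) ∈ S} := dfn
    rw [hq1 _ hd]
    refine Filter.mem_of_superset (Filter.inter_mem c2 (hpS u hu)) ?_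
    rintro x ⟨h1, h2⟩
    rcases tn_dich (hfib u x) with h | h
    · exact h
    · exfalso
      obtain ⟨b, hb⟩ := h
      obtain ⟨w, hw, ⟨z, hz⟩, hw2⟩ := hkey x b u hu h2 (h1 b)
      exact hb z (hw2 z hz).2 (hw2 z hz).1
  rw [← Ultrafilter.compl_mem_iff_notMem] at c1 c2
  obtain ⟨E, hE, hE1⟩ := exists_supF hLow
  have hadh : ∀ x, x ∈ ({x | ∀ y, ¬ Low x y}ᶜ : Set Γ) → x ∈ ({x | ∀ y, Low x y}ᶜ : Set Γ) →
      ∀ u ∈ Ω, (∃ z, (u, (x, z)) ∈ S) → ∃ ε, Holds (E x) ε (fun z => (u, (x, z)) ∈ S) := by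
    intro x h1 h2 u hu hz
    simp only [mem_compl_iff, mem_ofPred_eq, not_forall, not_not] at h1 h2
    obtain ⟨y2, hy2⟩ := h2
    have hl := hE1 x h1 ⟨y2, fun y hy => le_of_not_ge fun h => hy2 (hdown x y y2 h hy)⟩
    by_contra hcon
    push Not at hcon
    have n0 : ¬ LN (E x) (fun z => (u, (x, z)) ∈ S) := fun h => hcon 0 (Or.inl ⟨rfl, h⟩)
    have n1 : ¬ (u, (x, E x)) ∈ S := fun h => hcon 1 (Or.inr (Or.inl ⟨rfl, h⟩))
    have n2 : ¬ RN (E x) (fun z => (u, (x, z)) ∈ S) := fun h => hcon 2 (Or.inr (Or.inr ⟨rfl, h⟩))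
    have n : NR (E x) (fun z => (u, (x, z)) ∉ S) :=
      NR.of n1 ((rn_dich (hfib u x) _).resolve_left n2) ((ln_dich (hfib u x) _).resolve_left n0)
    obtain ⟨b, c, hb, hc, hbc⟩ := n
    obtain ⟨y, hy, hby⟩ : ∃ y, Low x y ∧ b ≤ y := by
      by_contra h
      push Not at h
      exact absurd (hl.2 fun y hy => (h y hy).le) (not_le.2 hb)
    obtain ⟨w, hw, hwz, hw2⟩ := hkey x y u hu hz hy
    obtain ⟨c', hc1, hc2⟩ := exists_between hc
    have : ¬ Low x c' := fun h => absurd (hl.1 h) (not_le.2 hc1)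
    have : ∃ z, (w, (x, z)) ∈ S ∧ z ≤ c' := by
      by_contra h
      push Not at h
      exact this ⟨w, hw, hwz, h⟩
    obtain ⟨z, hz1, hz2⟩ := this
    exact hbc z (hby.trans_lt (hw2 z hz1).2) (hz2.trans_lt hc2) (hw2 z hz1).1
  have hall : ∃ ε, ∀ u ∈ Ω, {x | Holds (E x) ε (fun z => (u, (x, z)) ∈ S)} ∈ p := by
    have hone : ∀ u ∈ Ω, ∃ ε, {x | Holds (E x) ε (fun z => (u, (x, z)) ∈ S)} ∈ p := by
      intro u hu
      have h1 : {x | ∃ ε, Holds (E x) ε (fun z => (u, (x, z)) ∈ S)} ∈ p :=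
        Filter.mem_of_superset (Filter.inter_mem (Filter.inter_mem c1 c2) (hpS u hu))
          fun x hx => hadh x hx.1.1 hx.1.2 u hu hx.2
      exact Ultrafilter.eventually_exists_iff.1 h1
    have hmono : ∀ ε u v, (∀ x, (u, x) ∈ S → (v, x) ∈ S) →
        {x | Holds (E x) ε (fun z => (u, (x, z)) ∈ S)} ∈ p →
        {x | Holds (E x) ε (fun z => (v, (x, z)) ∈ S)} ∈ p := by
      intro ε u v huv h
      refine Filter.mem_of_superset h fun x hx => ?_
      rcases hx with ⟨h1, h2⟩ | ⟨h1, h2⟩ | ⟨h1, h2⟩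
      · exact Or.inl ⟨h1, h2.mono fun z hz => huv _ hz⟩
      · exact Or.inr (Or.inl ⟨h1, huv _ h2⟩)
      · exact Or.inr (Or.inr ⟨h1, h2.mono fun z hz => huv _ hz⟩)
    by_contra hcon
    push Not at hcon
    choose w hw hw2 using hcon
    have hmin : ∀ a ∈ Ω, ∀ b ∈ Ω, ∃ c ∈ Ω, (∀ x, (c, x) ∈ S → (a, x) ∈ S) ∧
        (∀ x, (c, x) ∈ S → (b, x) ∈ S) := by
      intro a ha b hb
      rcases hch a ha b hb with h | h
      · exact ⟨a, ha, fun _ h => h, h⟩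
      · exact ⟨b, hb, h, fun _ h => h⟩
    obtain ⟨a, ha, ha0, ha1⟩ := hmin _ (hw 0) _ (hw 1)
    obtain ⟨b, hb, hba, hb2⟩ := hmin _ ha _ (hw 2)
    obtain ⟨ε, hε⟩ := hone b hb
    refine hw2 ε (hmono ε b _ ?_ hε)
    have : ε = 0 ∨ ε = 1 ∨ ε = 2 := by fin_cases ε <;> simp
    rcases this with rfl | rfl | rfl
    · exact fun x hx => ha0 x (hba x hx)
    · exact fun x hx => ha1 x (hba x hx)
    · exact hb2
  obtain ⟨ε, hε⟩ := hall
  obtain ⟨q, hq, hq1⟩ := hp.holds hE ε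
  refine ⟨q, hq, fun u hu => ?_⟩
  have hd : DSet L M {x | (u, x) ∈ S} := dfn
  rw [hq1 _ hd]
  exact hε u hu

theorem chain_all (Γ : Type u) [Coded M Γ] : ChainP L M Γ := by
  refine coded_induction (L := L) (M := M) (fun Γ _ => ChainP L M Γ) ?_ ?_ ?_ Γ
  · intro Θ _ Ω S hΩ hS hne hch
    refine ⟨Pure.pure PUnit.unit, Nice.unit _, fun u hu => ?_⟩
    obtain ⟨x, hx⟩ := hne u hu
    exact Filter.mem_of_superset Filter.univ_mem fun y _ => hx
  · exact fun Γ _ => chain_step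
  · intro Γ Δ _ _ g f hg hf hgf h Θ _ Ω S hΩ hS hne hch
    obtain ⟨r, hr, hr1⟩ := h Θ Ω {z | (z.1, g z.2) ∈ S} hΩ dfn (by
      intro u hu
      obtain ⟨y, hy⟩ := hne u hu
      exact ⟨f y, by simpa [hgf] using hy⟩) (by
      intro u hu v hv
      exact (hch u hu v hv).imp (fun h x hx => h _ hx) (fun h x hx => h _ hx))
    refine ⟨r.map g, Nice.map _ _ r hr g hg, fun u hu => ?_⟩
    rw [Ultrafilter.mem_map]
    exact hr1 u hu

/-- Consing in a coded type. -/
def cnsG {Θ : Type u} {k : ℕ} (s : Θ) (x : Fin k → Θ) : Fin (k+1) → Θ := Fin.cons s x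

@[fun_prop]
theorem DefFun.cnsG {k : ℕ} {f : Γ → Θ} {g : Γ → Fin k → Θ} (hf : DefFun L M f) (hg : DefFun L M g) :
    DefFun L M (fun x => OM.cnsG (f x) (g x)) := by
  apply DefFun.pi
  intro j
  induction j using Fin.cases with
  | zero => exact hf
  | succ i => exact (DefFun.apply i).comp hg

/-- The sign lemma: nondefinable sets cannot be separated definably in all sign patterns. -/
theorem sign_lemma (r : ℕ) (A : Fin r → Set Θ) (hA : ∀ i, ¬ DSet L M (A i))
    (Λ : (Fin r → Bool) → Set (Fin r → Θ)) (hΛ : ∀ ε, DSet L M (Λ ε))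
    (H1 : ∀ ε t, (∀ i, t i ∈ A i ↔ ε i = true) → t ∈ Λ ε)
    (H2 : ∀ ε t, (∀ i, t i ∈ A i ↔ ε i = false) → t ∉ Λ ε) : False := by
  induction r with
  | zero =>
    exact H2 Fin.elim0 Fin.elim0 (fun i => i.elim0) (H1 Fin.elim0 Fin.elim0 (fun i => i.elim0))
  | succ r ih =>
    have hT := hΛ
    refine ih (fun i => A i.succ) (fun i => hA i.succ)
      (fun ε => {t | ∃ s, cnsG s t ∈ Λ (Fin.cons true ε : Fin (r+1) → Bool) ∧
        cnsG s t ∈ Λ (Fin.cons false ε : Fin (r+1) → Bool)}) ?_ ?_ ?_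
    · intro ε
      have h1 := hΛ (Fin.cons true ε : Fin (r+1) → Bool)
      have h2 := hΛ (Fin.cons false ε : Fin (r+1) → Bool)
      exact Dp.ex (Dp.and (Dp.mem h1 (by fun_prop)) (Dp.mem h2 (by fun_prop)))
    · intro ε t ht
      by_contra hcon
      simp only [mem_ofPred_eq, not_exists, not_and] at hcon
      apply hA 0
      have h1 := hΛ (Fin.cons true ε : Fin (r+1) → Bool)
      have h2 : DSet L M {s | cnsG s t ∈ Λ (Fin.cons true ε : Fin (r+1) → Bool)} :=
        DSet.of (Dp.mem h1 (by fun_prop))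
      convert h2 using 1
      ext s
      constructor
      · intro hs
        refine H1 _ _ fun i => ?_
        induction i using Fin.cases with
        | zero => simpa [cnsG] using hs
        | succ i => simpa [cnsG] using ht i
      · intro hs
        by_contra hs2
        refine hcon s hs (H1 _ _ fun i => ?_)
        induction i using Fin.cases with
        | zero => simpa [cnsG] using hs2
        | succ i => simpa [cnsG] using ht i
    · rintro ε t ht ⟨s, hs1, hs2⟩
      by_cases hs : s ∈ A 0
      · refine H2 _ _ (fun i => ?_) hs2
        induction i using Fin.cases with
        | zero => simpa [cnsG] using hs
        | succ i => simpa [cnsG] using ht i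
      · refine H2 _ _ (fun i => ?_) hs1
        induction i using Fin.cases with
        | zero => simpa [cnsG] using hs
        | succ i => simpa [cnsG] using ht i

end chain
end OM

namespace OM
section pierce

variable {L : FirstOrder.Language} {M : Type u} [L.Structure M]
variable {Γ Δ Ξ Θ : Type u} [Coded M Γ] [Coded M Δ] [Coded M Ξ] [Coded M Θ]
variable [LinearOrder M] [DOrd M] [OMin L M]

/-- The piercing lemma. -/
theorem piercing {K : Type*} [LinearOrder K] {J C : Type} [Finite J] [Finite C]
    (q : Ultrafilter Θ) (Ω : Set Θ) (hΩ : DSet L M Ω) (hq : Ω ∈ q) (τ : J → Θ → K)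
    (hτ : ∀ i j, DSet L M {z : Θ × Θ | τ i z.1 < τ j z.2}) (lo up : C → J)
    (hle : ∀ c, ∀ u ∈ Ω, τ (lo c) u ≤ τ (up c) u)
    (pair : ∀ u ∈ Ω, ∀ v ∈ Ω, ∃ c d, τ (lo c) u ≤ τ (up d) v ∧ τ (lo d) v ≤ τ (up c) u) :
    ∃ (c : C) (j : J) (r : Ultrafilter Θ), Nice L M Θ r ∧
      ∀ᶠ u in (q : Filter Θ), ∀ᶠ v in (r : Filter Θ), τ (lo c) u ≤ τ j v ∧ τ j v ≤ τ (up c) u := by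
  classical
  have T : ∀ {Ξ : Type u} [Coded M Ξ] (i j : J) (f g : Ξ → Θ), DefFun L M f → DefFun L M g →
      Dp L M (fun x => τ i (f x) < τ j (g x)) := by
    intro Ξ _ i j f g hf hg
    exact Dp.comp (f := fun x => (f x, g x)) (hτ i j) (by fun_prop)
  by_contra hcon
  simp only [not_exists, not_and] at hcon
  let A : C → J → Set Θ := fun c j => {v | ∀ᶠ u in (q : Filter Θ), τ j v < τ (lo c) u}
  have hA : ∀ c j v, v ∈ A c j → ∀ᶠ u in (q : Filter Θ), τ j v < τ (lo c) u := fun c j v h => h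
  have hnA : ∀ c j v, v ∉ A c j → ∀ᶠ u in (q : Filter Θ), τ (up c) u < τ j v := by
    intro c j v hv
    have h1 : ¬ ∀ᶠ u in (q : Filter Θ), τ (lo c) u ≤ τ j v ∧ τ j v ≤ τ (up c) u := by
      intro h
      refine hcon c j (Pure.pure v) (Nice.pure v) (h.mono fun u hu => ?_)
      exact hu
    have h2 : ∀ᶠ u in (q : Filter Θ), ¬ τ j v < τ (lo c) u := Ultrafilter.eventually_not.2 hv
    have h3 := Ultrafilter.eventually_not.2 h1
    filter_upwards [h2, h3] with u h2 h3
    by_contra h4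
    exact h3 ⟨not_lt.1 h2, not_lt.1 h4⟩
  have hΩe : ∀ᶠ u in (q : Filter Θ), u ∈ Ω := hq
  -- case I
  have hI : ∀ c, DSet L M (A c (lo c)) → A c (lo c) ∈ q → A c (up c) ∈ q := by
    intro c hd hin
    by_contra hup
    have hupe : ∀ᶠ u in (q : Filter Θ), u ∉ A c (up c) := Ultrafilter.eventually_not.2 hup
    have hine : ∀ᶠ u in (q : Filter Θ), u ∈ A c (lo c) := hin
    obtain ⟨r, hr, hr1⟩ := chain_all (L := L) (M := M) Θ Θ (A c (lo c) ∩ Ω)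
      {z : Θ × Θ | z.2 ∈ A c (lo c) ∧ ¬ τ (lo c) z.2 < τ (lo c) z.1} (Dp.and hd hΩ)
      (DSet.of (Dp.and (Dp.mem hd (by fun_prop)) (Dp.not (T _ _ _ _ (by fun_prop) (by fun_prop)))))
      (fun u hu => ⟨u, hu.1, lt_irrefl _⟩) (by
        intro u hu v hv
        rcases le_total (τ (lo c) u) (τ (lo c) v) with h | h
        · exact Or.inr fun x hx => ⟨hx.1, not_lt.2 (h.trans (not_lt.1 hx.2))⟩
        · exact Or.inl fun x hx => ⟨hx.1, not_lt.2 (h.trans (not_lt.1 hx.2))⟩)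
    refine hcon c (lo c) r hr ?_
    filter_upwards [hupe, hine, hΩe] with u h1 h2 h3
    refine Filter.mem_of_superset (hr1 u ⟨h2, h3⟩) ?_
    rintro v ⟨hv1, hv2⟩
    refine ⟨not_lt.1 hv2, ?_⟩
    obtain ⟨w, hw1, hw2, hw3⟩ := ((hnA c _ u h1).and ((hA c _ v hv1).and hΩe)).exists
    exact (hw2.trans_le ((hle c w hw3).trans hw1.le)).le
  -- separation
  let Sep : C → C → Θ → Prop := fun c d v =>
    ∀ᶠ u in (q : Filter Θ), τ (up c) u < τ (lo d) v ∨ τ (up d) v < τ (lo c) u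
  let Dfb : C → Prop := fun d => DSet L M (A d (lo d)) ∧ DSet L M (A d (up d))
  have hB : ∀ c d, ∃ B : Set Θ, DSet L M B ∧ B ∈ q ∧
      ((∃ j, A c j ≠ A d j) ∨ Dfb d → ∀ v ∈ B, Sep c d v) := by
    intro c d
    by_cases h1 : ∃ j, A c j ≠ A d j
    · obtain ⟨j, hj⟩ := h1
      have : ∃ w, (w ∈ A c j ∧ w ∉ A d j) ∨ (w ∈ A d j ∧ w ∉ A c j) := by
        by_contra h
        push Not at h
        exact hj (Set.ext fun w => ⟨(h w).1, (h w).2⟩)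
      obtain ⟨w, ⟨w1, w2⟩ | ⟨w1, w2⟩⟩ := this
      · refine ⟨{v | τ (up d) v < τ j w}, DSet.of (T _ _ _ _ (by fun_prop) (by fun_prop)),
          hnA d j w w2, fun _ v hv => ?_⟩
        filter_upwards [hA c j w w1] with u hu
        exact Or.inr (lt_trans hv hu)
      · refine ⟨{v | τ j w < τ (lo d) v}, DSet.of (T _ _ _ _ (by fun_prop) (by fun_prop)),
          hA d j w w1, fun _ v hv => ?_⟩
        filter_upwards [hnA c j w w2] with u hu
        exact Or.inl (lt_trans hu hv)
    · by_cases h2 : Dfb d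
      · push Not at h1
        by_cases h3 : A d (lo d) ∈ q
        · refine ⟨A d (up d), h2.2, hI d h2.1 h3, fun _ v hv => ?_⟩
          rw [← h1] at hv
          filter_upwards [hA c _ v hv] with u hu
          exact Or.inr hu
        · refine ⟨(A d (lo d))ᶜ, h2.1.compl, Ultrafilter.compl_mem_iff_notMem.2 h3,
            fun _ v hv => ?_⟩
          rw [← h1] at hv
          filter_upwards [hnA c _ v hv] with u hu
          exact Or.inl hu
      · exact ⟨univ, Dp.const True, Filter.univ_mem, fun h => absurd h (by tauto)⟩
  choose B hB1 hB2 hB3 using hB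
  let Ω' : Set Θ := {v | v ∈ Ω ∧ ∀ c d, v ∈ B c d}
  have hΩ' : DSet L M Ω' := Dp.and hΩ (Dp.allFin fun c => Dp.allFin fun d => hB1 c d)
  have hqΩ' : ∀ᶠ v in (q : Filter Θ), v ∈ Ω' :=
    hΩe.and (Filter.eventually_all.2 fun c => Filter.eventually_all.2 fun d => hB2 c d)
  have hsel : ∀ d, ¬ Dfb d → ∃ j, ¬ DSet L M (A d j) := by
    intro d hd
    by_contra h
    push Not at h
    exact hd ⟨h _, h _⟩
  obtain ⟨n, ⟨e⟩⟩ := Finite.exists_equiv_fin {d : C // ¬ Dfb d}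
  choose jd hjd using fun i : Fin n => hsel (e.symm i).1 (e.symm i).2
  let dd : Fin n → C := fun i => (e.symm i).1
  refine sign_lemma (L := L) (M := M) n (fun i => A (dd i) (jd i)) hjd
    (fun ε => {t | ∃ v, v ∈ Ω' ∧ ∀ i, (ε i = true → τ (jd i) (t i) < τ (lo (dd i)) v) ∧
      (ε i = false → τ (up (dd i)) v < τ (jd i) (t i))}) ?_ ?_ ?_
  · intro ε
    refine DSet.of (Dp.ex (Dp.and (Dp.mem hΩ' (by fun_prop)) (Dp.allFin fun i => Dp.and
      (Dp.imp (Dp.const _) (T _ _ _ _ (by fun_prop) (by fun_prop)))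
      (Dp.imp (Dp.const _) (T _ _ _ _ (by fun_prop) (by fun_prop))))))
  · intro ε t ht
    have h1 : ∀ i, ∀ᶠ v in (q : Filter Θ), (ε i = true → τ (jd i) (t i) < τ (lo (dd i)) v) ∧
      (ε i = false → τ (up (dd i)) v < τ (jd i) (t i)) := by
      intro i
      by_cases hi : ε i = true
      · filter_upwards [hA _ _ _ ((ht i).2 hi)] with v hv
        exact ⟨fun _ => hv, fun h => by simp [hi] at h⟩
      · filter_upwards [hnA _ _ _ (fun h => hi ((ht i).1 h))] with v hv
        exact ⟨fun h => absurd h hi, fun _ => hv⟩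
    obtain ⟨v, hv⟩ := (hqΩ'.and (Filter.eventually_all.2 h1)).exists
    exact ⟨v, hv.1, hv.2⟩
  · rintro ε t ht ⟨v, hv, hvt⟩
    have hsep : ∀ c d, Sep c d v := by
      intro c d
      by_cases h1 : (∃ j, A c j ≠ A d j) ∨ Dfb d
      · exact hB3 c d h1 v (hv.2 c d)
      push Not at h1
      obtain ⟨h1, h2⟩ := h1
      obtain ⟨i, hi⟩ : ∃ i, dd i = d := ⟨e ⟨d, h2⟩, by simp [dd]⟩
      have h3 := hvt i
      have h4 := ht i
      simp only [hi, ← h1] at h3 h4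
      by_cases hε : ε i = true
      · have : t i ∉ A c (jd i) := fun h => by simp [h4.1 h] at hε
        filter_upwards [hnA _ _ _ this] with u hu
        exact Or.inl (hu.trans (h3.1 hε))
      · have hε' : ε i = false := by simpa using hε
        filter_upwards [hA _ _ _ (h4.2 hε')] with u hu
        exact Or.inr ((h3.2 hε').trans hu)
    obtain ⟨u, hu1, hu2⟩ := (hΩe.and (Filter.eventually_all.2 fun c =>
      Filter.eventually_all.2 fun d => hsep c d)).exists
    obtain ⟨c, d, h5, h6⟩ := pair u hu1 v hv.1
    rcases hu2 c d with h | h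
    · exact absurd h (not_lt.2 h6)
    · exact absurd h (not_lt.2 h5)

end pierce
end OM

namespace OM
section germs

/-- Lexicographic sum of ultrapowers. -/
abbrev KK {N : ℕ} {Γ P : Type*} [LinearOrder P] (p : Fin N → Ultrafilter Γ) :=
  Σₗ t : Fin N, Filter.Germ (p t : Filter Γ) P

/-- The germ of a function in a summand. -/
def kmk {N : ℕ} {Γ P : Type*} [LinearOrder P] (p : Fin N → Ultrafilter Γ) (t : Fin N) (g : Γ → P) :
    KK (P := P) p := toLex ⟨t, (g : Filter.Germ (p t : Filter Γ) P)⟩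

theorem kmk_lt_same {N : ℕ} {Γ P : Type*} [LinearOrder P] (p : Fin N → Ultrafilter Γ) (t : Fin N)
    (g h : Γ → P) : kmk p t g < kmk p t h ↔ ∀ᶠ x in (p t : Filter Γ), g x < h x := by
  rw [← Filter.Germ.coe_lt]
  refine Sigma.Lex.lt_def.trans ⟨?_, fun h => Or.inr ⟨rfl, h⟩⟩
  rintro (h | ⟨_, h⟩)
  · exact absurd h (lt_irrefl t)
  · exact h

theorem kmk_lt_ne {N : ℕ} {Γ P : Type*} [LinearOrder P] (p : Fin N → Ultrafilter Γ) (t t' : Fin N)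
    (ht : t ≠ t') (g h : Γ → P) : kmk p t g < kmk p t' h ↔ t < t' := by
  refine Sigma.Lex.lt_def.trans ⟨?_, fun h => Or.inl h⟩
  rintro (h | ⟨h, _⟩)
  · exact h
  · exact absurd h ht

theorem kmk_le_same {N : ℕ} {Γ P : Type*} [LinearOrder P] (p : Fin N → Ultrafilter Γ) (t : Fin N)
    (g h : Γ → P) : kmk p t g ≤ kmk p t h ↔ ∀ᶠ x in (p t : Filter Γ), g x ≤ h x := by
  rw [← not_lt, kmk_lt_same, ← Ultrafilter.eventually_not]
  simp only [not_lt]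

theorem kmk_le_fst {N : ℕ} {Γ P : Type*} [LinearOrder P] (p : Fin N → Ultrafilter Γ) (t t' : Fin N)
    (g h : Γ → P) (hh : kmk p t g ≤ kmk p t' h) : t ≤ t' := by
  by_contra hcon
  exact absurd ((kmk_lt_ne p t' t (fun e => hcon e.symm.le) h g).2 (not_le.1 hcon)) (not_lt.2 hh)

end germs
section main

variable {L : FirstOrder.Language} {M : Type u} [L.Structure M]
variable {Γ Δ Ξ Θ : Type u} [Coded M Γ] [Coded M Δ] [Coded M Ξ] [Coded M Θ]
variable [LinearOrder M] [DOrd M] [OMin L M]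

/-- Every consistent definable family is covered by finitely many nice ultrafilters. -/
def Cov (L : FirstOrder.Language) (M : Type u) [L.Structure M] (Γ : Type u) [Coded M Γ] : Prop :=
  ∀ (Θ : Type u) [Coded M Θ] (Ω : Set Θ) (S : Set (Θ × Γ)), DSet L M Ω → DSet L M S →
    (∀ F : Finset Θ, ↑F ⊆ Ω → ∃ x, ∀ u ∈ F, (u, x) ∈ S) →
    ∃ T : Set (Ultrafilter Γ), T.Finite ∧ (∀ p ∈ T, Nice L M Γ p) ∧
      ∀ u ∈ Ω, ∃ p ∈ T, {x | (u, x) ∈ S} ∈ p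

theorem compactness (Ω : Set Θ) (S : Set (Θ × Γ))
    (h : ∀ q : Ultrafilter Θ, Ω ∈ q → ∃ p : Ultrafilter Γ, Nice L M Γ p ∧
      ∀ᶠ u in (q : Filter Θ), {x | (u, x) ∈ S} ∈ p) :
    ∃ T : Set (Ultrafilter Γ), T.Finite ∧ (∀ p ∈ T, Nice L M Γ p) ∧
      ∀ u ∈ Ω, ∃ p ∈ T, {x | (u, x) ∈ S} ∈ p := by
  by_contra hcon
  let F : Filter Θ :=
    { sets := {A | ∃ T : Set (Ultrafilter Γ), T.Finite ∧ (∀ p ∈ T, Nice L M Γ p) ∧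
        ∀ u ∈ Ω, u ∈ A ∨ ∃ p ∈ T, {x | (u, x) ∈ S} ∈ p}
      univ_sets := ⟨∅, finite_empty, by simp, by simp⟩
      sets_of_superset := by
        rintro A B ⟨T, h1, h2, h3⟩ hAB
        exact ⟨T, h1, h2, fun u hu => (h3 u hu).imp_left fun h => hAB h⟩
      inter_sets := by
        rintro A B ⟨T, h1, h2, h3⟩ ⟨T', h1', h2', h3'⟩
        refine ⟨T ∪ T', h1.union h1', ?_, ?_⟩
        · rintro p (hp | hp)
          · exact h2 p hp
          · exact h2' p hp
        · intro u hu
          rcases h3 u hu with h | ⟨p, hp, hp'⟩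
          · rcases h3' u hu with h' | ⟨p, hp, hp'⟩
            · exact Or.inl ⟨h, h'⟩
            · exact Or.inr ⟨p, Or.inr hp, hp'⟩
          · exact Or.inr ⟨p, Or.inl hp, hp'⟩ }
  have hmem : ∀ A, A ∈ F ↔ ∃ T : Set (Ultrafilter Γ), T.Finite ∧ (∀ p ∈ T, Nice L M Γ p) ∧
        ∀ u ∈ Ω, u ∈ A ∨ ∃ p ∈ T, {x | (u, x) ∈ S} ∈ p := fun A => Iff.rfl
  have : F.NeBot := by
    refine ⟨fun hb => ?_⟩
    have h1 : (∅ : Set Θ) ∈ F := by rw [hb]; trivial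
    rw [hmem] at h1
    obtain ⟨T, h1, h2, h3⟩ := h1
    exact hcon ⟨T, h1, h2, fun u hu => (h3 u hu).resolve_left (by simp)⟩
  obtain ⟨p, hp, hpq⟩ := h (Ultrafilter.of F) (Ultrafilter.of_le F
    ((hmem _).2 ⟨∅, finite_empty, by simp, fun u hu => Or.inl hu⟩))
  have h2 : {u | {x | (u, x) ∈ S} ∈ p}ᶜ ∈ Ultrafilter.of F := by
    refine Ultrafilter.of_le F ((hmem _).2 ⟨{p}, finite_singleton _, by simpa using hp, ?_⟩)
    intro u hu
    by_cases hh : {x | (u, x) ∈ S} ∈ p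
    · exact Or.inr ⟨p, rfl, hh⟩
    · exact Or.inl hh
  exact Ultrafilter.compl_notMem_iff.2 hpq h2

/-- Position in the ordered set of cuts. -/
def pos (a : M) (ε : Fin 3) : M ×ₗ Fin 3 := toLex (a, ε)

theorem pos_le {a b : M} {ε δ : Fin 3} : pos a ε ≤ pos b δ ↔ a < b ∨ a = b ∧ ε ≤ δ :=
  Prod.Lex.toLex_le_toLex
theorem pos_lt {a b : M} {ε δ : Fin 3} : pos a ε < pos b δ ↔ a < b ∨ a = b ∧ ε < δ :=
  Prod.Lex.toLex_lt_toLex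

/-- All positions in a closed interval hold. -/
def Blk (a : M) (ε : Fin 3) (b : M) (δ : Fin 3) (P : M → Prop) : Prop :=
  pos a ε ≤ pos b δ ∧ ∀ y η, pos a ε ≤ pos y η → pos y η ≤ pos b δ → Holds y η P

theorem fin3 (ε : Fin 3) : ε = 0 ∨ ε = 1 ∨ ε = 2 := by fin_cases ε <;> simp

theorem exists_blk {s : Set M} (hs : DSet L M s) (hb : ¬ BN (fun y => y ∈ s))
    (ht : ¬ TN (fun y => y ∈ s)) {y : M} (hy : y ∈ s) :
    ∃ a ∈ bd s, ∃ b ∈ bd s, ∃ ε δ, Blk a ε b δ (fun y => y ∈ s) ∧ pos a ε ≤ pos y 1 ∧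
      pos y 1 ≤ pos b δ := by
  by_cases hyb : y ∈ bd s
  · refine ⟨y, hyb, y, hyb, 1, 1, ⟨le_rfl, ?_⟩, le_rfl, le_rfl⟩
    intro z η h1 h2
    have h3 : pos z η = pos y 1 := le_antisymm h2 h1
    have h4 : z = y ∧ η = 1 := by simpa [pos] using h3
    obtain ⟨rfl, rfl⟩ := h4
    exact Or.inr (Or.inl ⟨rfl, hy⟩)
  have hfin := bd_finite hs
  have e1 : ({a | a ∈ bd s ∧ a < y} : Set M).Nonempty := by
    by_contra hcon
    rw [Set.not_nonempty_iff_eq_empty] at hcon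
    refine hb ⟨y, fun z hz => ?_⟩
    refine (mem_iff_of_no_bd hs hz.le fun x h1 h2 h3 => ?_).2 hy
    rcases h2.lt_or_eq with h | rfl
    · have : x ∈ ({a | a ∈ bd s ∧ a < y} : Set M) := ⟨h3, h⟩
      rw [hcon] at this
      exact this
    · exact hyb h3
  have e2 : ({a | a ∈ bd s ∧ y < a} : Set M).Nonempty := by
    by_contra hcon
    rw [Set.not_nonempty_iff_eq_empty] at hcon
    refine ht ⟨y, fun z hz => ?_⟩
    refine (mem_iff_of_no_bd hs hz.le fun x h1 h2 h3 => ?_).1 hy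
    rcases h1.lt_or_eq with h | rfl
    · have : x ∈ ({a | a ∈ bd s ∧ y < a} : Set M) := ⟨h3, h⟩
      rw [hcon] at this
      exact this
    · exact hyb h3
  obtain ⟨a, ⟨ha, hay⟩, ha2⟩ := Set.exists_max_image _ id (hfin.subset fun a h => h.1) e1
  obtain ⟨b, ⟨hbb, hyb'⟩, hb2⟩ := Set.exists_min_image _ id (hfin.subset fun a h => h.1) e2
  have hno : ∀ x, a < x → x < b → x ∉ bd s := by
    intro x h1 h2 h3
    rcases lt_trichotomy x y with h | rfl | h
    · exact absurd (ha2 x ⟨h3, h⟩) (not_le.2 h1)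
    · exact hyb h3
    · exact absurd (hb2 x ⟨h3, h⟩) (not_le.2 h2)
  have hin : ∀ x, a < x → x < b → x ∈ s := by
    intro x h1 h2
    rcases le_total x y with h | h
    · exact (mem_iff_of_no_bd hs h fun z hz hz' =>
        hno z (h1.trans_le hz) (hz'.trans_lt hyb')).2 hy
    · exact (mem_iff_of_no_bd hs h fun z hz hz' =>
        hno z (hay.trans_le hz) (hz'.trans_lt h2)).1 hy
  refine ⟨a, ha, b, hbb, 2, 0, ⟨pos_le.2 (Or.inl (hay.trans hyb')), ?_⟩, pos_le.2 (Or.inl hay),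
    pos_le.2 (Or.inl hyb')⟩
  intro z η h1 h2
  rw [pos_le] at h1 h2
  rcases h1 with h1 | ⟨rfl, h1⟩
  · rcases h2 with h2 | ⟨rfl, h2⟩
    · rcases fin3 η with rfl | rfl | rfl
      · exact Or.inl ⟨rfl, a, h1, fun x hx hx' => hin x hx' (hx.trans h2)⟩
      · exact Or.inr (Or.inl ⟨rfl, hin z h1 h2⟩)
      · exact Or.inr (Or.inr ⟨rfl, b, h2, fun x hx hx' => hin x (h1.trans hx) hx'⟩)
    · have : η = 0 := by simpa using h2
      subst this
      exact Or.inl ⟨rfl, a, h1, fun x hx hx' => hin x hx' hx⟩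
  · have : η = 2 := by
      rcases fin3 η with rfl | rfl | rfl
      · simp at h1
      · simp at h1
      · rfl
    subst this
    rcases h2 with h2 | ⟨rfl, h2⟩
    · exact Or.inr (Or.inr ⟨rfl, b, h2, fun x hx hx' => hin x hx hx'⟩)
    · simp at h2

theorem Dp.holds {f : Γ → M} {P : Γ → M → Prop} (ε : Fin 3) (hf : DefFun L M f)
    (hP : Dp L M (fun z : Γ × M => P z.1 z.2)) : Dp L M (fun x => Holds (f x) ε (P x)) := by
  unfold Holds
  have h1 : Dp L M (fun x => P x (f x)) := Dp.comp (f := fun x => (x, f x)) hP (by fun_prop)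
  exact Dp.or (Dp.and (Dp.const _) (Dp.LN hf hP)) (Dp.or (Dp.and (Dp.const _) h1)
    (Dp.and (Dp.const _) (Dp.RN hf hP)))

theorem Dp.posle {f g : Γ → M} (ε δ : Fin 3) (hf : DefFun L M f) (hg : DefFun L M g) :
    Dp L M (fun x => pos (f x) ε ≤ pos (g x) δ) := by
  simp only [pos_le]
  exact Dp.or (Dp.lt hf hg) (Dp.and (Dp.eq hf hg) (Dp.const _))

theorem Dp.blk {f g : Γ → M} {P : Γ → M → Prop} (ε δ : Fin 3) (hf : DefFun L M f)
    (hg : DefFun L M g) (hP : Dp L M (fun z : Γ × M => P z.1 z.2)) :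
    Dp L M (fun x => Blk (f x) ε (g x) δ (P x)) := by
  unfold Blk
  refine Dp.and (Dp.posle _ _ hf hg) (Dp.all (Dp.allFin fun η => Dp.imp
    (Dp.posle _ _ (by fun_prop) (by fun_prop)) (Dp.imp
    (Dp.posle _ _ (by fun_prop) (by fun_prop)) (Dp.holds η (by fun_prop) ?_))))
  exact Dp.comp (f := fun z : (Γ × M) × M => (z.1.1, z.2)) hP (by fun_prop)

end main
end OM

namespace OM
section covstep

variable {L : FirstOrder.Language} {M : Type u} [L.Structure M]
variable {Γ Δ Ξ Θ : Type u} [Coded M Γ] [Coded M Δ] [Coded M Ξ] [Coded M Θ]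
variable [LinearOrder M] [DOrd M] [OMin L M]

theorem cov_step (h : Cov L M Γ) : Cov L M (Γ × M) := by
  classical
  intro Θ _ Ω S hΩ hS hfip
  obtain ⟨T0, hT0, hT0n, hT0c⟩ := h (Θ × Θ) {a | a.1 ∈ Ω ∧ a.2 ∈ Ω}
    {z | ∃ y, (z.1.1, (z.2, y)) ∈ S ∧ (z.1.2, (z.2, y)) ∈ S} dfn dfn (by
      intro F hF
      obtain ⟨⟨x, y⟩, hxy⟩ := hfip (F.image Prod.fst ∪ F.image Prod.snd) (by
        intro u hu
        simp only [Finset.coe_union, Finset.coe_image, mem_union, mem_image] at hu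
        rcases hu with ⟨a, ha, rfl⟩ | ⟨a, ha, rfl⟩
        · exact (hF ha).1
        · exact (hF ha).2)
      refine ⟨x, fun a ha => ⟨y, hxy _ ?_, hxy _ ?_⟩⟩
      · exact Finset.mem_union_left _ (Finset.mem_image_of_mem _ ha)
      · exact Finset.mem_union_right _ (Finset.mem_image_of_mem _ ha))
  obtain ⟨N, p', hp', hcov⟩ : ∃ (N : ℕ) (p' : Fin N → Ultrafilter Γ), (∀ t, Nice L M Γ (p' t)) ∧
      ∀ u ∈ Ω, ∀ v ∈ Ω, ∃ t, ∀ᶠ x in (p' t : Filter Γ), ∃ y, (u, (x, y)) ∈ S ∧ (v, (x, y)) ∈ S := by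
    have := hT0.to_subtype
    obtain ⟨N, ⟨e⟩⟩ := Finite.exists_equiv_fin T0
    refine ⟨N, fun t => (e.symm t).1, fun t => hT0n _ (e.symm t).2, fun u hu v hv => ?_⟩
    obtain ⟨p, hp, hp2⟩ := hT0c (u, v) ⟨hu, hv⟩
    refine ⟨e ⟨p, hp⟩, ?_⟩
    simp only [Equiv.symm_apply_apply]
    exact hp2
  have hfib : ∀ u x, DSet L M {y | (u, (x, y)) ∈ S} := fun u x => dfn
  have hSd : Dp L M (fun z : (Θ × Γ) × M => (z.1.1, (z.1.2, z.2)) ∈ S) :=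
    Dp.mem hS (by fun_prop)
  obtain ⟨k, f, hf, hfb⟩ := UF_fun (L := L)
    (D := {z : (Θ × Γ) × M | z.2 ∈ bd {y | (z.1.1, (z.1.2, y)) ∈ S}})
    (by unfold bd; simp only [mem_ofPred_eq]; exact dfn) (fun z => bd_finite (hfib z.1 z.2))
  refine compactness Ω S fun q hq => ?_
  by_cases hray1 : ∃ t, ∀ᶠ u in (q : Filter Θ), {x | BN (fun y => (u, (x, y)) ∈ S)} ∈ p' t
  · obtain ⟨t, ht⟩ := hray1
    obtain ⟨p, hp, hp1⟩ := (hp' t).bot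
    refine ⟨p, hp, ht.mono fun u hu => ?_⟩
    have hd : DSet L M {x | (u, x) ∈ S} := dfn
    rw [hp1 _ hd]
    exact hu
  by_cases hray2 : ∃ t, ∀ᶠ u in (q : Filter Θ), {x | TN (fun y => (u, (x, y)) ∈ S)} ∈ p' t
  · obtain ⟨t, ht⟩ := hray2
    obtain ⟨p, hp, hp1⟩ := (hp' t).top
    refine ⟨p, hp, ht.mono fun u hu => ?_⟩
    have hd : DSet L M {x | (u, x) ∈ S} := dfn
    rw [hp1 _ hd]
    exact hu
  push Not at hray1 hray2
  let CC := Fin N × (Fin k × Fin 3) × (Fin k × Fin 3)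
  let Bk : CC → Θ → Γ → Prop := fun c u x =>
    Blk (f c.2.1.1 (u, x)) c.2.1.2 (f c.2.2.1 (u, x)) c.2.2.2 (fun y => (u, (x, y)) ∈ S)
  have hBk : ∀ c, Dp L M (fun z : Θ × Γ => Bk c z.1 z.2) := by
    intro c
    have h1 := hf c.2.1.1
    have h2 := hf c.2.2.1
    exact Dp.blk _ _ (by fun_prop) (by fun_prop) hSd
  let Val : CC → Θ → Prop := fun c u => {x | Bk c u x} ∈ p' c.1
  have hVal : ∀ c, Dp L M (Val c) := fun c => (hp' c.1).good.dp (DSet.of (hBk c))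
  let Q : CC → Prop := fun c => ∀ᶠ u in (q : Filter Θ), Val c u
  let Ω0 : Set Θ := {u | u ∈ Ω ∧ (∀ c, Val c u ↔ Q c) ∧
    (∀ t, ¬ {x | BN (fun y => (u, (x, y)) ∈ S)} ∈ p' t) ∧
    (∀ t, ¬ {x | TN (fun y => (u, (x, y)) ∈ S)} ∈ p' t)}
  have hΩ0 : DSet L M Ω0 := by
    refine Dp.and hΩ (Dp.and (Dp.allFin fun c => Dp.iff (hVal c) (Dp.const _)) (Dp.and
      (Dp.allFin fun t => Dp.not ?_) (Dp.allFin fun t => Dp.not ?_)))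
    · exact (hp' t).good.dp (D := {z : Θ × Γ | BN (fun y => (z.1, (z.2, y)) ∈ S)}) dfn
    · exact (hp' t).good.dp (D := {z : Θ × Γ | TN (fun y => (z.1, (z.2, y)) ∈ S)}) dfn
  have hqΩ0 : Ω0 ∈ q := by
    have e1 : ∀ᶠ u in (q : Filter Θ), u ∈ Ω := hq
    have e2 : ∀ᶠ u in (q : Filter Θ), ∀ c, (Val c u ↔ Q c) := by
      rw [Filter.eventually_all]
      intro c
      by_cases hQ : Q c
      · exact Filter.Eventually.mono hQ fun u hu => ⟨fun _ => hQ, fun _ => hu⟩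
      · exact (Ultrafilter.eventually_not.2 hQ).mono fun u hu =>
          ⟨fun h => absurd h hu, fun h => absurd h hQ⟩
    have e3 := Filter.eventually_all.2 hray1
    have e4 := Filter.eventually_all.2 hray2
    exact e1.and (e2.and (e3.and e4))
  let C := {c : CC // Q c}
  let J := Fin N × (Fin k × Fin 3)
  let τ : J → Θ → KK (P := M ×ₗ Fin 3) p' := fun j u =>
    kmk p' j.1 (fun x => pos (f j.2.1 (u, x)) j.2.2)
  have hτ : ∀ i j, DSet L M {z : Θ × Θ | τ i z.1 < τ j z.2} := by
    rintro ⟨t, i, ε⟩ ⟨t', j, δ⟩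
    by_cases ht : t = t'
    · subst ht
      have h1 := hf i
      have h2 := hf j
      have : DSet L M {z : (Θ × Θ) × Γ | pos (f i (z.1.1, z.2)) ε < pos (f j (z.1.2, z.2)) δ} := by
        simp only [pos_lt]
        exact dfn
      refine ((hp' t).good.dp this).congr fun z => ?_
      exact (kmk_lt_same p' t (fun x => pos (f i (z.1, x)) ε)
        (fun x => pos (f j (z.2, x)) δ)).symm
    · refine (Dp.const (t < t')).congr fun z => ?_
      exact (kmk_lt_ne p' t t' ht _ _).symm
  obtain ⟨c, ⟨t', i, ε⟩, r, hr, hpierce⟩ := piercing (L := L) (M := M) (C := C) q Ω0 hΩ0 hqΩ0 τ hτ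
    (fun c => (c.1.1, c.1.2.1)) (fun c => (c.1.1, c.1.2.2)) (by
      rintro ⟨c, hc⟩ u hu
      have h1 := (hu.2.1 c).2 hc
      refine (kmk_le_same p' c.1 _ _).2 (Filter.Eventually.mono h1 fun x hx => hx.1)) (by
      intro u hu v hv
      obtain ⟨t, ht⟩ := hcov u hu.1 v hv.1
      have n1 := Ultrafilter.eventually_not.2 (hu.2.2.1 t)
      have n2 := Ultrafilter.eventually_not.2 (hu.2.2.2 t)
      have n3 := Ultrafilter.eventually_not.2 (hv.2.2.1 t)
      have n4 := Ultrafilter.eventually_not.2 (hv.2.2.2 t)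
      have hex : ∀ u x, ¬ BN (fun y => (u, (x, y)) ∈ S) → ¬ TN (fun y => (u, (x, y)) ∈ S) →
          ∀ y, (u, (x, y)) ∈ S → ∃ a : (Fin k × Fin 3) × (Fin k × Fin 3), Bk (t, a) u x ∧
            pos (f a.1.1 (u, x)) a.1.2 ≤ pos y 1 ∧ pos y 1 ≤ pos (f a.2.1 (u, x)) a.2.2 := by
        intro u x h1 h2 y hy
        obtain ⟨a, ha, b, hb, ε, δ, h3, h4, h5⟩ := exists_blk (hfib u x) h1 h2 hy
        obtain ⟨i, rfl⟩ := hfb (u, x) a ha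
        obtain ⟨j, rfl⟩ := hfb (u, x) b hb
        exact ⟨((i, ε), (j, δ)), h3, h4, h5⟩
      have hev : ∀ᶠ x in (p' t : Filter Γ), ∃ a : (Fin k × Fin 3) × (Fin k × Fin 3),
          ∃ b : (Fin k × Fin 3) × (Fin k × Fin 3), (Bk (t, a) u x ∧ Bk (t, b) v x) ∧
          pos (f a.1.1 (u, x)) a.1.2 ≤ pos (f b.2.1 (v, x)) b.2.2 ∧
          pos (f b.1.1 (v, x)) b.1.2 ≤ pos (f a.2.1 (u, x)) a.2.2 := by
        filter_upwards [ht, n1, n2, n3, n4] with x hx n1 n2 n3 n4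
        obtain ⟨y, hy1, hy2⟩ := hx
        obtain ⟨a, ha1, ha2, ha3⟩ := hex u x n1 n2 y hy1
        obtain ⟨b, hb1, hb2, hb3⟩ := hex v x n3 n4 y hy2
        exact ⟨a, b, ⟨ha1, hb1⟩, ha2.trans hb3, hb2.trans ha3⟩
      obtain ⟨a, hev⟩ := Ultrafilter.eventually_exists_iff.1 hev
      obtain ⟨b, hev⟩ := Ultrafilter.eventually_exists_iff.1 hev
      refine ⟨⟨(t, a), (hu.2.1 (t, a)).1 (hev.mono fun x hx => hx.1.1)⟩,
        ⟨(t, b), (hv.2.1 (t, b)).1 (hev.mono fun x hx => hx.1.2)⟩, ?_, ?_⟩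
      · exact (kmk_le_same p' t _ _).2 (hev.mono fun x hx => hx.2.1)
      · exact (kmk_le_same p' t _ _).2 (hev.mono fun x hx => hx.2.2))
  obtain ⟨⟨t, a⟩, hc⟩ := c
  have htt : t = t' := by
    obtain ⟨u, hu⟩ := hpierce.exists
    obtain ⟨v, hv1, hv2⟩ := hu.exists
    exact le_antisymm (kmk_le_fst p' _ _ _ _ hv1) (kmk_le_fst p' _ _ _ _ hv2)
  subst htt
  obtain ⟨P, hP, hP1⟩ := hr.prod (hp' t)
  have hfi := hf i
  obtain ⟨p, hp, hp1⟩ := hP.holds hfi ε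
  refine ⟨p.map (fun z => (z.1.2, z.2)), Nice.map _ _ p hp _ (by fun_prop), ?_⟩
  have hΩe : ∀ᶠ u in (q : Filter Θ), u ∈ Ω0 := hqΩ0
  filter_upwards [hpierce, hΩe] with u hu hu0
  rw [Ultrafilter.mem_map]
  have hd1 : DSet L M ((fun z : (Θ × Γ) × M => (z.1.2, z.2)) ⁻¹' {x | (u, x) ∈ S}) :=
    DSet.of (Dp.mem (f := fun z : (Θ × Γ) × M => (u, (z.1.2, z.2))) hS (by fun_prop))
  rw [hp1 _ hd1]
  have hd2 : DSet L M {z : Θ × Γ | Holds (f i z) ε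
      (fun y => (z, y) ∈ ((fun z : (Θ × Γ) × M => (z.1.2, z.2)) ⁻¹' {x | (u, x) ∈ S}))} :=
    DSet.of (Dp.holds ε hfi hd1)
  rw [hP1 _ hd2]
  refine Filter.mem_of_superset hu ?_
  rintro v ⟨hv1, hv2⟩
  have hv1 := (kmk_le_same p' t _ _).1 hv1
  have hv2 := (kmk_le_same p' t _ _).1 hv2
  have hval : ∀ᶠ x in (p' t : Filter Γ), Bk (t, a) u x := (hu0.2.1 (t, a)).2 hc
  show ∀ᶠ x in (p' t : Filter Γ), _
  filter_upwards [hv1, hv2, hval] with x h1 h2 h3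
  exact h3.2 _ _ h1 h2

theorem cov_all (Γ : Type u) [Coded M Γ] : Cov L M Γ := by
  refine coded_induction (L := L) (M := M) (fun Γ _ => Cov L M Γ) ?_ ?_ ?_ Γ
  · intro Θ _ Ω S hΩ hS hfip
    refine ⟨{Pure.pure PUnit.unit}, finite_singleton _, ?_, ?_⟩
    · intro p _
      exact Nice.unit _
    · intro u hu
      obtain ⟨x, hx⟩ := hfip {u} (by simpa using hu)
      refine ⟨_, rfl, Filter.mem_of_superset Filter.univ_mem fun y _ => ?_⟩
      exact hx u (by simp)
  · exact fun Γ _ => cov_step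
  · intro Γ Δ _ _ g f hg hf hgf h Θ _ Ω S hΩ hS hfip
    obtain ⟨T, hT, hTn, hTc⟩ := h Θ Ω {z | (z.1, g z.2) ∈ S} hΩ dfn (by
      intro F hF
      obtain ⟨y, hy⟩ := hfip F hF
      exact ⟨f y, fun u hu => by simpa [hgf] using hy u hu⟩)
    refine ⟨(fun p => p.map g) '' T, hT.image _, ?_, fun u hu => ?_⟩
    · rintro _ ⟨p, hp, rfl⟩
      exact Nice.map _ _ p (hTn p hp) g hg
    · obtain ⟨p, hp, hp1⟩ := hTc u hu
      refine ⟨_, ⟨p, hp, rfl⟩, ?_⟩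
      rw [Ultrafilter.mem_map]
      exact hp1

end covstep
end OM

namespace OM
section final

variable {L : FirstOrder.Language} {M : Type u} [L.Structure M]
variable {Γ Δ Ξ Θ : Type u} [Coded M Γ] [Coded M Δ] [Coded M Ξ] [Coded M Θ]

theorem dset_iff {J : Type} [Finite J] {D : Set (J → M)} :
    DSet L M D ↔ (univ : Set M).Definable L D := by
  constructor
  · intro h
    have := Set.Definable.preimage_comp (fun z : J × Unit => z.1) h
    exact this
  · intro h
    have := Set.Definable.preimage_comp (fun z : J => (z, ())) h
    exact this

theorem fam_to {k : ℕ} {C : Set (Set (Fin k → M))} (h : IsDefFamily L (univ : Set M) k C) :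
    ∃ (m : ℕ) (Ω : Set (Fin m → M)) (S : Set ((Fin m → M) × (Fin k → M))), DSet L M Ω ∧
      DSet L M S ∧ C = (fun u => {x | (u, x) ∈ S}) '' Ω := by
  obtain ⟨m, Ω, D, hΩ, hD, rfl⟩ := h
  refine ⟨m, Ω, {z | Sum.elim z.1 z.2 ∈ D}, dset_iff.2 hΩ, ?_, rfl⟩
  have hD := dset_iff.2 hD
  have hs : DefFun L M (fun z : (Fin m → M) × (Fin k → M) => Sum.elim z.1 z.2) := by
    refine DefFun.pi fun j => ?_
    rcases j with j | j
    · exact (DefFun.apply j).comp (DefFun.fst DefFun.id)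
    · exact (DefFun.apply j).comp (DefFun.snd DefFun.id)
  exact DSet.of (Dp.mem hD hs)

theorem fam_of {k : ℕ} {W : Set Θ} {S : Set (Θ × (Fin k → M))} (hW : DSet L M W)
    (hS : DSet L M S) : IsDefFamily L (univ : Set M) k ((fun w => {x | (w, x) ∈ S}) '' W) := by
  obtain ⟨m, f, g, hf, hg, h1, h2⟩ := exists_code (L := L) M Θ
  refine ⟨m, {y | g y ∈ W}, {z | (g (fun i => z (Sum.inl i)), fun i => z (Sum.inr i)) ∈ S},
    dset_iff.1 (DSet.of (Dp.mem hW hg)), dset_iff.1 (DSet.of (Dp.mem hS (by fun_prop))), ?_⟩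
  ext Y
  constructor
  · rintro ⟨w, hw, rfl⟩
    refine ⟨f w, ?_, ?_⟩
    · simpa [h1] using hw
    · ext x
      simp [famFiber, h1]
  · rintro ⟨y, hy, rfl⟩
    refine ⟨g y, hy, ?_⟩
    ext x
    simp [famFiber]

variable [LinearOrder M] [DOrd M] [OMin L M]

theorem limit_point {k : ℕ} {X : Set (Fin k → M)} [TopologicalSpace ↥X]
    (hX : IsDefTopSpace L X) (hc : DefinablyCompact L X) {Ω : Set Θ} {S : Set (Θ × (Fin k → M))}
    (hS : DSet L M S) (hcl : ∀ u ∈ Ω, TauClosed X {x | (u, x) ∈ S}) {p : Ultrafilter (Fin k → M)}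
    (hp : Nice L M (Fin k → M) p) (hne : ∃ u ∈ Ω, {x | (u, x) ∈ S} ∈ p) :
    ∃ x ∈ X, ∀ u ∈ Ω, {x | (u, x) ∈ S} ∈ p → (u, x) ∈ S := by
  obtain ⟨hXd, Bs, hBf, hBX, hbasis⟩ := hX
  obtain ⟨m, ΩB, U, hΩB, hU, rfl⟩ := fam_to hBf
  have hXd := dset_iff.2 hXd
  obtain ⟨Θ', _, W, D', hW, hD', h1, h2, h3⟩ := hp.good Θ S hS
  obtain ⟨u0, hu0, hu0p⟩ := hne
  have hXp : X ∈ p := Filter.mem_of_superset hu0p (hcl u0 hu0).1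
  let E : Set (Θ' × (Fin k → M)) := {z | z.2 ∈ X ∧ ∀ b, b ∈ ΩB → (b, z.2) ∈ U →
    ∃ y, (b, y) ∈ U ∧ y ∈ X ∧ (z.1, y) ∈ D'}
  have hE : DSet L M E := dfn
  have hEcl : ∀ w, (Subtype.val ⁻¹' {x | (w, x) ∈ E} : Set ↥X) =
      closure (Subtype.val ⁻¹' {x | (w, x) ∈ D'} : Set ↥X) := by
    intro w
    ext ⟨x, hx⟩
    rw [hbasis.mem_closure_iff]
    constructor
    · rintro ⟨_, h⟩ _ ⟨_, ⟨b, hb, rfl⟩, rfl⟩ hxo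
      obtain ⟨y, hy1, hy2, hy3⟩ := h b hb hxo
      exact ⟨⟨y, hy2⟩, hy1, hy3⟩
    · intro h
      refine ⟨hx, fun b hb hbx => ?_⟩
      obtain ⟨⟨y, hy⟩, hy1, hy2⟩ := h _ ⟨_, ⟨b, hb, rfl⟩, rfl⟩ hbx
      exact ⟨y, hy1, hy, hy2⟩
  have hsub : ∀ w x, x ∈ X → (w, x) ∈ D' → (w, x) ∈ E := fun w x hx h =>
    ⟨hx, fun b _ hb => ⟨x, hb, hx, h⟩⟩
  have hEne : ∀ w ∈ W, ({x | (w, x) ∈ E} : Set (Fin k → M)).Nonempty := by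
    intro w hw
    obtain ⟨x, hx1, hx2⟩ := Ultrafilter.nonempty_of_mem (Filter.inter_mem hXp (h1 w hw))
    exact ⟨x, hsub w x hx1 hx2⟩
  have hx0 : (⋂₀ ((fun w => {x | (w, x) ∈ E}) '' W)).Nonempty := by
    refine hc _ (fam_of hW hE) ⟨?_, ?_⟩ ?_
    · rintro ⟨w, hw, h⟩
      have := hEne w hw
      simp only at h
      rw [h] at this
      exact Set.not_nonempty_empty this
    · rintro _ ⟨w, hw, rfl⟩ _ ⟨w', hw', rfl⟩
      obtain ⟨w'', hw'', h⟩ := h2 w hw w' hw'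
      refine ⟨_, ⟨w'', hw'', rfl⟩, ?_⟩
      rintro x ⟨hx, hx2⟩
      refine ⟨⟨hx, fun b hb hbx => ?_⟩, ⟨hx, fun b hb hbx => ?_⟩⟩
      · obtain ⟨y, hy1, hy2, hy3⟩ := hx2 b hb hbx
        exact ⟨y, hy1, hy2, (h y hy3).1⟩
      · obtain ⟨y, hy1, hy2, hy3⟩ := hx2 b hb hbx
        exact ⟨y, hy1, hy2, (h y hy3).2⟩
    · rintro _ ⟨w, hw, rfl⟩
      refine ⟨hEne w hw, fun x hx => hx.1, ?_⟩
      simp only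
      rw [hEcl]
      exact isClosed_closure
  obtain ⟨x, hx⟩ := hx0
  have hxE : ∀ w ∈ W, (w, x) ∈ E := fun w hw => hx _ ⟨w, hw, rfl⟩
  obtain ⟨w0, hw0, _⟩ := h3 u0 hu0p
  have hxX := (hxE w0 hw0).1
  refine ⟨x, hxX, fun u hu hup => ?_⟩
  obtain ⟨w, hw, hw2⟩ := h3 u hup
  have hm : (⟨x, hxX⟩ : ↥X) ∈ (Subtype.val ⁻¹' {x | (w, x) ∈ E} : Set ↥X) := hxE w hw
  rw [hEcl] at hm
  exact closure_minimal (fun y hy => hw2 y.1 hy) (hcl u hu).2 hm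

theorem forward {k : ℕ} {X : Set (Fin k → M)} [TopologicalSpace ↥X]
    (hX : IsDefTopSpace L X) (hc : DefinablyCompact L X) (C : Set (Set (Fin k → M)))
    (hC : IsDefFamily L (Set.univ : Set M) k C) (hcl : ∀ Y ∈ C, TauClosed X Y)
    (hcons : ∀ F : Finset (Set (Fin k → M)), ↑F ⊆ C →
      (⋂₀ (F : Set (Set (Fin k → M)))).Nonempty) :
    ∃ T : Finset (Fin k → M), ↑T ⊆ X ∧ ∀ Y ∈ C, ∃ x ∈ T, x ∈ Y := by
  classical
  obtain ⟨m, Ω, S, hΩ, hS, rfl⟩ := fam_to hC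
  obtain ⟨T, hT, hTn, hTc⟩ := cov_all (L := L) (M := M) (Fin k → M) (Fin m → M) Ω S hΩ hS (by
    intro F hF
    obtain ⟨x, hx⟩ := hcons (F.image fun u => {x | (u, x) ∈ S}) (by
      intro Y hY
      simp only [Finset.coe_image] at hY
      obtain ⟨u, hu, rfl⟩ := hY
      exact ⟨u, hF hu, rfl⟩)
    refine ⟨x, fun u hu => ?_⟩
    have := hx {x | (u, x) ∈ S} (by
      simp only [Finset.coe_image]
      exact ⟨u, hu, rfl⟩)
    exact this)
  have hlim : ∀ p : {p // p ∈ T ∧ ∃ u ∈ Ω, {x | (u, x) ∈ S} ∈ p}, ∃ x ∈ X, ∀ u ∈ Ω,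
      {x | (u, x) ∈ S} ∈ p.1 → (u, x) ∈ S := fun p =>
    limit_point hX hc hS (fun u hu => hcl _ ⟨u, hu, rfl⟩) (hTn p.1 p.2.1) p.2.2
  choose pt hpt1 hpt2 using hlim
  have hfin : Finite {p // p ∈ T ∧ ∃ u ∈ Ω, {x | (u, x) ∈ S} ∈ p} :=
    (hT.subset (fun p hp => hp.1) : {p | p ∈ T ∧ ∃ u ∈ Ω, {x | (u, x) ∈ S} ∈ p}.Finite).to_subtype
  refine ⟨(Set.finite_range pt).toFinset, ?_, ?_⟩
  · intro x hx
    simp only [Set.Finite.coe_toFinset] at hx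
    obtain ⟨p, rfl⟩ := hx
    exact hpt1 p
  · rintro _ ⟨u, hu, rfl⟩
    obtain ⟨p, hp, hup⟩ := hTc u hu
    refine ⟨pt ⟨p, hp, u, hu, hup⟩, ?_, hpt2 _ u hu hup⟩
    simp

theorem backward {k : ℕ} {X : Set (Fin k → M)} [TopologicalSpace ↥X]
    (h : ∀ C : Set (Set (Fin k → M)), IsDefFamily L (Set.univ : Set M) k C →
        (∀ Y ∈ C, TauClosed X Y) →
        (∀ F : Finset (Set (Fin k → M)), ↑F ⊆ C → (⋂₀ (F : Set (Set (Fin k → M)))).Nonempty) →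
        ∃ T : Finset (Fin k → M), ↑T ⊆ X ∧ ∀ Y ∈ C, ∃ x ∈ T, x ∈ Y) : DefinablyCompact L X := by
  classical
  intro C hC hdir hcl
  rcases C.eq_empty_or_nonempty with rfl | ⟨Y0, hY0⟩
  · rw [sInter_empty]
    exact ⟨fun _ => Classical.arbitrary M, trivial⟩
  have hlow : ∀ F : Finset (Set (Fin k → M)), ↑F ⊆ C → ∃ Z ∈ C, ∀ Y ∈ F, Z ⊆ Y := by
    intro F
    induction F using Finset.induction_on with
    | empty => exact fun _ => ⟨Y0, hY0, by simp⟩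
    | insert Y F hY ih =>
      intro hF
      obtain ⟨Z, hZ, hZF⟩ := ih (fun A hA => hF (by simp only [Finset.coe_insert]; exact Or.inr hA))
      obtain ⟨Z', hZ', hZ2⟩ := hdir.2 Z hZ Y (hF (by simp))
      refine ⟨Z', hZ', fun A hA => ?_⟩
      rcases Finset.mem_insert.1 hA with rfl | hA
      · exact fun x hx => (hZ2 hx).2
      · exact fun x hx => hZF A hA (hZ2 hx).1
  obtain ⟨T, hTX, hT⟩ := h C hC (fun Y hY => (hcl Y hY).2) (by
    intro F hF
    obtain ⟨Z, hZ, hZF⟩ := hlow F hF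
    obtain ⟨x, hx⟩ := (hcl Z hZ).1
    exact ⟨x, fun Y hY => hZF Y hY hx⟩)
  by_contra hcon
  have : ∀ x, ∃ Y ∈ C, x ∉ Y := by
    intro x
    by_contra hx
    push Not at hx
    exact hcon ⟨x, fun Y hY => hx Y hY⟩
  choose Y hY1 hY2 using this
  obtain ⟨Z, hZ, hZF⟩ := hlow (T.image Y) (by
    intro A hA
    simp only [Finset.coe_image] at hA
    obtain ⟨x, hx, rfl⟩ := hA
    exact hY1 x)
  obtain ⟨x, hxT, hxZ⟩ := hT Z hZ
  exact hY2 x (hZF _ (Finset.mem_image_of_mem _ hxT) hxZ)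

end final
end OM

/-- a definable topological space `(X,τ)` is definably compact if and only if
every consistent definable family of `τ`-closed subsets of `X` has a finite transversal
contained in `X`. -/
theorem statement14 (L : FirstOrder.Language) (M : Type*) [L.Structure M] [LinearOrder M]
    (hM : IsOMinimal L M) (k : ℕ) (X : Set (Fin k → M)) [TopologicalSpace ↥X]
    (hX : IsDefTopSpace L X) :
    DefinablyCompact L X ↔
      ∀ C : Set (Set (Fin k → M)), IsDefFamily L (Set.univ : Set M) k C →
        (∀ Y ∈ C, TauClosed X Y) →
        (∀ F : Finset (Set (Fin k → M)), ↑F ⊆ C → (⋂₀ (F : Set (Set (Fin k → M)))).Nonempty) →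
        ∃ T : Finset (Fin k → M), ↑T ⊆ X ∧ ∀ Y ∈ C, ∃ x ∈ T, x ∈ Y := by
  haveI : OM.OMin L M := ⟨hM⟩
  haveI : OM.DOrd M := OM.DOrd.of hM
  exact ⟨fun hc C hC hcl hcons => OM.forward hX hc C hC hcl hcons, fun h => OM.backward h⟩
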